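/- For every simple polygon P in the Euclidean plane such that the geodesic distance between any two distinct vertices of P is at least 1, there exists a vertex guard set G of P such that the geodesic distance between any two distinct guards of G is at least 2 (i.e., G has dispersion distance at least 2). -/

import Mathlib

open Set Metric
open scoped ENNReal

noncomputable section

/-- The Euclidean plane. -/
abbrev Plane : Type := EuclideanSpace ℝ (Fin 2)

/-- A *simple polygon*: the compact region of the plane bounded by a simple
closed polygonal curve, together with the cyclic sequence of vertices of that
curve.  The field `carrier` is the region (boundary included); the field
`frontier_eq` states that the topological boundary of the region is exactly
the closed polygonal curve through the vertices, and the fields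
`edges_adjacent`/`edges_disjoint` state that this curve is simple. -/
structure SimplePolygon where
  /-- the number of vertices -/
  n : ℕ
  /-- a polygon has at least three vertices -/
  three_le : 3 ≤ n
  /-- the vertices, in cyclic order along the boundary curve -/
  vertex : ZMod n → Plane
  /-- the compact region bounded by the polygonal curve -/
  carrier : Set Plane
  isCompact : IsCompact carrier
  isConnected : IsConnected carrier
  /-- the region is the closure of its interior (it is a genuine
  two-dimensional region) -/
  regular : carrier = closure (interior carrier)
  /-- the topological boundary of the region is the union of the edges of the
  closed polygonal curve through the vertices -/
  frontier_eq : frontier carrier = ⋃ i : ZMod n, segment ℝ (vertex i) (vertex (i + 1))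
  /-- the vertices are pairwise distinct -/
  vertex_injective : Function.Injective vertex
  /-- consecutive edges of the curve meet exactly in their common vertex -/
  edges_adjacent : ∀ i : ZMod n,
    segment ℝ (vertex i) (vertex (i + 1)) ∩ segment ℝ (vertex (i + 1)) (vertex (i + 2)) =
      {vertex (i + 1)}
  /-- non-adjacent edges of the curve are disjoint -/
  edges_disjoint : ∀ i j : ZMod n, i ≠ j → i + 1 ≠ j → j + 1 ≠ i →
    Disjoint (segment ℝ (vertex i) (vertex (i + 1))) (segment ℝ (vertex j) (vertex (j + 1)))

/-- The geodesic distance between `p` and `q` inside the set `P`: the infimum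
of the lengths (total variations) of continuous paths from `p` to `q` staying
in `P`.  (Non-rectifiable paths have length `∞` and hence do not contribute.) -/
def geodesicDist (P : Set Plane) (p q : Plane) : ℝ≥0∞ :=
  ⨅ (γ : ℝ → Plane) (_ : ContinuousOn γ (Icc 0 1)) (_ : γ 0 = p) (_ : γ 1 = q)
    (_ : MapsTo γ (Icc 0 1) P), eVariationOn γ (Icc 0 1)

/-- `p` sees `q` within `P` if the closed segment `[p,q]` is contained in `P`. -/
def Sees (P : Set Plane) (p q : Plane) : Prop :=
  segment ℝ p q ⊆ P

/-- `G` is a guard set for `P` if `G ⊆ P` and every point of `P` is seen by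
some point of `G`. -/
def IsGuardSet (P : Set Plane) (G : Set Plane) : Prop :=
  G ⊆ P ∧ ∀ x ∈ P, ∃ g ∈ G, Sees P g x

/-- A vertex guard set of a simple polygon: a guard set consisting of
vertices of the polygon. -/
def SimplePolygon.IsVertexGuardSet (P : SimplePolygon) (G : Set Plane) : Prop :=
  G ⊆ Set.range P.vertex ∧ IsGuardSet P.carrier G

/-- The dispersion distance of a guard set `G` in `P`: the infimum of the
geodesic distances between pairs of distinct guards. -/
def dispersionDist (P : Set Plane) (G : Set Plane) : ℝ≥0∞ :=
  ⨅ (g : Plane) (_ : g ∈ G) (h : Plane) (_ : h ∈ G) (_ : g ≠ h), geodesicDist P g h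

/-- The vertex `P.vertex i` is *reflex* (interior angle strictly greater than
`180°`): sufficiently close to the vertex, the segment joining a point of the
incoming edge to a point of the outgoing edge (both distinct from the vertex)
always leaves the polygon. -/
def SimplePolygon.IsReflexAt (P : SimplePolygon) (i : ZMod P.n) : Prop :=
  ∃ δ > (0 : ℝ), ∀ a ∈ segment ℝ (P.vertex (i - 1)) (P.vertex i),
    ∀ c ∈ segment ℝ (P.vertex i) (P.vertex (i + 1)),
      a ≠ P.vertex i → c ≠ P.vertex i →
      dist a (P.vertex i) < δ → dist c (P.vertex i) < δ →
      ¬ segment ℝ a c ⊆ P.carrier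

/-- The vertices of `P` are labeled in counterclockwise order: the shoelace
signed area of the vertex cycle is positive. -/
def SimplePolygon.IsCCW (P : SimplePolygon) : Prop :=
  0 < ∑ i ∈ Finset.range P.n,
    (P.vertex (i : ZMod P.n) 0 * P.vertex ((i : ZMod P.n) + 1) 1 -
      P.vertex ((i : ZMod P.n) + 1) 0 * P.vertex (i : ZMod P.n) 1)



/-- Planar cross product on `ℂ`. -/
def cr (u v : ℂ) : ℝ := u.re * v.im - u.im * v.re

/-- A simple polygon in `ℂ`. -/
structure CPoly where
  n : ℕ
  three_le : 3 ≤ n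
  V : ZMod n → ℂ
  P : Set ℂ
  cpt : IsCompact P
  conn : IsConnected P
  reg : P ⊆ closure (interior P)
  fr : frontier P = ⋃ i : ZMod n, segment ℝ (V i) (V (i + 1))
  inj : Function.Injective V
  adj : ∀ i : ZMod n,
    segment ℝ (V i) (V (i + 1)) ∩ segment ℝ (V (i + 1)) (V (i + 2)) = {V (i + 1)}
  disj : ∀ i j : ZMod n, i ≠ j → i + 1 ≠ j → j + 1 ≠ i →
    Disjoint (segment ℝ (V i) (V (i + 1))) (segment ℝ (V j) (V (j + 1)))

namespace CPoly

variable (Q : CPoly)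

/-- The `i`-th edge. -/
def E (i : ZMod Q.n) : Set ℂ := segment ℝ (Q.V i) (Q.V (i + 1))

lemma neZero : NeZero Q.n := ⟨by have := Q.three_le; omega⟩

lemma finite_idx : Finite (ZMod Q.n) := by
  have := Q.neZero
  infer_instance

lemma one_ne_zero' : (1 : ZMod Q.n) ≠ 0 := by
  have : Fact (1 < Q.n) := ⟨by have := Q.three_le; omega⟩
  exact one_ne_zero

lemma two_ne_zero' : (2 : ZMod Q.n) ≠ 0 := by
  intro h
  have h2 : ((2 : ℕ) : ZMod Q.n) = 0 := by exact_mod_cast h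
  rw [ZMod.natCast_eq_zero_iff] at h2
  have := Nat.le_of_dvd (by norm_num) h2
  have := Q.three_le
  omega

lemma succ_ne (i : ZMod Q.n) : i + 1 ≠ i := by
  intro h
  exact Q.one_ne_zero' (by simpa using h)

lemma closed : IsClosed Q.P := Q.cpt.isClosed

lemma fr_sub : frontier Q.P ⊆ Q.P := Q.closed.frontier_subset

lemma mem_fr {x : ℂ} : x ∈ frontier Q.P ↔ ∃ i, x ∈ Q.E i := by
  rw [Q.fr]; simp [E]

lemma E_sub (i : ZMod Q.n) : Q.E i ⊆ Q.P := fun _ hx => Q.fr_sub (Q.mem_fr.2 ⟨i, hx⟩)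

lemma V_mem_fr (i : ZMod Q.n) : Q.V i ∈ frontier Q.P :=
  Q.mem_fr.2 ⟨i, left_mem_segment _ _ _⟩

lemma V_mem (i : ZMod Q.n) : Q.V i ∈ Q.P := Q.fr_sub (Q.V_mem_fr i)

lemma V_ne_succ (i : ZMod Q.n) : Q.V i ≠ Q.V (i + 1) := fun h => Q.succ_ne i (Q.inj h).symm

lemma not_fr_int {x : ℂ} (hx : x ∈ Q.P) (h : x ∉ frontier Q.P) : x ∈ interior Q.P := by
  by_contra h'
  exact h ⟨subset_closure hx, h'⟩

/-- Two edges sharing a point: equal or adjacent, sharing a vertex. -/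
lemma edge_inter {i j : ZMod Q.n} {x : ℂ} (hi : x ∈ Q.E i) (hj : x ∈ Q.E j) :
    i = j ∨ (i + 1 = j ∧ x = Q.V j) ∨ (j + 1 = i ∧ x = Q.V i) := by
  by_cases h1 : i = j
  · exact Or.inl h1
  by_cases h2 : i + 1 = j
  · right; left
    refine ⟨h2, ?_⟩
    have : x ∈ segment ℝ (Q.V i) (Q.V (i + 1)) ∩ segment ℝ (Q.V (i + 1)) (Q.V (i + 2)) := by
      refine ⟨hi, ?_⟩
      have e : i + 2 = (i + 1) + 1 := by ring
      rw [e, h2]; exact hj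
    rw [Q.adj i] at this
    rw [← h2]; exact this
  by_cases h3 : j + 1 = i
  · right; right
    refine ⟨h3, ?_⟩
    have : x ∈ segment ℝ (Q.V j) (Q.V (j + 1)) ∩ segment ℝ (Q.V (j + 1)) (Q.V (j + 2)) := by
      refine ⟨hj, ?_⟩
      have e : j + 2 = (j + 1) + 1 := by ring
      rw [e, h3]; exact hi
    rw [Q.adj j] at this
    rw [← h3]; exact this
  · exact absurd hj (Set.disjoint_left.1 (Q.disj i j h1 h2 h3) hi)

lemma V_mem_E {i j : ZMod Q.n} (h : Q.V j ∈ Q.E i) : i = j ∨ i + 1 = j := by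
  have hj : Q.V j ∈ Q.E j := left_mem_segment _ _ _
  rcases Q.edge_inter h hj with h | ⟨h, -⟩ | ⟨h, h'⟩
  · exact Or.inl h
  · exact Or.inr h
  · exact Or.inl (Q.inj h').symm

/-- Edges not containing `x` stay away from `x`. -/
lemma far_edges (x : ℂ) : ∃ ε > 0, ∀ i, x ∉ Q.E i → ∀ z, dist z x < ε → z ∉ Q.E i := by
  have := Q.finite_idx
  have hc : IsClosed (⋃ i ∈ {i | x ∉ Q.E i}, Q.E i) := by
    apply Set.Finite.isClosed_biUnion (Set.toFinite _)
    intro i _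
    have : IsCompact (Q.E i) := by
      unfold E
      rw [segment_eq_image_lineMap]
      exact isCompact_Icc.image AffineMap.lineMap_continuous
    exact this.isClosed
  have hx : x ∈ (⋃ i ∈ {i | x ∉ Q.E i}, Q.E i)ᶜ := by
    simp
  obtain ⟨ε, hε, h⟩ := Metric.isOpen_iff.1 hc.isOpen_compl x hx
  refine ⟨ε, hε, fun i hi z hz hzi => ?_⟩
  apply h (Metric.mem_ball.2 hz)
  simp only [mem_iUnion]
  exact ⟨i, hi, hzi⟩

end CPoly

lemma mem_seg {x y z : ℂ} : z ∈ segment ℝ x y ↔ ∃ t : ℝ, 0 ≤ t ∧ t ≤ 1 ∧ z = x + t • (y - x) := by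
  rw [segment_eq_image']
  constructor
  · rintro ⟨t, ht, rfl⟩; exact ⟨t, ht.1, ht.2, rfl⟩
  · rintro ⟨t, h0, h1, rfl⟩; exact ⟨t, ⟨h0, h1⟩, rfl⟩

lemma seg_start {x d z : ℂ} (h : dist z x < ‖d‖) :
    z ∈ segment ℝ x (x + d) ↔ ∃ t : ℝ, 0 ≤ t ∧ z = x + t • d := by
  rw [mem_seg]
  constructor
  · rintro ⟨t, h0, _, rfl⟩; exact ⟨t, h0, by simp⟩
  · rintro ⟨t, h0, rfl⟩
    refine ⟨t, h0, ?_, by simp⟩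
    rw [dist_eq_norm, add_sub_cancel_left, norm_smul, Real.norm_of_nonneg h0] at h
    by_contra hc
    push Not at hc
    nlinarith [norm_nonneg d]

namespace CPoly
variable (Q : CPoly)

/-- local model at a vertex -/
lemma model_vertex (j : ZMod Q.n) : ∃ ε > 0, ∃ d₁ d₂ : ℂ, d₁ ≠ 0 ∧ d₂ ≠ 0 ∧
    (∀ t : ℝ, 0 < t → d₁ ≠ t • d₂) ∧ ∀ z, dist z (Q.V j) < ε →
      (z ∈ frontier Q.P ↔ ∃ t : ℝ, 0 ≤ t ∧ (z = Q.V j + t • d₁ ∨ z = Q.V j + t • d₂)) := by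
  obtain ⟨ε, hε, hfar⟩ := Q.far_edges (Q.V j)
  set d₁ := Q.V (j - 1) - Q.V j with hd₁
  set d₂ := Q.V (j + 1) - Q.V j with hd₂
  have e1 : j - 1 + 1 = j := by ring
  have hd1 : d₁ ≠ 0 := by
    have := Q.V_ne_succ (j - 1)
    rw [e1] at this
    exact sub_ne_zero.2 this
  have hd2 : d₂ ≠ 0 := sub_ne_zero.2 (Q.V_ne_succ j).symm
  have E1 : Q.E (j - 1) = segment ℝ (Q.V j) (Q.V j + d₁) := by
    unfold E; rw [e1, segment_symm, hd₁]; congr 1; ring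
  have E2 : Q.E j = segment ℝ (Q.V j) (Q.V j + d₂) := by
    unfold E; rw [hd₂]; congr 1; ring
  refine ⟨min ε (min ‖d₁‖ ‖d₂‖), by
    simp only [gt_iff_lt, lt_min_iff]; exact ⟨hε, norm_pos_iff.2 hd1, norm_pos_iff.2 hd2⟩,
    d₁, d₂, hd1, hd2, ?_, ?_⟩
  · intro t ht h
    -- common point of both edges
    set m := min 1 (1 / t) with hm
    have hm0 : 0 < m := by rw [hm]; positivity
    have hm1 : m ≤ 1 := min_le_left _ _
    have hmt : m * t ≤ 1 := by
      have : m ≤ 1 / t := min_le_right _ _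
      rwa [le_div_iff₀ ht] at this
    have hx1 : Q.V j + m • d₁ ∈ Q.E (j - 1) := by
      rw [E1, mem_seg]; exact ⟨m, hm0.le, hm1, by simp⟩
    have hx2 : Q.V j + m • d₁ ∈ Q.E j := by
      rw [E2, mem_seg]
      refine ⟨m * t, by positivity, hmt, ?_⟩
      rw [h, smul_smul]; simp
    rcases Q.edge_inter hx1 hx2 with h' | ⟨_, h'⟩ | ⟨h', _⟩
    · exact Q.succ_ne (j - 1) (by rw [e1]; exact h'.symm)
    · have : m • d₁ = 0 := by simpa using h'
      rcases smul_eq_zero.1 this with h0 | h0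
      · exact hm0.ne' h0
      · exact hd1 h0
    · apply Q.two_ne_zero'
      have : j + 1 - (j - 1) = 0 := sub_eq_zero.2 h'
      rw [← this]; ring
  · intro z hz
    simp only [lt_min_iff] at hz
    rw [Q.mem_fr]
    constructor
    · rintro ⟨i, hi⟩
      have hij : Q.V j ∈ Q.E i := by
        by_contra hc
        exact hfar i hc z hz.1 hi
      rcases Q.V_mem_E hij with rfl | rfl
      · rw [E2, seg_start hz.2.2] at hi
        obtain ⟨t, h0, h⟩ := hi
        exact ⟨t, h0, Or.inr h⟩
      · have : i + 1 - 1 = i := by ring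
        rw [this] at E1
        rw [E1, seg_start hz.2.1] at hi
        obtain ⟨t, h0, h⟩ := hi
        exact ⟨t, h0, Or.inl h⟩
    · rintro ⟨t, h0, h | h⟩
      · exact ⟨j - 1, by rw [E1, seg_start hz.2.1]; exact ⟨t, h0, h⟩⟩
      · exact ⟨j, by rw [E2, seg_start hz.2.2]; exact ⟨t, h0, h⟩⟩

/-- local model at a point of an open edge -/
lemma model_edge (j : ZMod Q.n) {x : ℂ} (hx : x ∈ Q.E j) (hv : ∀ i, x ≠ Q.V i) :
    ∃ ε > 0, ∀ z, dist z x < ε →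
      (z ∈ frontier Q.P ↔ ∃ t : ℝ, z = x + t • (Q.V (j + 1) - Q.V j)) := by
  obtain ⟨ε, hε, hfar⟩ := Q.far_edges x
  set d := Q.V (j + 1) - Q.V j with hd
  have hd0 : d ≠ 0 := sub_ne_zero.2 (Q.V_ne_succ j).symm
  have hdn : 0 < ‖d‖ := norm_pos_iff.2 hd0
  obtain ⟨θ, h0, h1, hxθ⟩ := mem_seg.1 hx
  rw [← hd] at hxθ
  have h0' : 0 < θ := by
    rcases h0.lt_or_eq with h | h
    · exact h
    · exfalso; apply hv j; rw [hxθ, ← h]; simp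
  have h1' : θ < 1 := by
    rcases h1.lt_or_eq with h | h
    · exact h
    · exfalso; apply hv (j + 1); rw [hxθ, h, hd]; simp
  refine ⟨min ε (min (θ * ‖d‖) ((1 - θ) * ‖d‖)), ?_, ?_⟩
  · have : 0 < 1 - θ := by linarith
    simp only [gt_iff_lt, lt_min_iff]
    exact ⟨hε, by positivity, by positivity⟩
  · intro z hz
    simp only [lt_min_iff] at hz
    rw [Q.mem_fr]
    constructor
    · rintro ⟨i, hi⟩
      have hij : x ∈ Q.E i := by
        by_contra hc
        exact hfar i hc z hz.1 hi
      have : i = j := by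
        rcases Q.edge_inter hij hx with h | ⟨_, h⟩ | ⟨_, h⟩
        · exact h
        · exact absurd h (hv _)
        · exact absurd h (hv _)
      subst this
      obtain ⟨s, _, _, hs⟩ := mem_seg.1 hi
      refine ⟨s - θ, ?_⟩
      rw [hs, hxθ, ← hd, sub_smul]; ring
    · rintro ⟨t, rfl⟩
      refine ⟨j, mem_seg.2 ⟨θ + t, ?_, ?_, ?_⟩⟩
      · have := hz.2.1
        rw [dist_eq_norm, add_sub_cancel_left, norm_smul] at this
        have := lt_of_mul_lt_mul_right this hdn.le
        rw [Real.norm_eq_abs] at this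
        linarith [(abs_lt.1 this).1]
      · have := hz.2.2
        rw [dist_eq_norm, add_sub_cancel_left, norm_smul] at this
        have := lt_of_mul_lt_mul_right this hdn.le
        rw [Real.norm_eq_abs] at this
        linarith [(abs_lt.1 this).2]
      · rw [hxθ, ← hd, add_smul]; ring

/-- unified local model -/
lemma model {x : ℂ} (hx : x ∈ frontier Q.P) : ∃ ε > 0, ∃ d₁ d₂ : ℂ, d₁ ≠ 0 ∧ d₂ ≠ 0 ∧
    (∀ t : ℝ, 0 < t → d₁ ≠ t • d₂) ∧ ∀ z, dist z x < ε →
      (z ∈ frontier Q.P ↔ ∃ t : ℝ, 0 ≤ t ∧ (z = x + t • d₁ ∨ z = x + t • d₂)) := by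
  by_cases hv : ∃ i, x = Q.V i
  · obtain ⟨i, rfl⟩ := hv
    exact Q.model_vertex i
  · push Not at hv
    obtain ⟨j, hj⟩ := Q.mem_fr.1 hx
    obtain ⟨ε, hε, h⟩ := Q.model_edge j hj hv
    have hd0 : Q.V (j + 1) - Q.V j ≠ 0 := sub_ne_zero.2 (Q.V_ne_succ j).symm
    refine ⟨ε, hε, Q.V (j + 1) - Q.V j, -(Q.V (j + 1) - Q.V j), hd0, neg_ne_zero.2 hd0, ?_, ?_⟩
    · intro t ht h'
      have : (1 + t) • (Q.V (j + 1) - Q.V j) = 0 := by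
        rw [add_smul, one_smul]
        nth_rewrite 1 [h']
        simp; ring
      rcases smul_eq_zero.1 this with h0 | h0
      · linarith
      · exact hd0 h0
    · intro z hz
      rw [h z hz]
      constructor
      · rintro ⟨t, rfl⟩
        rcases le_total 0 t with h0 | h0
        · exact ⟨t, h0, Or.inl rfl⟩
        · exact ⟨-t, by linarith, Or.inr (by simp; ring)⟩
      · rintro ⟨t, h0, rfl | rfl⟩
        · exact ⟨t, rfl⟩
        · exact ⟨-t, by simp; ring⟩

end CPoly


lemma cr_continuous (u : ℂ) : Continuous (fun v => cr u v) := by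
  unfold cr; fun_prop

lemma cr_smul_right (u v : ℂ) (t : ℝ) : cr u (t • v) = t * cr u v := by
  simp [cr]; ring
lemma cr_smul_left (u v : ℂ) (t : ℝ) : cr (t • u) v = t * cr u v := by
  simp [cr]; ring
lemma cr_add_right (u v w : ℂ) : cr u (v + w) = cr u v + cr u w := by
  simp [cr]; ring
lemma cr_add_left (u v w : ℂ) : cr (u + v) w = cr u w + cr v w := by
  simp [cr]; ring
lemma cr_sub_right (u v w : ℂ) : cr u (v - w) = cr u v - cr u w := by
  simp [cr]; ring
lemma cr_sub_left (u v w : ℂ) : cr (u - v) w = cr u w - cr v w := by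
  simp [cr]; ring
lemma cr_neg_right (u v : ℂ) : cr u (-v) = - cr u v := by
  simp [cr]; ring
lemma cr_neg_left (u v : ℂ) : cr (-u) v = - cr u v := by
  simp [cr]; ring
lemma cr_self (u : ℂ) : cr u u = 0 := by
  simp [cr]; ring
lemma cr_swap (u v : ℂ) : cr u v = - cr v u := by
  simp [cr]; ring

lemma cr_I (u : ℂ) : cr u (Complex.I * u) = ‖u‖ ^ 2 := by
  rw [← Complex.normSq_eq_norm_sq]
  simp [cr, Complex.normSq]

/-- parallel vectors -/
lemma cr_eq_zero {u v : ℂ} (hu : u ≠ 0) (h : cr u v = 0) : ∃ t : ℝ, v = t • u := by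
  have hn : Complex.normSq u ≠ 0 := by simpa using hu
  refine ⟨(u.re * v.re + u.im * v.im) / Complex.normSq u, ?_⟩
  have h' : u.re * v.im = u.im * v.re := by unfold cr at h; linarith
  rw [Complex.normSq_apply] at hn ⊢
  apply Complex.ext
  · rw [Complex.smul_re, smul_eq_mul, div_mul_eq_mul_div, eq_div_iff hn]
    linear_combination (-u.im) * h'
  · rw [Complex.smul_im, smul_eq_mul, div_mul_eq_mul_div, eq_div_iff hn]
    linear_combination (u.re) * h'

/-- basis decomposition -/
lemma cr_basis {u v : ℂ} (h : cr u v ≠ 0) (w : ℂ) :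
    w = (cr w v / cr u v) • u + (cr u w / cr u v) • v := by
  have h' := h
  unfold cr at h'
  apply Complex.ext
  · simp only [Complex.add_re, Complex.smul_re, smul_eq_mul, cr, div_mul_eq_mul_div, ← add_div]
    rw [eq_div_iff h']; ring
  · simp only [Complex.add_im, Complex.smul_im, smul_eq_mul, cr, div_mul_eq_mul_div, ← add_div]
    rw [eq_div_iff h']; ring

/-- a preconnected set missing the frontier -/
lemma precon_in {S P : Set ℂ} (hS : IsPreconnected S) (h : ∀ z ∈ S, z ∉ frontier P) {x y : ℂ}
    (hx : x ∈ S) (hy : y ∈ S) (hxP : x ∈ P) : y ∈ P := by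
  by_contra hyP
  have hintr : ∀ z ∈ S, z ∈ P → z ∈ interior P := fun z hz hzP => by
    by_contra hc
    exact h z hz ⟨subset_closure hzP, hc⟩
  have hext : ∀ z ∈ S, z ∉ P → z ∈ (closure P)ᶜ := fun z hz hzP hc =>
    h z hz ⟨hc, fun hi => hzP (interior_subset hi)⟩
  obtain ⟨z, hz, hz1, hz2⟩ := hS (interior P) (closure P)ᶜ isOpen_interior
    isClosed_closure.isOpen_compl (fun z hz => by
      by_cases hzP : z ∈ P
      · exact Or.inl (hintr z hz hzP)
      · exact Or.inr (hext z hz hzP)) ⟨x, hx, hintr x hx hxP⟩ ⟨y, hy, hext y hy hyP⟩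
  exact hz2 (subset_closure (interior_subset hz1))

lemma smul_dist {x z : ℂ} {t ε : ℝ} (h0 : 0 ≤ t) (h1 : t ≤ 1) (h : dist z x < ε) :
    dist (x + t • (z - x)) x < ε := by
  rw [dist_eq_norm] at *
  rw [add_sub_cancel_left, norm_smul, Real.norm_of_nonneg h0]
  nlinarith [norm_nonneg (z - x)]

namespace CPoly
variable (Q : CPoly)

/-- local conicity -/
lemma conic {x : ℂ} (hx : x ∈ Q.P) : ∃ ε > 0, ∀ z, dist z x < ε → ∀ t : ℝ, 0 < t → t ≤ 1 →
    (z ∈ Q.P ↔ x + t • (z - x) ∈ Q.P) := by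
  by_cases hf : x ∈ frontier Q.P
  · obtain ⟨ε, hε, d₁, d₂, h1, h2, h3, h⟩ := Q.model hf
    refine ⟨ε, hε, fun z hz t ht0 ht1 => ?_⟩
    by_cases hzf : z ∈ frontier Q.P
    · have h' : x + t • (z - x) ∈ frontier Q.P := by
        rw [h _ (smul_dist ht0.le ht1 hz)]
        rw [h z hz] at hzf
        obtain ⟨s, hs, rfl | rfl⟩ := hzf
        · exact ⟨t * s, by positivity, Or.inl (by simp; ring)⟩
        · exact ⟨t * s, by positivity, Or.inr (by simp; ring)⟩
      exact ⟨fun _ => Q.fr_sub h', fun _ => Q.fr_sub hzf⟩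
    · have key : ∀ u ∈ Icc t 1, x + u • (z - x) ∉ frontier Q.P := by
        intro u hu hc
        have hu0 : 0 < u := lt_of_lt_of_le ht0 hu.1
        rw [h _ (smul_dist hu0.le hu.2 hz)] at hc
        apply hzf
        rw [h z hz]
        obtain ⟨s, hs, hc | hc⟩ := hc
        · refine ⟨s / u, by positivity, Or.inl ?_⟩
          have : u • (z - x) = s • d₁ := by simpa using hc
          rw [div_eq_inv_mul, mul_smul, ← this, smul_smul, inv_mul_cancel₀ hu0.ne']; simp
        · refine ⟨s / u, by positivity, Or.inr ?_⟩
          have : u • (z - x) = s • d₂ := by simpa using hc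
          rw [div_eq_inv_mul, mul_smul, ← this, smul_smul, inv_mul_cancel₀ hu0.ne']; simp
      have hS : IsPreconnected ((fun u : ℝ => x + u • (z - x)) '' Icc t 1) :=
        isPreconnected_Icc.image _ (by fun_prop)
      have hS' : ∀ y ∈ ((fun u : ℝ => x + u • (z - x)) '' Icc t 1), y ∉ frontier Q.P := by
        rintro _ ⟨u, hu, rfl⟩; exact key u hu
      have hz1 : z ∈ ((fun u : ℝ => x + u • (z - x)) '' Icc t 1) := ⟨1, ⟨ht1, le_rfl⟩, by simp⟩
      have hz2 : x + t • (z - x) ∈ ((fun u : ℝ => x + u • (z - x)) '' Icc t 1) :=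
        ⟨t, ⟨le_rfl, ht1⟩, rfl⟩
      exact ⟨precon_in hS hS' hz1 hz2, precon_in hS hS' hz2 hz1⟩
  · have hi := Q.not_fr_int hx hf
    rw [mem_interior_iff_mem_nhds, Metric.mem_nhds_iff] at hi
    obtain ⟨ε, hε, h⟩ := hi
    refine ⟨ε, hε, fun z hz t ht0 ht1 => ?_⟩
    exact ⟨fun _ => h (smul_dist ht0.le ht1 hz), fun _ => h hz⟩

/-- In a small ball the complement of the frontier splits in two connected sectors -/
lemma sectors {x : ℂ} (hx : x ∈ frontier Q.P) : ∃ ε₀ > 0, ∃ K₁ K₂ : Set ℂ,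
    (∀ ε > 0, IsPreconnected (ball x ε ∩ K₁)) ∧ (∀ ε > 0, IsPreconnected (ball x ε ∩ K₂)) ∧
    ∀ z, dist z x < ε₀ → (z ∉ frontier Q.P ↔ z ∈ K₁ ∨ z ∈ K₂) := by
  obtain ⟨ε, hε, d₁, d₂, h1, h2, h3, h⟩ := Q.model hx
  have cvx : ∀ u : ℂ, Convex ℝ {z : ℂ | 0 < cr u (z - x)} := by
    intro u z hz w hw a b ha hb hab
    simp only [mem_ofPred_eq] at *
    have : cr u (a • z + b • w - x) = a * cr u (z - x) + b * cr u (w - x) := by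
      have hx : x = a • x + b • x := by rw [← add_smul, hab, one_smul]
      nth_rewrite 1 [hx]
      simp [cr]; ring
    rw [this]
    rcases ha.lt_or_eq with ha | ha
    · have := mul_pos ha hz
      have := mul_nonneg hb hw.le
      linarith
    · have hb1 : b = 1 := by linarith
      rw [← ha, hb1]; simpa using hw
  refine ⟨ε, hε, ?_⟩
  by_cases hc : cr d₁ d₂ = 0
  · obtain ⟨k, hk⟩ := cr_eq_zero h1 hc
    have hk0 : k < 0 := by
      by_contra hk'
      push Not at hk'
      rcases hk'.lt_or_eq with h' | h'
      · apply h3 k⁻¹ (by positivity)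
        rw [hk, smul_smul, inv_mul_cancel₀ h'.ne', one_smul]
      · apply h2; rw [hk, ← h', zero_smul]
    refine ⟨{z | 0 < cr d₁ (z - x)}, {z | 0 < cr (-d₁) (z - x)}, ?_, ?_, ?_⟩
    · intro ε' _
      exact ((convex_ball _ _).inter (cvx _)).isPreconnected
    · intro ε' _
      exact ((convex_ball _ _).inter (cvx _)).isPreconnected
    · intro z hz
      rw [h z hz]
      simp only [mem_ofPred_eq, cr_neg_left]
      constructor
      · intro hn
        by_contra hcon
        push Not at hcon
        have h0 : cr d₁ (z - x) = 0 := by linarith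
        obtain ⟨t, ht⟩ := cr_eq_zero h1 h0
        apply hn
        rcases le_total 0 t with h' | h'
        · exact ⟨t, h', Or.inl (by rw [← ht]; ring)⟩
        · refine ⟨t / k, div_nonneg_of_nonpos h' hk0.le, Or.inr ?_⟩
          rw [hk, smul_smul, div_mul_cancel₀ _ hk0.ne, ← ht]; ring
      · rintro hcon ⟨t, _, rfl | rfl⟩
        · rw [add_sub_cancel_left, cr_smul_right, cr_self] at hcon; simp at hcon
        · rw [add_sub_cancel_left, cr_smul_right, hc] at hcon; simp at hcon
  · set u₁ := (cr d₁ d₂)⁻¹ • d₁ with hu1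
    set u₂ := -(cr d₁ d₂)⁻¹ • d₂ with hu2
    have e1 : ∀ w, cr u₁ w = cr d₁ w / cr d₁ d₂ := by
      intro w; rw [hu1, cr_smul_left]; field_simp
    have e2 : ∀ w, cr u₂ w = cr w d₂ / cr d₁ d₂ := by
      intro w; rw [hu2, cr_smul_left, cr_swap d₂ w]; field_simp
    have dec : ∀ w, w = (cr u₂ w) • d₁ + (cr u₁ w) • d₂ := by
      intro w; rw [e1, e2]; exact cr_basis hc w
    refine ⟨{z | 0 < cr u₁ (z - x)} ∩ {z | 0 < cr u₂ (z - x)},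
      {z | 0 < cr (-u₁) (z - x)} ∪ {z | 0 < cr (-u₂) (z - x)}, ?_, ?_, ?_⟩
    · intro ε' _
      exact ((convex_ball _ _).inter ((cvx _).inter (cvx _))).isPreconnected
    · intro ε' hε'
      rw [inter_union_distrib_left]
      obtain ⟨η, hη, hη'⟩ : ∃ η : ℝ, 0 < η ∧ η * ‖d₁ + d₂‖ < ε' := by
        refine ⟨ε' / (‖d₁ + d₂‖ + 1), by positivity, ?_⟩
        rw [div_mul_eq_mul_div, div_lt_iff₀ (by positivity)]
        nlinarith [norm_nonneg (d₁ + d₂)]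
      have hb : x + (-η) • (d₁ + d₂) ∈ ball x ε' := by
        rw [mem_ball, dist_eq_norm, add_sub_cancel_left, norm_smul]
        simpa [abs_of_pos hη] using hη'
      have f1 : cr u₁ (d₁ + d₂) = 1 := by
        rw [e1, cr_add_right, cr_self]; field_simp; simp
      have f2 : cr u₂ (d₁ + d₂) = 1 := by
        rw [e2, cr_add_left, cr_self]; field_simp; simp
      apply IsPreconnected.union (x + (-η) • (d₁ + d₂))
      · refine ⟨hb, ?_⟩
        simp only [mem_ofPred_eq]
        rw [add_sub_cancel_left, cr_smul_right, cr_neg_left, f1]; linarith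
      · refine ⟨hb, ?_⟩
        simp only [mem_ofPred_eq]
        rw [add_sub_cancel_left, cr_smul_right, cr_neg_left, f2]; linarith
      · exact ((convex_ball _ _).inter (cvx _)).isPreconnected
      · exact ((convex_ball _ _).inter (cvx _)).isPreconnected
    · intro z hz
      rw [h z hz]
      simp only [mem_inter_iff, mem_union, mem_ofPred_eq, cr_neg_left]
      constructor
      · intro hn
        by_contra hcon
        push Not at hcon
        obtain ⟨hc1, hc2, hc3⟩ := hcon
        have dz := dec (z - x)
        apply hn
        rcases (show (0:ℝ) ≤ cr u₁ (z - x) by linarith).lt_or_eq with h' | h'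
        · have := hc1 h'
          have h0 : cr u₂ (z - x) = 0 := by linarith
          refine ⟨_, h'.le, Or.inr ?_⟩
          rw [h0, zero_smul, zero_add] at dz
          rw [← dz]; ring
        · refine ⟨cr u₂ (z - x), by linarith, Or.inl ?_⟩
          rw [← h', zero_smul, add_zero] at dz
          rw [← dz]; ring
      · rintro hcon ⟨t, ht, rfl | rfl⟩
        · rw [add_sub_cancel_left, cr_smul_right, cr_smul_right, e1, e2, cr_self, div_self hc] at hcon
          simp at hcon; linarith
        · rw [add_sub_cancel_left, cr_smul_right, cr_smul_right, e1, e2, cr_self, div_self hc] at hcon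
          simp at hcon; linarith

/-- (Out) and (In) -/
lemma out_in {x : ℂ} (hx : x ∈ frontier Q.P) : ∃ ε₀ > 0, ∀ ε, 0 < ε → ε ≤ ε₀ →
    IsPreconnected (ball x ε \ Q.P) ∧ IsPreconnected ((Q.P ∩ ball x ε) \ {x}) := by
  obtain ⟨ε₀, hε₀, K₁, K₂, hK1, hK2, h⟩ := Q.sectors hx
  refine ⟨ε₀, hε₀, fun ε hε hle => ?_⟩
  have hxP := Q.fr_sub hx
  have nof1 : ∀ z ∈ ball x ε ∩ K₁, z ∉ frontier Q.P := fun z hz =>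
    (h z (lt_of_lt_of_le hz.1 hle)).2 (Or.inl hz.2)
  have nof2 : ∀ z ∈ ball x ε ∩ K₂, z ∉ frontier Q.P := fun z hz =>
    (h z (lt_of_lt_of_le hz.1 hle)).2 (Or.inr hz.2)
  have aux : ∀ K K' : Set ℂ, IsPreconnected (ball x ε ∩ K) → IsPreconnected (ball x ε ∩ K') →
      (∀ z ∈ ball x ε ∩ K, z ∉ frontier Q.P) → (∀ z ∈ ball x ε ∩ K', z ∉ frontier Q.P) →
      (∀ z, dist z x < ε → z ∉ frontier Q.P → z ∈ K ∨ z ∈ K') →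
      (ball x ε ∩ K ∩ Q.P).Nonempty →
      IsPreconnected (ball x ε \ Q.P) ∧ IsPreconnected ((Q.P ∩ ball x ε) \ {x}) := by
    rintro K K' hK hK' hn hn' hcov ⟨y, hy, hyP⟩
    have hin : ball x ε ∩ K ⊆ Q.P := fun z hz => precon_in hK hn hy hz hyP
    have hout : ∀ z ∈ ball x ε ∩ K', z ∉ Q.P := by
      intro w hw hwP
      have hin' : ball x ε ∩ K' ⊆ Q.P := fun z hz => precon_in hK' hn' hw hz hwP
      have : ball x ε ⊆ Q.P := by
        intro z hz
        by_cases hzf : z ∈ frontier Q.P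
        · exact Q.fr_sub hzf
        · rcases hcov z hz hzf with h' | h'
          · exact hin ⟨hz, h'⟩
          · exact hin' ⟨hz, h'⟩
      have hxi : x ∈ interior Q.P := mem_interior.2 ⟨_, this, isOpen_ball, mem_ball_self hε⟩
      exact hx.2 hxi
    constructor
    · have : ball x ε \ Q.P = ball x ε ∩ K' := by
        ext z
        constructor
        · rintro ⟨hz, hzP⟩
          rcases hcov z hz (fun hf => hzP (Q.fr_sub hf)) with h' | h'
          · exact absurd (hin ⟨hz, h'⟩) hzP
          · exact ⟨hz, h'⟩
        · intro hz; exact ⟨hz.1, hout z hz⟩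
      rw [this]; exact hK'
    · apply hK.subset_closure
      · intro z hz
        refine ⟨⟨hin hz, hz.1⟩, ?_⟩
        rintro rfl
        exact hn _ hz hx
      · rintro z ⟨⟨hzP, hzb⟩, -⟩
        have hzc := Q.reg hzP
        rw [_root_.mem_closure_iff] at hzc ⊢
        intro o ho hzo
        obtain ⟨w, ⟨hwo, hwb⟩, hwi⟩ := hzc (o ∩ ball x ε) (ho.inter isOpen_ball) ⟨hzo, hzb⟩
        refine ⟨w, hwo, hwb, ?_⟩
        rcases hcov w hwb (fun hf => hf.2 hwi) with h' | h'
        · exact h'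
        · exact absurd (interior_subset hwi) (hout w ⟨hwb, h'⟩)
  have hcl := Q.reg hxP
  rw [_root_.mem_closure_iff] at hcl
  obtain ⟨w, hwb, hwi⟩ := hcl (ball x ε) isOpen_ball (mem_ball_self hε)
  have hcov : ∀ z, dist z x < ε → z ∉ frontier Q.P → z ∈ K₁ ∨ z ∈ K₂ := fun z hz hf =>
    (h z (lt_of_lt_of_le hz hle)).1 hf
  rcases hcov w hwb (fun hf => hf.2 hwi) with h' | h'
  · exact aux K₁ K₂ (hK1 ε hε) (hK2 ε hε) nof1 nof2 hcov ⟨w, ⟨hwb, h'⟩, interior_subset hwi⟩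
  · exact aux K₂ K₁ (hK2 ε hε) (hK1 ε hε) nof2 nof1 (fun z hz hf => (hcov z hz hf).symm)
      ⟨w, ⟨hwb, h'⟩, interior_subset hwi⟩

end CPoly


namespace CPoly
variable (Q : CPoly)

/-- direction of an edge -/
def dir (j : ZMod Q.n) : ℂ := Q.V (j + 1) - Q.V j

lemma dir_ne (j : ZMod Q.n) : Q.dir j ≠ 0 := sub_ne_zero.2 (Q.V_ne_succ j).symm

lemma cr_dir_edge {j : ZMod Q.n} {x : ℂ} (hx : x ∈ Q.E j) : cr (Q.dir j) (x - Q.V j) = 0 := by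
  obtain ⟨t, _, _, rfl⟩ := mem_seg.1 hx
  rw [add_sub_cancel_left, cr_smul_right]
  show t * cr (Q.dir j) (Q.dir j) = 0
  rw [cr_self, mul_zero]

/-- local half disc, with unspecified sign -/
lemma half (j : ZMod Q.n) {x : ℂ} (hx : x ∈ Q.E j) (hv : ∀ i, x ≠ Q.V i) :
    ∃ ε > 0, (∀ z, dist z x < ε → (z ∈ Q.P ↔ 0 ≤ cr (Q.dir j) (z - Q.V j))) ∨
      (∀ z, dist z x < ε → (z ∈ Q.P ↔ 0 ≤ cr (-Q.dir j) (z - Q.V j))) := by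
  obtain ⟨ε, hε, h⟩ := Q.model_edge j hx hv
  refine ⟨ε, hε, ?_⟩
  have hxf : x ∈ frontier Q.P := Q.mem_fr.2 ⟨j, hx⟩
  have hfr : ∀ z, dist z x < ε → (z ∈ frontier Q.P ↔ cr (Q.dir j) (z - Q.V j) = 0) := by
    intro z hz
    rw [h z hz]
    have e : cr (Q.dir j) (z - Q.V j) = cr (Q.dir j) (z - x) := by
      have := Q.cr_dir_edge hx
      have e2 : z - Q.V j = (z - x) + (x - Q.V j) := by ring
      rw [e2, cr_add_right, this, add_zero]
    rw [e]
    constructor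
    · rintro ⟨t, rfl⟩
      rw [add_sub_cancel_left, cr_smul_right]
      show t * cr (Q.dir j) (Q.dir j) = 0
      rw [cr_self, mul_zero]
    · intro h0
      obtain ⟨t, ht⟩ := cr_eq_zero (Q.dir_ne j) h0
      exact ⟨t, by show z = x + t • Q.dir j; rw [← ht]; ring⟩
  have cvx : ∀ u : ℂ, Convex ℝ {z : ℂ | 0 < cr u (z - Q.V j)} := by
    intro u z hz w hw a b ha hb hab
    simp only [mem_ofPred_eq] at *
    have : cr u (a • z + b • w - Q.V j) = a * cr u (z - Q.V j) + b * cr u (w - Q.V j) := by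
      have hx : Q.V j = a • Q.V j + b • Q.V j := by rw [← add_smul, hab, one_smul]
      nth_rewrite 1 [hx]
      simp [cr]; ring
    rw [this]
    rcases ha.lt_or_eq with ha | ha
    · have := mul_pos ha hz
      have := mul_nonneg hb hw.le
      linarith
    · have hb1 : b = 1 := by linarith
      rw [← ha, hb1]; simpa using hw
  have pre : ∀ u : ℂ, IsPreconnected (ball x ε ∩ {z | 0 < cr u (z - Q.V j)}) := fun u =>
    ((convex_ball _ _).inter (cvx _)).isPreconnected
  have aux : ∀ u : ℂ, (u = Q.dir j ∨ u = -Q.dir j) →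
      (∃ w, dist w x < ε ∧ 0 < cr u (w - Q.V j) ∧ w ∈ Q.P) →
      (∀ z, dist z x < ε → (z ∈ Q.P ↔ 0 ≤ cr u (z - Q.V j))) := by
    rintro u hu ⟨w, hw, hwu, hwP⟩ z hz
    have eq0 : ∀ z, cr u (z - Q.V j) = 0 ↔ cr (Q.dir j) (z - Q.V j) = 0 := by
      intro z
      rcases hu with rfl | rfl
      · rfl
      · rw [cr_neg_left, neg_eq_zero]
    have nof : ∀ u', (u' = u ∨ u' = -u) → ∀ z ∈ ball x ε ∩ {z | 0 < cr u' (z - Q.V j)},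
        z ∉ frontier Q.P := by
      rintro u' hu' z ⟨hz, hz'⟩ hf
      rw [hfr z hz, ← eq0] at hf
      simp only [mem_ofPred_eq] at hz'
      rcases hu' with rfl | rfl
      · linarith
      · rw [cr_neg_left] at hz'; linarith
    have hin : ∀ z, dist z x < ε → 0 < cr u (z - Q.V j) → z ∈ Q.P := fun z hz hz' =>
      precon_in (pre u) (nof u (Or.inl rfl)) (x := w) ⟨hw, hwu⟩ ⟨hz, hz'⟩ hwP
    constructor
    · intro hzP
      by_contra hc
      push Not at hc
      have hz' : 0 < cr (-u) (z - Q.V j) := by rw [cr_neg_left]; linarith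
      apply hxf.2
      refine mem_interior.2 ⟨ball x ε, ?_, isOpen_ball, mem_ball_self hε⟩
      intro y hy
      rcases lt_trichotomy (cr u (y - Q.V j)) 0 with h' | h' | h'
      · exact precon_in (pre (-u)) (nof (-u) (Or.inr rfl)) (x := z) ⟨hz, hz'⟩
          ⟨hy, by simp only [mem_ofPred_eq]; rw [cr_neg_left]; linarith⟩ hzP
      · exact Q.fr_sub ((hfr y hy).2 ((eq0 y).1 h'))
      · exact hin y hy h'
    · intro h0
      rcases h0.lt_or_eq with h' | h'
      · exact hin z hz h'
      · exact Q.fr_sub ((hfr z hz).2 ((eq0 z).1 h'.symm))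
  have hcl := Q.reg (Q.fr_sub hxf)
  rw [_root_.mem_closure_iff] at hcl
  obtain ⟨w, hwb, hwi⟩ := hcl (ball x ε) isOpen_ball (mem_ball_self hε)
  have hwn : cr (Q.dir j) (w - Q.V j) ≠ 0 := fun h0 => ((hfr w hwb).2 h0).2 hwi
  rcases lt_or_gt_of_ne hwn with h' | h'
  · right
    exact aux _ (Or.inr rfl) ⟨w, hwb, by rw [cr_neg_left]; linarith, interior_subset hwi⟩
  · left
    exact aux _ (Or.inl rfl) ⟨w, hwb, h', interior_subset hwi⟩

/-- nonvertex points of an edge are in the open segment -/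
lemma mem_openSeg {j : ZMod Q.n} {x : ℂ} :
    x ∈ openSegment ℝ (Q.V j) (Q.V (j + 1)) ↔ x ∈ Q.E j ∧ ∀ i, x ≠ Q.V i := by
  constructor
  · intro hx
    refine ⟨openSegment_subset_segment _ _ _ hx, ?_⟩
    rintro i rfl
    have hE : Q.V i ∈ Q.E j := openSegment_subset_segment _ _ _ hx
    have hne := Q.V_ne_succ j
    rcases Q.V_mem_E hE with rfl | rfl
    · exact hne (left_mem_openSegment_iff.1 hx)
    · exact hne (right_mem_openSegment_iff.1 hx)
  · rintro ⟨hx, hv⟩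
    rcases (mem_openSegment_of_ne_left_right (hv j).symm (hv (j+1)).symm hx) with h
    exact h

/-- uniform side along an edge -/
lemma halfE (j : ZMod Q.n) : ∃ u : ℂ, (u = Q.dir j ∨ u = -Q.dir j) ∧
    ∀ x ∈ Q.E j, (∀ i, x ≠ Q.V i) →
      ∃ ε > 0, ∀ z, dist z x < ε → (z ∈ Q.P ↔ 0 ≤ cr u (z - Q.V j)) := by
  set U : ℂ → Set ℂ := fun u => {x | ∃ ε > 0, ∀ z, dist z x < ε →
    (z ∈ Q.P ↔ 0 ≤ cr u (z - Q.V j))} with hU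
  have op : ∀ u, IsOpen (U u) := by
    intro u
    rw [Metric.isOpen_iff]
    rintro x ⟨ε, hε, h⟩
    refine ⟨ε / 2, by positivity, ?_⟩
    intro y hy
    refine ⟨ε / 2, by positivity, fun z hz => h z ?_⟩
    rw [mem_ball] at hy
    linarith [dist_triangle z y x]
  have dj : ∀ x, x ∈ U (Q.dir j) → x ∈ U (-Q.dir j) → False := by
    rintro x ⟨ε₁, h1, H1⟩ ⟨ε₂, h2, H2⟩
    set d := Q.dir j
    have hd : 0 < ‖d‖ := norm_pos_iff.2 (Q.dir_ne j)
    -- a point off the line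
    obtain ⟨η, hη, hη1, hη2⟩ : ∃ η : ℝ, 0 < η ∧ η * ‖d‖ < ε₁ ∧ η * ‖d‖ < ε₂ := by
      refine ⟨min ε₁ ε₂ / (2 * ‖d‖), by positivity, ?_, ?_⟩
      · have : min ε₁ ε₂ / (2 * ‖d‖) * ‖d‖ = min ε₁ ε₂ / 2 := by field_simp
        rw [this]; linarith [min_le_left ε₁ ε₂]
      · have : min ε₁ ε₂ / (2 * ‖d‖) * ‖d‖ = min ε₁ ε₂ / 2 := by field_simp
        rw [this]; linarith [min_le_right ε₁ ε₂]
    have key : ∀ z, dist z x < ε₁ → dist z x < ε₂ → cr d (z - Q.V j) = 0 := by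
      intro z hz1 hz2
      have a1 := H1 z hz1
      have a2 := H2 z hz2
      rw [a1, cr_neg_left] at a2
      by_contra hne
      rcases lt_or_gt_of_ne hne with h' | h'
      · have := a2.2 (by linarith); linarith
      · have := a2.1 h'.le; linarith
    have k0 := key x (by simpa using h1) (by simpa using h2)
    have hdist : dist (x + η • (Complex.I * d)) x = η * ‖d‖ := by
      rw [dist_eq_norm, add_sub_cancel_left, norm_smul, norm_mul, Complex.norm_I, one_mul,
        Real.norm_of_nonneg hη.le]
    have k1 := key (x + η • (Complex.I * d)) (by rw [hdist]; exact hη1) (by rw [hdist]; exact hη2)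
    have e : x + η • (Complex.I * d) - Q.V j = (x - Q.V j) + η • (Complex.I * d) := by ring
    rw [e, cr_add_right, k0, cr_smul_right, cr_I, zero_add] at k1
    have : 0 < η * ‖d‖ ^ 2 := by positivity
    linarith
  have pre : IsPreconnected (openSegment ℝ (Q.V j) (Q.V (j + 1))) :=
    (convex_openSegment _ _).isPreconnected
  rw [isPreconnected_iff_subset_of_disjoint] at pre
  have cov : openSegment ℝ (Q.V j) (Q.V (j + 1)) ⊆ U (Q.dir j) ∪ U (-Q.dir j) := by
    intro x hx
    obtain ⟨hx, hv⟩ := Q.mem_openSeg.1 hx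
    obtain ⟨ε, hε, h | h⟩ := Q.half j hx hv
    · exact Or.inl ⟨ε, hε, h⟩
    · exact Or.inr ⟨ε, hε, h⟩
  rcases pre _ _ (op _) (op _) cov (by
    ext x
    simp only [mem_inter_iff, mem_empty_iff_false, iff_false]
    rintro ⟨_, h1, h2⟩
    exact dj x h1 h2) with h | h
  · exact ⟨Q.dir j, Or.inl rfl, fun x hx hv => h (Q.mem_openSeg.2 ⟨hx, hv⟩)⟩
  · exact ⟨-Q.dir j, Or.inr rfl, fun x hx hv => h (Q.mem_openSeg.2 ⟨hx, hv⟩)⟩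

lemma fr_preconn : IsPreconnected (frontier Q.P) := by
  have := Q.neZero
  have e : frontier Q.P = ⋃ k : ℕ, Q.E (k : ZMod Q.n) := by
    ext x
    rw [Q.mem_fr]
    simp only [mem_iUnion]
    constructor
    · rintro ⟨i, hi⟩
      exact ⟨i.val, by rwa [ZMod.natCast_zmod_val]⟩
    · rintro ⟨k, hk⟩; exact ⟨_, hk⟩
  rw [e]
  apply IsPreconnected.iUnion_of_chain
  · intro k; exact (convex_segment _ _).isPreconnected
  · intro k
    refine ⟨Q.V ((k : ZMod Q.n) + 1), right_mem_segment _ _ _, ?_⟩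
    have : (((Order.succ k : ℕ)) : ZMod Q.n) = (k : ZMod Q.n) + 1 := by
      simp
    rw [this]
    exact left_mem_segment _ _ _

/-- the complement is connected -/
lemma compl_preconn : IsPreconnected Q.Pᶜ := by
  rw [isPreconnected_iff_subset_of_disjoint]
  -- one-sided claim
  have claim : ∀ U V : Set ℂ, IsOpen U → IsOpen V → Q.Pᶜ ⊆ U ∪ V → Q.Pᶜ ∩ (U ∩ V) = ∅ →
      (∀ x ∈ frontier Q.P, ∃ ε > 0, ball x ε \ Q.P ⊆ U) → Q.Pᶜ ⊆ U := by
    intro U V hU hV hcov hdis hC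
    have dis : ∀ z, z ∉ Q.P → z ∈ U → z ∈ V → False := fun z h1 h2 h3 => by
      have : z ∈ Q.Pᶜ ∩ (U ∩ V) := ⟨h1, h2, h3⟩
      rw [hdis] at this; exact this
    have hop : IsOpen (Q.Pᶜ ∩ V) := Q.closed.isOpen_compl.inter hV
    have hcl : IsClosed (Q.Pᶜ ∩ V) := by
      rw [← isOpen_compl_iff, Metric.isOpen_iff]
      intro x hx
      by_cases hxP : x ∈ Q.P
      · by_cases hf : x ∈ frontier Q.P
        · obtain ⟨ε, hε, h⟩ := hC x hf
          exact ⟨ε, hε, fun z hz hz' => dis z hz'.1 (h ⟨hz, hz'.1⟩) hz'.2⟩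
        · have := Q.not_fr_int hxP hf
          rw [mem_interior_iff_mem_nhds, Metric.mem_nhds_iff] at this
          obtain ⟨ε, hε, h⟩ := this
          exact ⟨ε, hε, fun z hz hz' => hz'.1 (h hz)⟩
      · have hxU : x ∈ U := by
          rcases hcov hxP with h | h
          · exact h
          · exact absurd ⟨hxP, h⟩ hx
        obtain ⟨ε, hε, h⟩ := Metric.isOpen_iff.1 hU x hxU
        exact ⟨ε, hε, fun z hz hz' => dis z hz'.1 (h hz) hz'.2⟩
    rcases isClopen_iff.1 ⟨hcl, hop⟩ with h | h
    · intro z hz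
      rcases hcov hz with h' | h'
      · exact h'
      · have : z ∈ Q.Pᶜ ∩ V := ⟨hz, h'⟩
        rw [h] at this; exact absurd this (notMem_empty _)
    · exfalso
      have : Q.V 0 ∈ Q.Pᶜ ∩ V := by rw [h]; trivial
      exact this.1 (Q.V_mem 0)
  intro U V hU hV hcov hdis
  set O : Set ℂ → Set ℂ := fun W => {x | ∃ ε > 0, ball x ε \ Q.P ⊆ W} with hO
  have op : ∀ W, IsOpen (O W) := by
    intro W
    rw [Metric.isOpen_iff]
    rintro x ⟨ε, hε, h⟩
    refine ⟨ε / 2, by positivity, ?_⟩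
    intro y hy
    refine ⟨ε / 2, by positivity, fun z hz => h ⟨?_, hz.2⟩⟩
    have := hz.1
    rw [mem_ball] at *
    linarith [dist_triangle z y x]
  have hfr := Q.fr_preconn
  rw [isPreconnected_iff_subset_of_disjoint] at hfr
  have cov : frontier Q.P ⊆ O U ∪ O V := by
    intro x hx
    obtain ⟨ε, hε, h⟩ := Q.out_in hx
    have hp := (h ε hε le_rfl).1
    rw [isPreconnected_iff_subset_of_disjoint] at hp
    rcases hp U V hU hV (fun z hz => hcov hz.2) (by
      rw [← subset_empty_iff, ← hdis]
      exact inter_subset_inter_left _ (fun z hz => hz.2)) with h' | h'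
    · exact Or.inl ⟨ε, hε, h'⟩
    · exact Or.inr ⟨ε, hε, h'⟩
  have hd : frontier Q.P ∩ (O U ∩ O V) = ∅ := by
    rw [← subset_empty_iff]
    rintro x ⟨hx, ⟨ε₁, h1, H1⟩, ⟨ε₂, h2, H2⟩⟩
    have hc : x ∈ closure Q.Pᶜ := by
      rw [frontier_eq_closure_inter_closure] at hx; exact hx.2
    rw [_root_.mem_closure_iff] at hc
    obtain ⟨z, ⟨hz1, hz2⟩, hz⟩ := hc (ball x ε₁ ∩ ball x ε₂) (isOpen_ball.inter isOpen_ball)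
      ⟨mem_ball_self h1, mem_ball_self h2⟩
    rw [← hdis]
    exact absurd (show z ∈ Q.Pᶜ ∩ (U ∩ V) from ⟨hz, H1 ⟨hz1, hz⟩, H2 ⟨hz2, hz⟩⟩)
      (by rw [hdis]; exact notMem_empty _)
  rcases hfr _ _ (op U) (op V) cov hd with h | h
  · exact Or.inl (claim U V hU hV hcov hdis h)
  · exact Or.inr (claim V U hV hU (by rwa [union_comm]) (by rwa [inter_comm V U]) h)

end CPoly

/-- puncturing a preconnected set -/
lemma puncture {S : Set ℂ} (hS : IsPreconnected S) {x : ℂ} {ε : ℝ} (hε : 0 < ε)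
    (h : IsPreconnected ((S ∩ ball x ε) \ {x})) : IsPreconnected (S \ {x}) := by
  rw [isPreconnected_iff_subset_of_disjoint] at *
  have claim : ∀ U V : Set ℂ, IsOpen U → IsOpen V → S \ {x} ⊆ U ∪ V →
      S \ {x} ∩ (U ∩ V) = ∅ → (S ∩ ball x ε) \ {x} ⊆ U → S \ {x} ⊆ U ∨ S \ {x} ⊆ V := by
    intro U V hU hV hcov hdis hin
    have dis : ∀ z ∈ S, z ≠ x → z ∈ U → z ∈ V → False := fun z h1 h0 h2 h3 => by
      have : z ∈ S \ {x} ∩ (U ∩ V) := ⟨⟨h1, h0⟩, h2, h3⟩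
      rw [hdis] at this; exact this
    rcases hS (U ∪ ball x ε) (V \ closedBall x (ε / 2)) (hU.union isOpen_ball)
      (hV.sdiff isClosed_closedBall) (by
        intro z hz
        by_cases hb : z ∈ ball x ε
        · exact Or.inl (Or.inr hb)
        · have hzx : z ≠ x := by rintro rfl; exact hb (mem_ball_self hε)
          rcases hcov ⟨hz, hzx⟩ with h' | h'
          · exact Or.inl (Or.inl h')
          · refine Or.inr ⟨h', fun hc => hb ?_⟩
            rw [mem_closedBall] at hc
            rw [mem_ball]; linarith) (by
        rw [← subset_empty_iff]
        rintro z ⟨hz, hz1, hz2, hz3⟩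
        have hzx : z ≠ x := by rintro rfl; exact hz3 (mem_closedBall_self (by positivity))
        rcases hz1 with h' | h'
        · exact dis z hz hzx h' hz2
        · exact dis z hz hzx (hin ⟨⟨hz, h'⟩, hzx⟩) hz2) with h' | h'
    · left
      intro z hz
      rcases h' hz.1 with h'' | h''
      · exact h''
      · exact hin ⟨⟨hz.1, h''⟩, hz.2⟩
    · right
      intro z hz
      exact (h' hz.1).1
  intro U V hU hV hcov hdis
  rcases h U V hU hV (fun z hz => hcov ⟨hz.1.1, hz.2⟩) (by
    rw [← subset_empty_iff, ← hdis]
    exact inter_subset_inter_left _ (fun z hz => ⟨hz.1.1, hz.2⟩)) with h' | h'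
  · exact claim U V hU hV hcov hdis h'
  · exact (claim V U hV hU (by rwa [union_comm]) (by rwa [inter_comm V U]) h').symm

namespace CPoly
variable (Q : CPoly)

/-- removing finitely many boundary points keeps `P` connected -/
lemma punct_finite (F : Set ℂ) (hF : F.Finite) (hsub : F ⊆ frontier Q.P) :
    IsPreconnected (Q.P \ F) := by
  induction F, hF using Set.Finite.induction_on with
  | empty => simpa using Q.conn.isPreconnected
  | @insert x F hx hF ih =>
    have ih' := ih (fun z hz => hsub (mem_insert_of_mem _ hz))
    have e : Q.P \ insert x F = (Q.P \ F) \ {x} := by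
      ext z; simp; tauto
    rw [e]
    obtain ⟨ε₀, hε₀, h⟩ := Q.out_in (hsub (mem_insert x F))
    obtain ⟨ε₁, hε₁, h1⟩ := Metric.isOpen_iff.1 hF.isClosed.isOpen_compl x hx
    apply puncture ih' (ε := min ε₀ ε₁) (by positivity)
    have e2 : ((Q.P \ F) ∩ ball x (min ε₀ ε₁)) \ {x} = (Q.P ∩ ball x (min ε₀ ε₁)) \ {x} := by
      ext z
      constructor
      · rintro ⟨⟨⟨h1, h2⟩, h3⟩, h4⟩; exact ⟨⟨h1, h3⟩, h4⟩
      · rintro ⟨⟨h2, h3⟩, h4⟩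
        exact ⟨⟨⟨h2, h1 (ball_subset_ball (min_le_right _ _) h3)⟩, h3⟩, h4⟩
    rw [e2]
    exact (h _ (by positivity) (min_le_left _ _)).2

/-- clopen-in-`P \ F` principle -/
lemma clopen_punct {F W : Set ℂ} (hF : F.Finite) (hsub : F ⊆ frontier Q.P)
    (hcl : ∀ x ∈ Q.P, x ∉ F → x ∉ W → ∃ ε > 0, ∀ z ∈ Q.P, dist z x < ε → z ∉ W)
    (hop : ∀ x ∈ Q.P, x ∉ F → x ∈ W → ∃ ε > 0, ∀ z ∈ Q.P, dist z x < ε → z ∈ W)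
    {x : ℂ} (hx : x ∈ Q.P) (hxF : x ∉ F) (hxW : x ∈ W) : Q.P \ F ⊆ W := by
  have hp := Q.punct_finite F hF hsub
  rw [isPreconnected_iff_subset_of_disjoint] at hp
  set U : Set ℂ := {x | ∃ ε > 0, ∀ z ∈ Q.P, dist z x < ε → z ∈ W}
  set V : Set ℂ := {x | ∃ ε > 0, ∀ z ∈ Q.P, dist z x < ε → z ∉ W}
  have hU : IsOpen U := by
    rw [Metric.isOpen_iff]
    rintro x ⟨ε, hε, h⟩
    refine ⟨ε / 2, by positivity, fun y hy => ⟨ε / 2, by positivity, fun z hzP hz => h z hzP ?_⟩⟩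
    rw [mem_ball] at hy
    linarith [dist_triangle z y x]
  have hV : IsOpen V := by
    rw [Metric.isOpen_iff]
    rintro x ⟨ε, hε, h⟩
    refine ⟨ε / 2, by positivity, fun y hy => ⟨ε / 2, by positivity, fun z hzP hz => h z hzP ?_⟩⟩
    rw [mem_ball] at hy
    linarith [dist_triangle z y x]
  have iU : ∀ z ∈ Q.P, z ∈ U → z ∈ W := by
    rintro z hz ⟨ε, hε, h⟩; exact h z hz (by simpa using hε)
  have iV : ∀ z ∈ Q.P, z ∈ V → z ∉ W := by
    rintro z hz ⟨ε, hε, h⟩; exact h z hz (by simpa using hε)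
  rcases hp U V hU hV (by
      rintro z ⟨hz, hzF⟩
      by_cases hzW : z ∈ W
      · exact Or.inl (hop z hz hzF hzW)
      · exact Or.inr (hcl z hz hzF hzW)) (by
      rw [← subset_empty_iff]
      rintro z ⟨⟨hz, _⟩, h1, h2⟩
      exact iV z hz h2 (iU z hz h1)) with h | h
  · exact fun z hz => iU z hz.1 (h hz)
  · exact absurd hxW (iV x hx (h ⟨hx, hxF⟩))

/-- filling lemma -/
lemma filling {a b c : ℂ} (hne : cr (b - a) (c - a) ≠ 0) (hab : segment ℝ a b ⊆ Q.P)
    (hac : segment ℝ a c ⊆ Q.P) (hbc : segment ℝ b c ⊆ Q.P) {β γ : ℝ} (hβ : 0 ≤ β) (hγ : 0 ≤ γ)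
    (hs : β + γ ≤ 1) : a + (β • (b - a) + γ • (c - a)) ∈ Q.P := by
  set D := cr (b - a) (c - a) with hD
  set fβ : ℂ → ℝ := fun z => cr (z - a) (c - a) / D with hfβ
  set fγ : ℂ → ℝ := fun z => cr (b - a) (z - a) / D with hfγ
  have cβ : Continuous fβ := by simp only [hfβ]; unfold cr; fun_prop
  have cγ : Continuous fγ := by simp only [hfγ]; unfold cr; fun_prop
  have rep : ∀ z, z = a + (fβ z • (b - a) + fγ z • (c - a)) := by
    intro z
    have := cr_basis hne (z - a)
    simp only [hfβ, hfγ, hD]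
    rw [← this]; ring
  have val : ∀ s t : ℝ, fβ (a + (s • (b - a) + t • (c - a))) = s ∧
      fγ (a + (s • (b - a) + t • (c - a))) = t := by
    intro s t
    simp only [hfβ, hfγ]
    constructor
    · rw [add_sub_cancel_left, cr_add_left, cr_smul_left, cr_smul_left, cr_self, ← hD]; field_simp; simp
    · rw [add_sub_cancel_left, cr_add_right, cr_smul_right, cr_smul_right, cr_self, ← hD]; field_simp; simp
  by_contra hz
  set z := a + (β • (b - a) + γ • (c - a)) with hzdef
  have hbd : Bornology.IsBounded Q.P := Q.cpt.isBounded
  obtain ⟨R, hR⟩ := hbd.subset_ball a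
  set R' := max R 0 + ‖b - a‖ + ‖c - a‖ + 1 with hR'
  have hR'0 : 0 < R' := by positivity
  set T : Set ℂ := {z | 0 ≤ fβ z ∧ 0 ≤ fγ z ∧ fβ z + fγ z ≤ 1}
  have hfar : a + (R' : ℂ) ∉ Q.P := by
    intro h
    have := hR h
    rw [mem_ball, dist_eq_norm, add_sub_cancel_left, Complex.norm_real,
      Real.norm_of_nonneg hR'0.le] at this
    have := le_max_left R 0
    linarith [norm_nonneg (b - a), norm_nonneg (c - a)]
  have hfarT : a + (R' : ℂ) ∉ T := by
    rintro ⟨h1, h2, h3⟩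
    have := rep (a + (R' : ℂ))
    have e : (R' : ℂ) = fβ (a + (R' : ℂ)) • (b - a) + fγ (a + (R' : ℂ)) • (c - a) := by
      linear_combination this
    have : R' ≤ ‖b - a‖ + ‖c - a‖ := by
      calc R' = ‖(R' : ℂ)‖ := by rw [Complex.norm_real, Real.norm_of_nonneg hR'0.le]
        _ = ‖fβ (a + (R' : ℂ)) • (b - a) + fγ (a + (R' : ℂ)) • (c - a)‖ := by rw [← e]
        _ ≤ ‖fβ (a + (R' : ℂ)) • (b - a)‖ + ‖fγ (a + (R' : ℂ)) • (c - a)‖ := norm_add_le _ _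
        _ = fβ (a + (R' : ℂ)) * ‖b - a‖ + fγ (a + (R' : ℂ)) * ‖c - a‖ := by
          rw [norm_smul, norm_smul, Real.norm_of_nonneg h1, Real.norm_of_nonneg h2]
        _ ≤ 1 * ‖b - a‖ + 1 * ‖c - a‖ := by gcongr <;> linarith
        _ = _ := by ring
    have := le_max_right R 0
    linarith
  have hzT : z ∈ T := by
    obtain ⟨h1, h2⟩ := val β γ
    exact ⟨by rw [h1]; exact hβ, by rw [h2]; exact hγ, by rw [h1, h2]; exact hs⟩
  have hside : ∀ y ∈ Q.Pᶜ, y ∉ frontier T := by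
    rintro y hy ⟨hyc, hyi⟩
    have hTc : IsClosed T :=
      (isClosed_le continuous_const cβ).inter ((isClosed_le continuous_const cγ).inter
        (isClosed_le (cβ.add cγ) continuous_const))
    rw [hTc.closure_eq] at hyc
    obtain ⟨h1, h2, h3⟩ := hyc
    have hy' := rep y
    apply hy
    rcases h1.lt_or_eq with g1 | g1
    · rcases h2.lt_or_eq with g2 | g2
      · rcases h3.lt_or_eq with g3 | g3
        · exfalso
          apply hyi
          refine mem_interior.2 ⟨{z | 0 < fβ z} ∩ ({z | 0 < fγ z} ∩ {z | fβ z + fγ z < 1}), ?_, ?_,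
            g1, g2, g3⟩
          · rintro w ⟨w1, w2, w3⟩
            exact ⟨le_of_lt w1, le_of_lt w2, le_of_lt w3⟩
          · exact (isOpen_lt continuous_const cβ).inter ((isOpen_lt continuous_const cγ).inter
              (isOpen_lt (cβ.add cγ) continuous_const))
        · apply hbc
          rw [mem_seg]
          refine ⟨fγ y, h2, by linarith, ?_⟩
          have : fβ y = 1 - fγ y := by linarith
          rw [this] at hy'
          rw [hy', ← hy']
          simp only [Complex.real_smul] at *
          push_cast at *
          linear_combination hy'
      · apply hab
        rw [mem_seg]
        refine ⟨fβ y, h1, by linarith, ?_⟩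
        rw [← g2] at hy'
        simpa using hy'
    · apply hac
      rw [mem_seg]
      refine ⟨fγ y, h2, by linarith, ?_⟩
      rw [← g1] at hy'
      simpa using hy'
  exact hfarT (precon_in Q.compl_preconn hside hz hfar hzT)

end CPoly


lemma ev_within {P : Set ℂ} {x : ℂ} {p : ℂ → Prop} :
    (∀ᶠ z in nhdsWithin x P, p z) ↔ ∃ ε > 0, ∀ z ∈ P, dist z x < ε → p z := by
  rw [Filter.Eventually, Metric.mem_nhdsWithin_iff]
  constructor
  · rintro ⟨ε, hε, h⟩
    exact ⟨ε, hε, fun z hz hd => h ⟨hd, hz⟩⟩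
  · rintro ⟨ε, hε, h⟩
    exact ⟨ε, hε, fun z hz => h z hz.2 hz.1⟩

namespace CPoly
variable (Q : CPoly)

/-- existence of a logarithm of `z - q` on `P` -/
def Good (q : ℂ) : Prop := ∃ L : ℂ → ℂ, ContinuousOn L Q.P ∧ ∀ z ∈ Q.P, Complex.exp (L z) = z - q

lemma good_local {q : ℂ} (hq : q ∉ Q.P) : ∃ ε > 0, ∀ q', dist q' q < ε → (Q.Good q ↔ Q.Good q') := by
  obtain ⟨ε, hε, h⟩ := Metric.isOpen_iff.1 Q.closed.isOpen_compl q hq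
  refine ⟨ε, hε, fun q' hq' => ?_⟩
  have hz : ∀ z ∈ Q.P, ε ≤ ‖z - q‖ := by
    intro z hz
    by_contra hc
    push Not at hc
    rw [← dist_eq_norm] at hc
    exact h hc hz
  have hq'P : q' ∉ Q.P := h hq'
  have hne : ∀ z ∈ Q.P, z - q ≠ 0 := fun z hz h0 => hq (by rwa [sub_eq_zero.1 h0] at hz)
  have hne' : ∀ z ∈ Q.P, z - q' ≠ 0 := fun z hz h0 => hq'P (by rwa [sub_eq_zero.1 h0] at hz)
  have slit : ∀ z ∈ Q.P, (z - q') / (z - q) ∈ Complex.slitPlane := by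
    intro z hzP
    have e : (z - q') / (z - q) = 1 + (q - q') / (z - q) := by
      field_simp [hne z hzP]; ring
    rw [e]
    apply Complex.mem_slitPlane_of_norm_lt_one
    have := hz z hzP
    rw [norm_div, div_lt_one (by linarith)]
    rw [dist_comm, dist_eq_norm] at hq'
    linarith
  have cont : ContinuousOn (fun z => Complex.log ((z - q') / (z - q))) Q.P := by
    apply ContinuousOn.clog
    · apply ContinuousOn.div (by fun_prop) (by fun_prop) hne
    · exact slit
  have ex : ∀ z ∈ Q.P, Complex.exp (Complex.log ((z - q') / (z - q))) = (z - q') / (z - q) :=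
    fun z hz => Complex.exp_log (div_ne_zero (hne' z hz) (hne z hz))
  constructor
  · rintro ⟨L, hL, hL'⟩
    refine ⟨fun z => L z + Complex.log ((z - q') / (z - q)), hL.add cont, fun z hz => ?_⟩
    rw [Complex.exp_add, ex z hz, hL' z hz, mul_div_cancel₀ _ (hne z hz)]
  · rintro ⟨L, hL, hL'⟩
    refine ⟨fun z => L z - Complex.log ((z - q') / (z - q)), hL.sub cont, fun z hz => ?_⟩
    rw [Complex.exp_sub, ex z hz, hL' z hz, div_div_cancel₀ (hne' z hz)]

lemma good_all {q : ℂ} (hq : q ∉ Q.P) : Q.Good q := by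
  have hp := Q.compl_preconn
  rw [isPreconnected_iff_subset_of_disjoint] at hp
  set U : Set ℂ := {q | ∃ ε > 0, ∀ q', dist q' q < ε → Q.Good q'}
  set V : Set ℂ := {q | ∃ ε > 0, ∀ q', dist q' q < ε → ¬ Q.Good q'}
  have hU : IsOpen U := by
    rw [Metric.isOpen_iff]
    rintro x ⟨ε, hε, h⟩
    refine ⟨ε / 2, by positivity, fun y hy => ⟨ε / 2, by positivity, fun z hz => h z ?_⟩⟩
    rw [mem_ball] at hy
    linarith [dist_triangle z y x]
  have hV : IsOpen V := by
    rw [Metric.isOpen_iff]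
    rintro x ⟨ε, hε, h⟩
    refine ⟨ε / 2, by positivity, fun y hy => ⟨ε / 2, by positivity, fun z hz => h z ?_⟩⟩
    rw [mem_ball] at hy
    linarith [dist_triangle z y x]
  have iU : ∀ z ∈ U, Q.Good z := by
    rintro z ⟨ε, hε, h⟩; exact h z (by simpa using hε)
  have iV : ∀ z ∈ V, ¬ Q.Good z := by
    rintro z ⟨ε, hε, h⟩; exact h z (by simpa using hε)
  rcases hp U V hU hV (by
      intro z hz
      obtain ⟨ε, hε, h⟩ := Q.good_local hz
      by_cases hg : Q.Good z
      · exact Or.inl ⟨ε, hε, fun q' hq' => (h q' hq').1 hg⟩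
      · exact Or.inr ⟨ε, hε, fun q' hq' hc => hg ((h q' hq').2 hc)⟩) (by
      rw [← subset_empty_iff]
      rintro z ⟨_, h1, h2⟩
      exact iV z h2 (iU z h1)) with h | h
  · exact iU q (h hq)
  · exfalso
    obtain ⟨R, hR⟩ := Q.cpt.isBounded.subset_ball 0
    have hre : ∀ z ∈ Q.P, 0 < (z - (-(R : ℂ))).re := by
      intro z hz
      have h1 := hR hz
      rw [mem_ball, dist_zero_right] at h1
      have h2 := Complex.abs_re_le_norm z
      have h3 := neg_abs_le z.re
      simp
      linarith
    have hout : -(R : ℂ) ∉ Q.P := by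
      intro hz
      have := hre _ hz
      simp at this
    apply iV _ (h hout)
    refine ⟨fun z => Complex.log (z - (-(R : ℂ))), ?_, ?_⟩
    · apply ContinuousOn.clog (by fun_prop)
      intro z hz
      exact Or.inl (hre z hz)
    · intro z hz
      apply Complex.exp_log
      intro h0
      have := hre z hz
      rw [h0] at this; simp at this

/-- a vertex has a continuous angle function -/
lemma angle {a : ℂ} (ha : a ∈ frontier Q.P) : ∃ θ : ℂ → ℝ,
    (∀ x ∈ Q.P, x ≠ a → ContinuousWithinAt θ Q.P x) ∧
    ∀ z ∈ Q.P, z ≠ a → z - a = ‖z - a‖ * Complex.exp (θ z * Complex.I) := by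
  obtain ⟨ε, hε, h⟩ := Q.conic (Q.fr_sub ha)
  have hc : a ∈ closure Q.Pᶜ := by
    rw [frontier_eq_closure_inter_closure] at ha; exact ha.2
  rw [_root_.mem_closure_iff] at hc
  obtain ⟨q, hq, hqP⟩ := hc (ball a ε) isOpen_ball (mem_ball_self hε)
  have hray : ∀ t : ℝ, 0 < t → t ≤ 1 → a + t • (q - a) ∉ Q.P := fun t h0 h1 hc =>
    hqP ((h q hq t h0 h1).2 hc)
  obtain ⟨L, hL, hL'⟩ := Q.good_all hqP
  have hne : ∀ z ∈ Q.P, z - q ≠ 0 := fun z hz h0 => hqP (by rwa [sub_eq_zero.1 h0] at hz)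
  have slit : ∀ z ∈ Q.P, z ≠ a → (z - a) / (z - q) ∈ Complex.slitPlane := by
    intro z hz hza
    rw [Complex.mem_slitPlane_iff_not_le_zero]
    intro hle
    obtain ⟨h1, h2⟩ := Complex.le_def.1 hle
    simp only [Complex.zero_re, Complex.zero_im] at h1 h2
    set k := -((z - a) / (z - q)).re with hk
    have hk0 : 0 ≤ k := by linarith
    have e : (z - a) / (z - q) = -(k : ℂ) := by
      apply Complex.ext
      · simp [hk]
      · rw [h2]; simp
    rw [div_eq_iff (hne z hz)] at e
    have hk1 : k ≠ 0 := by
      intro h0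
      rw [h0] at e
      simp at e
      exact hza (sub_eq_zero.1 e)
    have hk2 : 0 < k := lt_of_le_of_ne hk0 hk1.symm
    apply hray (k / (1 + k)) (by positivity) (by rw [div_le_one (by positivity)]; linarith)
    have hc : (1 + (k : ℂ)) ≠ 0 := by
      have : (1 + k : ℝ) ≠ 0 := by positivity
      exact_mod_cast this
    have : a + (k / (1 + k)) • (q - a) = z := by
      rw [Complex.real_smul]
      push_cast
      field_simp
      linear_combination -e
    rw [this]; exact hz
  refine ⟨fun z => (L z).im + Complex.arg ((z - a) / (z - q)), ?_, ?_⟩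
  · intro x hx hxa
    apply ContinuousWithinAt.add
    · exact Complex.continuous_im.continuousAt.comp_continuousWithinAt (hL x hx)
    · have hdiv : ContinuousWithinAt (fun z => (z - a) / (z - q)) Q.P x :=
        ContinuousWithinAt.div (by fun_prop) (by fun_prop) (hne x hx)
      exact ContinuousAt.comp_continuousWithinAt (f := fun z => (z - a) / (z - q))
        (Complex.continuousAt_arg (slit x hx hxa)) hdiv
  · intro z hz hza
    have e1 : z - q = ‖z - q‖ * Complex.exp ((L z).im * Complex.I) := by
      have hn : ‖z - q‖ = Real.exp (L z).re := by rw [← hL' z hz, Complex.norm_exp]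
      rw [hn, ← hL' z hz, Complex.ofReal_exp, ← Complex.exp_add, Complex.re_add_im]
    have e2 := Complex.norm_mul_exp_arg_mul_I ((z - a) / (z - q))
    have e3 : z - a = (z - q) * ((z - a) / (z - q)) := by
      rw [mul_div_cancel₀ _ (hne z hz)]
    have e4 : ‖z - a‖ = ‖z - q‖ * ‖(z - a) / (z - q)‖ := by
      rw [← norm_mul, ← e3]
    rw [e4]
    push_cast
    rw [add_mul, Complex.exp_add]
    calc z - a = (z - q) * ((z - a) / (z - q)) := e3
      _ = (‖z - q‖ * Complex.exp ((L z).im * Complex.I)) *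
          (‖(z - a) / (z - q)‖ * Complex.exp (Complex.arg ((z - a) / (z - q)) * Complex.I)) := by
        rw [← e1, e2]
      _ = _ := by ring

/-- Separation function of a chord. -/
lemma sep {a c : ℂ} (ha : a ∈ frontier Q.P) (hc : c ∈ frontier Q.P) (hac : a ≠ c)
    (hsub : segment ℝ a c ⊆ Q.P) : ∃ N : ℂ → ℤ,
    (∀ x ∈ Q.P, x ∉ segment ℝ a c → ∃ ε > 0, ∀ z ∈ Q.P, dist z x < ε → N z = N x) ∧
    (∀ m ∈ openSegment ℝ a c, ∃ ε > 0, ∃ k : ℤ, ∀ z ∈ Q.P, dist z m < ε →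
      (0 < cr (c - a) (z - a) → N z = k) ∧ (cr (c - a) (z - a) < 0 → N z = k - 1)) := by
  obtain ⟨α, hα, hα'⟩ := Q.angle ha
  obtain ⟨κ, hκ, hκ'⟩ := Q.angle hc
  set r : ℂ → ℂ := fun z => (z - a) / (z - c) with hr
  set F : ℂ → ℝ := fun z => α z - κ z with hF
  have pi2 := Real.two_pi_pos
  have int : ∀ z ∈ Q.P, z ≠ a → z ≠ c → ∃ n : ℤ, F z - Complex.arg (r z) = n * (2 * Real.pi) := by
    intro z hz hza hzc
    have e1 := hα' z hz hza
    have e2 := hκ' z hz hzc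
    have e3 := Complex.norm_mul_exp_arg_mul_I (r z)
    have na : (‖z - a‖ : ℂ) ≠ 0 := by
      exact_mod_cast (norm_pos_iff.2 (sub_ne_zero.2 hza)).ne'
    have nc : (‖z - c‖ : ℂ) ≠ 0 := by
      exact_mod_cast (norm_pos_iff.2 (sub_ne_zero.2 hzc)).ne'
    have hzc' : z - c ≠ 0 := sub_ne_zero.2 hzc
    have nr : (‖r z‖ : ℂ) = ‖z - a‖ / ‖z - c‖ := by
      rw [hr]; simp only [norm_div]; push_cast; rfl
    have hexp : Complex.exp (((F z - Complex.arg (r z) : ℝ) : ℂ) * Complex.I) = 1 := by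
      simp only [hF]
      push_cast
      rw [sub_mul, sub_mul, Complex.exp_sub, Complex.exp_sub]
      have x1 : Complex.exp (α z * Complex.I) = (z - a) / ‖z - a‖ := by
        rw [eq_div_iff na, mul_comm]; exact e1.symm
      have x2 : Complex.exp (κ z * Complex.I) = (z - c) / ‖z - c‖ := by
        rw [eq_div_iff nc, mul_comm]; exact e2.symm
      have x3 : Complex.exp (Complex.arg (r z) * Complex.I) =
          ((z - a) / (z - c)) / (‖z - a‖ / ‖z - c‖) := by
        rw [← nr, eq_div_iff (by rw [nr]; exact div_ne_zero na nc), mul_comm]; exact e3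
      rw [x1, x2, x3]
      have hza' : z - a ≠ 0 := sub_ne_zero.2 hza
      field_simp
    obtain ⟨n, hn⟩ := Complex.exp_eq_one_iff.1 hexp
    refine ⟨n, ?_⟩
    have : ((F z - Complex.arg (r z) : ℝ) : ℂ) = n * (2 * Real.pi) := by
      have hI := Complex.I_ne_zero
      apply mul_right_cancel₀ hI
      rw [hn]; ring
    exact_mod_cast this
  set N : ℂ → ℤ := fun z => round ((F z - Complex.arg (r z)) / (2 * Real.pi)) with hN
  have Nval : ∀ z ∈ Q.P, z ≠ a → z ≠ c → F z - Complex.arg (r z) = N z * (2 * Real.pi) := by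
    intro z hz hza hzc
    obtain ⟨n, hn⟩ := int z hz hza hzc
    have : N z = n := by
      simp only [hN]; rw [hn, mul_div_cancel_right₀ _ pi2.ne', round_intCast]
    rw [this, hn]
  have inteq : ∀ m n : ℤ, |(m : ℝ) * (2 * Real.pi) - n * (2 * Real.pi)| < 2 * Real.pi → m = n := by
    intro m n h
    rw [← sub_mul, abs_mul, abs_of_pos pi2] at h
    have h1 : |(m : ℝ) - n| < 1 := by
      by_contra hc
      push Not at hc
      nlinarith
    have h2 : |m - n| < 1 := by exact_mod_cast h1
    have := Int.abs_lt_one_iff.1 h2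
    omega
  have Fc : ∀ x ∈ Q.P, x ≠ a → x ≠ c → ContinuousWithinAt F Q.P x := fun x hx h1 h2 =>
    (hα x hx h1).sub (hκ x hx h2)
  have rc : ∀ x, x ≠ c → ContinuousAt r x := fun x hx =>
    ContinuousAt.div (by fun_prop) (by fun_prop) (sub_ne_zero.2 hx)
  have evne : ∀ x y : ℂ, x ≠ y → ∀ᶠ z in nhdsWithin x Q.P, z ≠ y := fun x y h =>
    (eventually_ne_nhds h).filter_mono nhdsWithin_le_nhds
  have him : ∀ z, z ≠ c → ∃ k : ℝ, 0 < k ∧ (r z).im = - k * cr (c - a) (z - a) := by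
    intro z hz
    have hn : 0 < Complex.normSq (z - c) := Complex.normSq_pos.2 (sub_ne_zero.2 hz)
    refine ⟨(Complex.normSq (z - c))⁻¹, by positivity, ?_⟩
    simp only [hr, Complex.div_im, cr]
    simp only [Complex.sub_re, Complex.sub_im]
    field_simp
    ring
  refine ⟨N, ?_, ?_⟩
  · intro x hx hxs
    have hxa : x ≠ a := by rintro rfl; exact hxs (left_mem_segment _ _ _)
    have hxc : x ≠ c := by rintro rfl; exact hxs (right_mem_segment _ _ _)
    have slit : r x ∈ Complex.slitPlane := by
      rw [Complex.mem_slitPlane_iff_not_le_zero]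
      intro hle
      obtain ⟨h1, h2⟩ := Complex.le_def.1 hle
      simp only [Complex.zero_re, Complex.zero_im] at h1 h2
      set k := -(r x).re with hk
      have hk0 : 0 ≤ k := by linarith
      have e : (x - a) / (x - c) = -(k : ℂ) := by
        show r x = _
        apply Complex.ext
        · simp [hk]
        · rw [h2]; simp
      rw [div_eq_iff (sub_ne_zero.2 hxc)] at e
      apply hxs
      rw [mem_seg]
      refine ⟨k / (1 + k), by positivity, by rw [div_le_one (by positivity)]; linarith, ?_⟩
      have hc : (1 + (k : ℂ)) ≠ 0 := by
        have : (1 + k : ℝ) ≠ 0 := by positivity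
        exact_mod_cast this
      rw [Complex.real_smul]
      push_cast
      field_simp
      linear_combination e
    have hcont : ContinuousWithinAt (fun z => F z - Complex.arg (r z)) Q.P x := by
      apply (Fc x hx hxa hxc).sub
      exact ((Complex.continuousAt_arg slit).comp (rc x hxc)).continuousWithinAt
    have h1 := Metric.tendsto_nhds.1 hcont (2 * Real.pi) pi2
    have := (h1.and ((evne x a hxa).and (evne x c hxc)))
    rw [ev_within] at this
    obtain ⟨ε, hε, h⟩ := this
    refine ⟨ε, hε, fun z hz hd => ?_⟩
    obtain ⟨h1, h2, h3⟩ := h z hz hd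
    apply inteq
    rw [← Nval z hz h2 h3, ← Nval x hx hxa hxc]
    exact h1
  · intro m hm
    have hmP : m ∈ Q.P := hsub (openSegment_subset_segment _ _ _ hm)
    have hma : m ≠ a := by
      rintro rfl; exact hac (left_mem_openSegment_iff.1 hm)
    have hmc : m ≠ c := by
      rintro rfl; exact hac (right_mem_openSegment_iff.1 hm)
    obtain ⟨s, t, hs, ht, hst, hmst⟩ := hm
    have hmr : r m = ((-(t / s) : ℝ) : ℂ) := by
      simp only [hr]
      rw [div_eq_iff (sub_ne_zero.2 hmc), ← hmst]
      have hs' : (s : ℂ) ≠ 0 := by exact_mod_cast hs.ne'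
      have hss : s = 1 - t := by linarith
      simp only [Complex.real_smul]
      push_cast
      field_simp
      rw [hss]; push_cast; ring
    have hre : (r m).re < 0 := by
      rw [hmr, Complex.ofReal_re]; have : 0 < t / s := by positivity
      linarith
    have him0 : (r m).im = 0 := by rw [hmr, Complex.ofReal_im]
    have hargm : Complex.arg (r m) = Real.pi := Complex.arg_eq_pi_iff.2 ⟨hre, him0⟩
    have hFm := Nval m hmP hma hmc
    rw [hargm] at hFm
    have tr : Filter.Tendsto r (nhdsWithin m Q.P) (nhds (r m)) :=
      (rc m hmc).tendsto.mono_left nhdsWithin_le_nhds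
    have c1 := Metric.tendsto_nhds.1 (Fc m hmP hma hmc) Real.pi Real.pi_pos
    have c2 := Metric.tendsto_nhds.1
      (Complex.continuousWithinAt_arg_of_re_neg_of_im_zero hre him0) Real.pi Real.pi_pos
    have c3 := Metric.tendsto_nhds.1
      (Complex.tendsto_arg_nhdsWithin_im_neg_of_re_neg_of_im_zero hre him0) Real.pi Real.pi_pos
    rw [eventually_nhdsWithin_iff] at c2 c3
    have := c1.and ((tr.eventually c2).and ((tr.eventually c3).and
      ((evne m a hma).and (evne m c hmc))))
    rw [ev_within] at this
    obtain ⟨ε, hε, h⟩ := this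
    refine ⟨ε, hε, N m + 1, fun z hz hd => ?_⟩
    obtain ⟨h1, h2, h3, h4, h5⟩ := h z hz hd
    obtain ⟨k, hk, hki⟩ := him z h5
    have hNz := Nval z hz h4 h5
    rw [Real.dist_eq] at h1
    constructor
    · intro hpos
      have h3' := h3 (by show (r z).im < 0; rw [hki]; nlinarith [mul_pos hk hpos])
      rw [Real.dist_eq] at h3'
      apply inteq
      rw [← hNz]
      push_cast
      rw [add_mul, ← hFm]
      have b1 := abs_lt.1 h1
      have b2 := abs_lt.1 h3'
      rw [abs_lt]
      constructor <;> linarith [b1.1, b1.2, b2.1, b2.2]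
    · intro hneg
      have h2' := h2 (by show 0 ≤ (r z).im; rw [hki]; nlinarith [mul_pos_of_neg_of_neg (neg_neg_of_pos hk) hneg])
      rw [hargm, Real.dist_eq] at h2'
      rw [add_sub_cancel_right]
      apply inteq
      rw [← hNz, ← hFm]
      have b1 := abs_lt.1 h1
      have b2 := abs_lt.1 h2'
      rw [abs_lt]
      constructor <;> linarith [b1.1, b1.2, b2.1, b2.2]

end CPoly


lemma seg_mem {x y : ℂ} {t : ℝ} (h0 : 0 ≤ t) (h1 : t ≤ 1) : x + t • (y - x) ∈ segment ℝ x y :=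
  mem_seg.2 ⟨t, h0, h1, rfl⟩

lemma cr_affine (u v o y : ℂ) (τ : ℝ) :
    cr u (o + τ • (y - o) - v) = (1 - τ) * cr u (o - v) + τ * cr u (y - v) := by
  simp [cr]; ring

namespace CPoly
variable (Q : CPoly)

/-- points of the line of an edge, reachable from the edge without meeting vertices -/
lemma edge_extend {j : ZMod Q.n} {p x : ℂ} (hp : p ∈ Q.E j) (hpv : ∀ i, p ≠ Q.V i)
    (hcr : cr (Q.dir j) (x - Q.V j) = 0)
    (hno : ∀ t : ℝ, 0 ≤ t → t ≤ 1 → ∀ i, p + t • (x - p) ≠ Q.V i) : x ∈ Q.E j := by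
  obtain ⟨s, hs0, hs1, hps⟩ := mem_seg.1 hp
  obtain ⟨t, ht⟩ := cr_eq_zero (Q.dir_ne j) hcr
  have hx : x = Q.V j + t • (Q.V (j + 1) - Q.V j) := by
    show x = Q.V j + t • Q.dir j
    rw [← ht]; ring
  rw [show Q.E j = segment ℝ (Q.V j) (Q.V (j + 1)) from rfl, mem_seg]
  have hs0' : 0 < s := by
    rcases hs0.lt_or_eq with h | h
    · exact h
    · exact absurd (by rw [hps, ← h]; simp) (hpv j)
  have hs1' : s < 1 := by
    rcases hs1.lt_or_eq with h | h
    · exact h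
    · exact absurd (by rw [hps, h]; simp) (hpv (j + 1))
  refine ⟨t, ?_, ?_, hx⟩
  · by_contra hc
    push Not at hc
    have hst : 0 < s - t := by linarith
    apply hno (s / (s - t)) (by positivity) (by rw [div_le_one hst]; linarith) j
    rw [hps, hx]
    have : (s : ℂ) - t ≠ 0 := by exact_mod_cast hst.ne'
    simp only [Complex.real_smul]
    push_cast
    field_simp
    ring
  · by_contra hc
    push Not at hc
    have hst : 0 < t - s := by linarith
    apply hno ((1 - s) / (t - s)) (div_nonneg (by linarith) hst.le)
      (by rw [div_le_one hst]; linarith) (j + 1)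
    rw [hps, hx]
    have : (t : ℂ) - s ≠ 0 := by exact_mod_cast hst.ne'
    simp only [Complex.real_smul]
    push_cast
    field_simp
    ring

lemma vis_open {o x : ℂ} (hox : segment ℝ o x ⊆ Q.P)
    (hno : x = o ∨ ∀ τ : ℝ, 0 < τ → τ ≤ 1 → ∀ i, o + τ • (x - o) ≠ Q.V i) :
    ∃ ε > 0, ∀ y ∈ Q.P, dist y x < ε → segment ℝ o y ⊆ Q.P := by
  have hoP : o ∈ Q.P := hox (left_mem_segment _ _ _)
  have hxP : x ∈ Q.P := hox (right_mem_segment _ _ _)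
  rcases hno with rfl | hno
  · obtain ⟨ε, hε, h⟩ := Q.conic hxP
    refine ⟨ε, hε, fun y hy hd z hz => ?_⟩
    obtain ⟨t, h0, h1, rfl⟩ := mem_seg.1 hz
    rcases h0.lt_or_eq with h' | h'
    · exact (h y hd t h' h1).1 hy
    · rw [← h']; simpa using hxP
  -- points of the parametrised segments
  have close : ∀ (τ₀ : ℝ) (U : Set ℂ), U ∈ nhds (o + τ₀ • (x - o)) → ∃ ε > 0, ∀ τ y,
      |τ - τ₀| < ε → dist y x < ε → o + τ • (y - o) ∈ U := by
    intro τ₀ U hU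
    have hc : ContinuousAt (fun p : ℝ × ℂ => o + p.1 • (p.2 - o)) (τ₀, x) := by fun_prop
    have := hc.eventually_mem hU
    rw [Metric.eventually_nhds_iff] at this
    obtain ⟨ε, hε, h⟩ := this
    refine ⟨ε, hε, fun τ y h1 h2 => h (y := (τ, y)) ?_⟩
    rw [Prod.dist_eq, max_lt_iff]
    exact ⟨h1, h2⟩
  have loc : ∀ τ₀ : ℝ, 0 < τ₀ → τ₀ ≤ 1 → ∃ ε > 0, ∀ τ, τ ≤ 1 → 0 ≤ τ → |τ - τ₀| < ε → ∀ y ∈ Q.P,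
      dist y x < ε → o + τ • (y - o) ∈ Q.P := by
    intro τ₀ h0 h1
    set p := o + τ₀ • (x - o) with hp
    have hpP : p ∈ Q.P := hox (seg_mem h0.le h1)
    by_cases hf : p ∈ frontier Q.P
    · obtain ⟨j, hj⟩ := Q.mem_fr.1 hf
      have hpv : ∀ i, p ≠ Q.V i := hno τ₀ h0 h1
      obtain ⟨u, hu, H⟩ := Q.halfE j
      obtain ⟨ε₁, hε₁, H1⟩ := H p hj hpv
      obtain ⟨ε₂, hε₂, hcl⟩ := close τ₀ (ball p ε₁) (ball_mem_nhds _ hε₁)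
      have hup : cr u (p - Q.V j) = 0 := by
        have := Q.cr_dir_edge hj
        rcases hu with rfl | rfl
        · exact this
        · rw [cr_neg_left, this, neg_zero]
      have hup' := hup
      rw [hp, cr_affine] at hup'
      have hxτ : ∀ τ : ℝ, 0 ≤ τ → τ ≤ 1 → |τ - τ₀| < ε₂ →
          0 ≤ (1 - τ) * cr u (o - Q.V j) + τ * cr u (x - Q.V j) := by
        intro τ t0 t1 ht
        rw [← cr_affine]
        exact (H1 _ (hcl τ x ht (by simpa using hε₂))).1 (hox (seg_mem t0 t1))
      -- o is on the good side
      set A := cr u (o - Q.V j)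
      set B := cr u (x - Q.V j)
      have hA : 0 ≤ A := by
        set η := min (ε₂ / 2) τ₀
        have hη : 0 < η := by positivity
        have := hxτ (τ₀ - η) (by linarith [min_le_right (ε₂ / 2) τ₀]) (by linarith) (by
          rw [sub_sub_cancel_left, abs_neg, abs_of_pos hη]; linarith [min_le_left (ε₂ / 2) τ₀])
        have h3 : 0 ≤ η * (A - B) := by nlinarith
        have h4 : 0 ≤ A - B := nonneg_of_mul_nonneg_right h3 hη
        have : A = τ₀ * (A - B) := by linarith
        rw [this]; positivity
      have hyx : ∃ ε₃ > 0, ∀ y ∈ Q.P, dist y x < ε₃ → 0 ≤ cr u (y - Q.V j) := by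
        rcases h1.lt_or_eq with h1' | h1'
        · -- the segment runs along the edge
          have hAB : A = 0 ∧ B = 0 := by
            set η := min (ε₂ / 2) (1 - τ₀)
            have hη : 0 < η := by
              have : 0 < 1 - τ₀ := by linarith
              positivity
            have := hxτ (τ₀ + η) (by linarith) (by linarith [min_le_right (ε₂ / 2) (1 - τ₀)]) (by
              rw [add_sub_cancel_left, abs_of_pos hη]; linarith [min_le_left (ε₂ / 2) (1 - τ₀)])
            have h3 : 0 ≤ η * (B - A) := by nlinarith
            have h4 : 0 ≤ B - A := nonneg_of_mul_nonneg_right h3 hη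
            have e1 : A = -(τ₀ * (B - A)) := by linarith
            have e2 : A ≤ 0 := by rw [e1]; have : 0 ≤ τ₀ * (B - A) := by positivity
                                  linarith
            have e3 : A = 0 := le_antisymm e2 hA
            refine ⟨e3, ?_⟩
            rw [e3] at hup'
            have : τ₀ * B = 0 := by linarith
            rcases mul_eq_zero.1 this with h | h
            · linarith
            · exact h
          have hcrx : cr (Q.dir j) (x - Q.V j) = 0 := by
            have := hAB.2
            rcases hu with h | h
            · rw [← h]; exact this
            · have h' : Q.dir j = -u := by rw [h]; ring
              rw [h', cr_neg_left, neg_eq_zero]; exact this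
          have hxE : x ∈ Q.E j := by
            apply Q.edge_extend hj hpv hcrx
            intro t t0 t1 i
            have : p + t • (x - p) = o + (τ₀ + t * (1 - τ₀)) • (x - o) := by
              rw [hp]; simp; ring
            rw [this]
            apply hno
            · have : 0 ≤ t * (1 - τ₀) := mul_nonneg t0 (by linarith)
              linarith
            · nlinarith
          obtain ⟨ε₃, hε₃, H3⟩ := H x hxE (fun i => by
            have := hno 1 one_pos le_rfl i
            simpa using this)
          exact ⟨ε₃, hε₃, fun y hy hd => (H3 y hd).1 hy⟩
        · have : p = x := by rw [hp, h1']; simp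
          rw [this] at H1
          exact ⟨ε₁, hε₁, fun y hy hd => (H1 y hd).1 hy⟩
      obtain ⟨ε₃, hε₃, H3⟩ := hyx
      refine ⟨min ε₂ ε₃, by positivity, fun τ t1 t0 ht y hy hd => ?_⟩
      rw [lt_min_iff] at ht hd
      rw [H1 _ (hcl τ y ht.1 hd.1), cr_affine]
      have := H3 y hy hd.2
      have : 0 ≤ 1 - τ := by linarith
      positivity
    · obtain ⟨ε, hε, h⟩ := close τ₀ Q.P (mem_interior_iff_mem_nhds.1 (Q.not_fr_int hpP hf))
      exact ⟨ε, hε, fun τ _ _ h1 y _ h2 => h τ y h1 h2⟩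
  have loc0 : ∃ ε > 0, ∀ τ, τ ≤ 1 → 0 ≤ τ → |τ - 0| < ε → ∀ y ∈ Q.P,
      dist y x < ε → o + τ • (y - o) ∈ Q.P := by
    obtain ⟨ε₀, hε₀, h⟩ := Q.conic hoP
    set R := ‖x - o‖ + 1
    have hR : 0 < R := by positivity
    set τ₁ := min 1 (ε₀ / (2 * R))
    have hτ1 : 0 < τ₁ := by positivity
    have hτR : τ₁ * R < ε₀ := by
      have : τ₁ ≤ ε₀ / (2 * R) := min_le_right _ _
      calc τ₁ * R ≤ ε₀ / (2 * R) * R := by gcongr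
        _ = ε₀ / 2 := by field_simp
        _ < ε₀ := by linarith
    obtain ⟨ε₁, hε₁, h1⟩ := loc τ₁ hτ1 (min_le_left _ _)
    refine ⟨min (min 1 ε₁) τ₁, by positivity, fun τ t1 t0 ht y hy hd => ?_⟩
    simp only [lt_min_iff, sub_zero] at ht hd
    rw [abs_of_nonneg t0] at ht
    have hy1 := h1 τ₁ (min_le_left _ _) hτ1.le (by simpa using hε₁) y hy hd.1.2
    rcases t0.lt_or_eq with h' | h'
    · have hdist : dist (o + τ₁ • (y - o)) o < ε₀ := by
        rw [dist_eq_norm, add_sub_cancel_left, norm_smul, Real.norm_of_nonneg hτ1.le]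
        have : ‖y - o‖ ≤ R := by
          have e : y - o = (y - x) + (x - o) := by ring
          rw [e]
          have := norm_add_le (y - x) (x - o)
          have h3 := hd.1.1
          rw [dist_eq_norm] at h3
          linarith
        nlinarith
      have := (h _ hdist (τ / τ₁) (by positivity) (by rw [div_le_one hτ1]; linarith [ht.2])).1 hy1
      rw [add_sub_cancel_left, smul_smul, div_mul_cancel₀ _ hτ1.ne'] at this
      exact this
    · rw [← h']; simpa using hoP
  have locall : ∀ τ₀ ∈ Icc (0:ℝ) 1, ∃ ε > 0, ∀ τ, τ ≤ 1 → 0 ≤ τ → |τ - τ₀| < ε → ∀ y ∈ Q.P,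
      dist y x < ε → o + τ • (y - o) ∈ Q.P := by
    rintro τ₀ ⟨h0, h1⟩
    rcases h0.lt_or_eq with h | h
    · exact loc τ₀ h h1
    · rw [← h]; exact loc0
  have main : ∃ ε > 0, ∀ τ ∈ Icc (0:ℝ) 1, ∀ y ∈ Q.P, dist y x < ε → o + τ • (y - o) ∈ Q.P := by
    apply isCompact_Icc.induction_on (p := fun S => ∃ ε > 0, ∀ τ ∈ S, ∀ y ∈ Q.P, dist y x < ε →
      o + τ • (y - o) ∈ Q.P)
    · exact ⟨1, one_pos, fun τ h => absurd h (notMem_empty _)⟩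
    · rintro s t hst ⟨ε, hε, h⟩
      exact ⟨ε, hε, fun τ hτ => h τ (hst hτ)⟩
    · rintro s t ⟨ε, hε, h⟩ ⟨ε', hε', h'⟩
      refine ⟨min ε ε', by positivity, ?_⟩
      intro τ hτ y hy hd
      rw [lt_min_iff] at hd
      rcases hτ with hτ | hτ
      · exact h τ hτ y hy hd.1
      · exact h' τ hτ y hy hd.2
    · intro τ₀ hτ₀
      obtain ⟨ε, hε, h⟩ := locall τ₀ hτ₀
      refine ⟨ball τ₀ ε ∩ Icc 0 1, ?_, ε, hε, ?_⟩
      · exact Filter.inter_mem (mem_nhdsWithin_of_mem_nhds (ball_mem_nhds _ hε)) self_mem_nhdsWithin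
      · rintro τ ⟨hτ, t0, t1⟩ y hy hd
        exact h τ t1 t0 hτ y hy hd
  obtain ⟨ε, hε, h⟩ := main
  refine ⟨ε, hε, fun y hy hd z hz => ?_⟩
  obtain ⟨t, h0, h1, rfl⟩ := mem_seg.1 hz
  exact h t ⟨h0, h1⟩ y hy hd

/-- Break lemma -/
lemma brk {o : ℂ} {γ : ℝ → ℂ} (hγ : ContinuousOn γ (Icc 0 1)) (hP : MapsTo γ (Icc 0 1) Q.P)
    (h0 : segment ℝ o (γ 0) ⊆ Q.P) (h1 : ¬ segment ℝ o (γ 1) ⊆ Q.P) :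
    ∃ t : ℝ, 0 ≤ t ∧ t < 1 ∧ segment ℝ o (γ t) ⊆ Q.P ∧ ∃ i, Q.V i ∈ segment ℝ o (γ t) ∧ Q.V i ≠ o := by
  set S : Set ℝ := {t ∈ Icc (0:ℝ) 1 | segment ℝ o (γ t) ⊆ Q.P} with hS
  have hSc : IsClosed S := by
    have : S = ⋂ τ ∈ Icc (0:ℝ) 1, {t ∈ Icc (0:ℝ) 1 | o + τ • (γ t - o) ∈ Q.P} := by
      ext t
      simp only [hS, mem_iInter, mem_ofPred_eq]
      constructor
      · rintro ⟨ht, h⟩ τ hτ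
        exact ⟨ht, h (seg_mem hτ.1 hτ.2)⟩
      · intro h
        refine ⟨(h 0 (by simp)).1, fun z hz => ?_⟩
        obtain ⟨τ, t0, t1, rfl⟩ := mem_seg.1 hz
        exact (h τ ⟨t0, t1⟩).2
    rw [this]
    refine isClosed_biInter fun τ _ => ?_
    have hc : ContinuousOn (fun t => o + τ • (γ t - o)) (Icc 0 1) := by fun_prop
    exact hc.preimage_isClosed_of_isClosed isClosed_Icc Q.closed
  have hSb : S ⊆ Icc 0 1 := fun t ht => ht.1
  have hne : S.Nonempty := ⟨0, by simp, h0⟩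
  have hSk : IsCompact S := isCompact_Icc.of_isClosed_subset hSc hSb
  set t := sSup S
  have htS : t ∈ S := hSk.sSup_mem hne
  have ht1 : t < 1 := by
    rcases htS.1.2.lt_or_eq with h | h
    · exact h
    · exact absurd (by rw [← h]; exact htS.2) h1
  refine ⟨t, htS.1.1, ht1, htS.2, ?_⟩
  by_contra hcon
  push Not at hcon
  obtain ⟨ε, hε, h⟩ := Q.vis_open htS.2 (by
    by_cases hx : γ t = o
    · exact Or.inl hx
    · right
      intro τ t0 t1 i hi
      have := hcon i (by rw [← hi]; exact seg_mem t0.le t1)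
      rw [← hi] at this
      have h2 : τ • (γ t - o) = 0 := by simpa using this
      rcases smul_eq_zero.1 h2 with h | h
      · linarith
      · exact hx (sub_eq_zero.1 h))
  have hc := Metric.continuousOn_iff.1 hγ t htS.1 ε hε
  obtain ⟨δ, hδ, hd⟩ := hc
  set s := min (t + δ / 2) 1
  have hst : t < s := by
    apply lt_min <;> linarith
  have hs1 : s ∈ Icc (0:ℝ) 1 := ⟨by linarith [htS.1.1], min_le_right _ _⟩
  have hsd : dist s t < δ := by
    rw [Real.dist_eq, abs_of_pos (by linarith)]
    have : s ≤ t + δ / 2 := min_le_left _ _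
    linarith
  have : s ∈ S := ⟨hs1, h _ (hP hs1) (hd s hs1 hsd)⟩
  exact absurd (le_csSup hSk.bddAbove this) (not_le.2 hst)

/-- Break lemma along a segment -/
lemma brk_seg {o x y : ℂ} (hxy : segment ℝ x y ⊆ Q.P) (h0 : segment ℝ o x ⊆ Q.P)
    (h1 : ¬ segment ℝ o y ⊆ Q.P) :
    ∃ z ∈ segment ℝ x y, z ≠ y ∧ segment ℝ o z ⊆ Q.P ∧ ∃ i, Q.V i ∈ segment ℝ o z ∧ Q.V i ≠ o := by
  obtain ⟨t, t0, t1, hs, i, hi⟩ := Q.brk (o := o) (γ := fun t => x + t • (y - x)) (by fun_prop)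
    (fun t ht => hxy (seg_mem ht.1 ht.2)) (by simpa using h0) (by simpa using h1)
  exact ⟨_, seg_mem t0 t1.le, fun he => h1 (by rw [← he]; exact hs), hs, i, hi⟩

end CPoly


/-- Geodesic distance in a subset of `ℂ`. -/
def geoC (P : Set ℂ) (p q : ℂ) : ℝ≥0∞ :=
  ⨅ (γ : ℝ → ℂ) (_ : ContinuousOn γ (Icc 0 1)) (_ : γ 0 = p) (_ : γ 1 = q)
    (_ : MapsTo γ (Icc 0 1) P), eVariationOn γ (Icc 0 1)

lemma geoC_le {P : Set ℂ} {γ : ℝ → ℂ} (h : ContinuousOn γ (Icc 0 1)) (hP : MapsTo γ (Icc 0 1) P) :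
    geoC P (γ 0) (γ 1) ≤ eVariationOn γ (Icc 0 1) :=
  iInf_le_of_le γ (iInf_le_of_le h (iInf_le_of_le rfl (iInf_le_of_le rfl (iInf_le _ hP))))

lemma geoC_lt {P : Set ℂ} {p q : ℂ} {r : ℝ≥0∞} (h : geoC P p q < r) :
    ∃ γ : ℝ → ℂ, ContinuousOn γ (Icc 0 1) ∧ γ 0 = p ∧ γ 1 = q ∧ MapsTo γ (Icc 0 1) P ∧
      eVariationOn γ (Icc 0 1) < r := by
  simp only [geoC, iInf_lt_iff] at h
  obtain ⟨γ, h1, h2, h3, h4, h5⟩ := h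
  exact ⟨γ, h1, h2, h3, h4, h5⟩

lemma var_seg (p q : ℂ) :
    eVariationOn (fun t : ℝ => p + t • (q - p)) (Icc 0 1) ≤ edist p q := by
  have hL : LipschitzOnWith ‖q - p‖₊ (fun t : ℝ => p + t • (q - p)) univ := by
    apply LipschitzOnWith.of_dist_le_mul
    intro x _ y _
    rw [dist_add_left, dist_eq_norm, ← sub_smul, norm_smul, Real.dist_eq, Real.norm_eq_abs,
      coe_nnnorm, mul_comm]
  have h1 := hL.comp_eVariationOn_le (g := fun t : ℝ => t) (s := Icc (0:ℝ) 1) (by simp [MapsTo])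
  have h2 : eVariationOn (fun t : ℝ => t) (Icc 0 1) ≤ ENNReal.ofReal (1 - 0) := by
    have := MonotoneOn.eVariationOn_eq (f := fun t : ℝ => t) (s := Icc (0:ℝ) 1)
      (monotone_id.monotoneOn _) (a := 0) (b := 1) (by simp) (by simp)
    simpa using this.le
  calc _ ≤ _ := h1
    _ ≤ (‖q - p‖₊ : ℝ≥0∞) * ENNReal.ofReal (1 - 0) := by gcongr
    _ = edist p q := by
      simp [edist_comm p q, edist_eq_enorm_sub]
      rfl

lemma cont_seg (p q : ℂ) : Continuous (fun t : ℝ => p + t • (q - p)) := by fun_prop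

lemma geoC_seg {P : Set ℂ} {p q : ℂ} (h : segment ℝ p q ⊆ P) : geoC P p q ≤ edist p q := by
  have := geoC_le (P := P) (γ := fun t : ℝ => p + t • (q - p)) (cont_seg p q).continuousOn
    (fun t ht => h (seg_mem ht.1 ht.2))
  simp only [zero_smul, add_zero, one_smul, add_sub_cancel] at this
  exact this.trans (var_seg p q)

lemma geoC_concat {P : Set ℂ} {γ₁ γ₂ : ℝ → ℂ} (h1 : ContinuousOn γ₁ (Icc 0 1))
    (h2 : ContinuousOn γ₂ (Icc 0 1)) (hP1 : MapsTo γ₁ (Icc 0 1) P) (hP2 : MapsTo γ₂ (Icc 0 1) P)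
    (h : γ₁ 1 = γ₂ 0) :
    geoC P (γ₁ 0) (γ₂ 1) ≤ eVariationOn γ₁ (Icc 0 1) + eVariationOn γ₂ (Icc 0 1) := by
  let γ : ℝ → ℂ := fun s => if s ≤ 1/2 then γ₁ (2*s) else γ₂ (2*s-1)
  have e1 : EqOn γ (γ₁ ∘ fun s => 2*s) (Icc 0 (1/2)) := by
    intro s hs
    simp only [γ, if_pos hs.2, Function.comp]
  have e2 : EqOn γ (γ₂ ∘ fun s => 2*s-1) (Icc (1/2) 1) := by
    intro s hs
    simp only [γ, Function.comp]
    split_ifs with h'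
    · have : s = 1/2 := le_antisymm h' hs.1
      subst this
      norm_num
      exact h
    · rfl
  have m1 : MapsTo (fun s : ℝ => 2*s) (Icc 0 (1/2)) (Icc 0 1) := by
    intro s hs; constructor <;> simp only [] <;> linarith [hs.1, hs.2]
  have m2 : MapsTo (fun s : ℝ => 2*s-1) (Icc (1/2) 1) (Icc 0 1) := by
    intro s hs; constructor <;> simp only [] <;> linarith [hs.1, hs.2]
  have hU : Icc (0:ℝ) (1/2) ∪ Icc (1/2) 1 = Icc 0 1 :=
    Icc_union_Icc_eq_Icc (by norm_num) (by norm_num)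
  have c1 : ContinuousOn γ (Icc 0 (1/2)) :=
    (h1.comp (by fun_prop) m1).congr e1
  have c2 : ContinuousOn γ (Icc (1/2) 1) :=
    (h2.comp (by fun_prop) m2).congr e2
  have c : ContinuousOn γ (Icc 0 1) := by
    rw [← hU]; exact c1.union_of_isClosed c2 isClosed_Icc isClosed_Icc
  have mP : MapsTo γ (Icc 0 1) P := by
    rw [← hU]
    rintro s (hs | hs)
    · rw [e1 hs]; exact hP1 (m1 hs)
    · rw [e2 hs]; exact hP2 (m2 hs)
  have := geoC_le c mP
  have g0 : γ 0 = γ₁ 0 := by rw [e1 ⟨le_rfl, by norm_num⟩]; simp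
  have g1 : γ 1 = γ₂ 1 := by rw [e2 ⟨by norm_num, le_rfl⟩]; norm_num
  rw [g0, g1] at this
  refine this.trans ?_
  have hsum : eVariationOn γ (Icc 0 1) =
      eVariationOn (γ₁ ∘ fun s => 2*s) (Icc 0 (1/2)) +
      eVariationOn (γ₂ ∘ fun s => 2*s-1) (Icc (1/2) 1) := by
    rw [← hU, eVariationOn.union γ (x := (1/2:ℝ)) ⟨by constructor <;> norm_num, fun y hy => hy.2⟩
      ⟨by constructor <;> norm_num, fun y hy => hy.1⟩, eVariationOn.congr e1, eVariationOn.congr e2]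
  rw [hsum]
  gcongr
  · exact eVariationOn.comp_le_of_monotoneOn _ _ (fun x _ y _ hxy => by linarith) m1
  · exact eVariationOn.comp_le_of_monotoneOn _ _ (fun x _ y _ hxy => by linarith) m2

lemma geoC_seg2 {P : Set ℂ} {p q r : ℂ} (h : segment ℝ p q ⊆ P) (h' : segment ℝ q r ⊆ P) :
    geoC P p r ≤ edist p q + edist q r := by
  have := geoC_concat (P := P) (γ₁ := fun t : ℝ => p + t • (q - p))
    (γ₂ := fun t : ℝ => q + t • (r - q)) (cont_seg p q).continuousOn
    (cont_seg q r).continuousOn (fun t ht => h (seg_mem ht.1 ht.2))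
    (fun t ht => h' (seg_mem ht.1 ht.2)) (by simp)
  simp only [zero_smul, add_zero, one_smul, add_sub_cancel] at this
  exact this.trans (add_le_add (var_seg p q) (var_seg q r))

/-- subsegments -/
lemma seg_sub_left {x y z : ℂ} (h : z ∈ segment ℝ x y) : segment ℝ x z ⊆ segment ℝ x y :=
  (convex_segment x y).segment_subset (left_mem_segment _ _ _) h

lemma seg_sub_right {x y z : ℂ} (h : z ∈ segment ℝ x y) : segment ℝ z y ⊆ segment ℝ x y :=
  (convex_segment x y).segment_subset h (right_mem_segment _ _ _)

lemma dist_seg {x y z : ℂ} (h : z ∈ segment ℝ x y) : dist x z + dist z y = dist x y :=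
  dist_add_dist_of_mem_segment h

lemma edist_seg {x y z : ℂ} (h : z ∈ segment ℝ x y) : edist x z + edist z y = edist x y := by
  rw [edist_dist, edist_dist, edist_dist, ← ENNReal.ofReal_add dist_nonneg dist_nonneg, dist_seg h]

namespace CPoly
variable (Q : CPoly)

/-- The separation hypothesis. -/
def Sep : Prop := ∀ i j, i ≠ j → 1 ≤ geoC Q.P (Q.V i) (Q.V j)

variable {Q}

lemma F3 (hs : Q.Sep) {i j : ZMod Q.n} (hij : i ≠ j) (h : geoC Q.P (Q.V i) (Q.V j) < 2) :
    segment ℝ (Q.V i) (Q.V j) ⊆ Q.P ∧ dist (Q.V i) (Q.V j) < 2 := by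
  obtain ⟨γ, hc, h0, h1, hP, hv⟩ := geoC_lt h
  have key : segment ℝ (Q.V i) (Q.V j) ⊆ Q.P := by
    by_contra hno
    obtain ⟨t, ht0, ht1, hseg, k, hk, hki⟩ := Q.brk (o := Q.V i) hc hP
      (by rw [h0, segment_same]; simpa using Q.V_mem i) (by rw [h1]; exact hno)
    have hkj : k ≠ j := by
      rintro rfl
      exact hno ((seg_sub_left hk).trans hseg)
    have hik : i ≠ k := by rintro rfl; exact hki rfl
    have a1 : 1 ≤ edist (Q.V i) (Q.V k) :=
      (hs i k hik).trans (geoC_seg ((seg_sub_left hk).trans hseg))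
    have m : MapsTo (fun s : ℝ => t + s * (1 - t)) (Icc 0 1) (Icc t 1) := by
      intro s hs
      constructor
      · have := mul_nonneg hs.1 (sub_nonneg.2 ht1.le); simp only []; linarith
      · have := mul_nonneg (sub_nonneg.2 hs.2) (sub_nonneg.2 ht1.le); simp only []; nlinarith
    have hsub : Icc t 1 ⊆ Icc (0:ℝ) 1 := Icc_subset_Icc_left ht0
    have a2 := geoC_concat (P := Q.P) (γ₁ := fun s : ℝ => Q.V k + s • (γ t - Q.V k))
      (γ₂ := γ ∘ fun s : ℝ => t + s * (1 - t)) (cont_seg _ _).continuousOn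
      ((hc.mono hsub).comp (by fun_prop) m)
      (fun s hs => hseg (seg_sub_right hk (seg_mem hs.1 hs.2)))
      (fun s hs => hP (hsub (m hs))) (by simp)
    simp only [zero_smul, add_zero, Function.comp, one_mul, add_sub_cancel, h1] at a2
    have a3 : eVariationOn (fun s : ℝ => γ (t + s * (1 - t))) (Icc 0 1) ≤ eVariationOn γ (Icc t 1) :=
      eVariationOn.comp_le_of_monotoneOn γ _ (fun x _ y _ hxy => by
        have := mul_le_mul_of_nonneg_right hxy (sub_nonneg.2 ht1.le)
        linarith) m
    have a4 := (hs k j hkj).trans (a2.trans (add_le_add (var_seg _ _) a3))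
    have a5 : edist (Q.V i) (γ t) ≤ eVariationOn γ (Icc 0 t) := by
      rw [← h0]
      exact eVariationOn.edist_le γ ⟨le_rfl, ht0⟩ ⟨ht0, le_rfl⟩
    have a6 := eVariationOn.Icc_add_Icc γ (s := univ) ht0 ht1.le (mem_univ t)
    simp only [univ_inter] at a6
    have : (2:ℝ≥0∞) ≤ eVariationOn γ (Icc 0 1) := by
      rw [← a6]
      calc (2:ℝ≥0∞) = 1 + 1 := by norm_num
        _ ≤ edist (Q.V i) (Q.V k) + (edist (Q.V k) (γ t) + eVariationOn γ (Icc t 1)) :=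
          add_le_add a1 a4
        _ = edist (Q.V i) (γ t) + eVariationOn γ (Icc t 1) := by
          rw [← add_assoc, edist_seg hk]
        _ ≤ _ := by gcongr
    exact absurd hv (not_lt.2 this)
  refine ⟨key, ?_⟩
  have : edist (Q.V i) (Q.V j) < 2 := by
    rw [← h0, ← h1]
    exact (eVariationOn.edist_le γ (s := Icc 0 1) ⟨le_rfl, by norm_num⟩
      ⟨by norm_num, le_rfl⟩).trans_lt hv
  rw [edist_dist, show (2:ℝ≥0∞) = ENNReal.ofReal 2 by simp, ENNReal.ofReal_lt_ofReal_iff (by norm_num)]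
    at this
  exact this

lemma F1 (hs : Q.Sep) {i j : ZMod Q.n} (hij : i ≠ j) (h : segment ℝ (Q.V i) (Q.V j) ⊆ Q.P) :
    1 ≤ dist (Q.V i) (Q.V j) := by
  have := (hs i j hij).trans (geoC_seg h)
  rw [edist_dist, show (1:ℝ≥0∞) = ENNReal.ofReal 1 by simp,
    ENNReal.ofReal_le_ofReal_iff dist_nonneg] at this
  exact this

lemma F2 (hs : Q.Sep) {i j : ZMod Q.n} {z : ℂ} (h1 : segment ℝ (Q.V i) z ⊆ Q.P)
    (h2 : segment ℝ z (Q.V j) ⊆ Q.P) (h : ¬ segment ℝ (Q.V i) (Q.V j) ⊆ Q.P) :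
    2 ≤ dist (Q.V i) z + dist z (Q.V j) := by
  by_contra hc
  push Not at hc
  have hij : i ≠ j := by
    rintro rfl
    apply h
    rw [segment_same]; simpa using Q.V_mem i
  refine h (F3 hs hij ?_).1
  refine (geoC_seg2 h1 h2).trans_lt ?_
  rw [edist_dist, edist_dist, ← ENNReal.ofReal_add dist_nonneg dist_nonneg,
    show (2:ℝ≥0∞) = ENNReal.ofReal 2 by simp, ENNReal.ofReal_lt_ofReal_iff (by norm_num)]
  exact hc

end CPoly


lemma dist_sq_c (z w : ℂ) : dist z w ^ 2 = (z.re - w.re) ^ 2 + (z.im - w.im) ^ 2 := by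
  rw [Complex.dist_eq, Complex.sq_norm, Complex.normSq_apply]; simp; ring

/-- Two points of a circle in the small cap cut by a line are at distance at most the chord. -/
lemma cap_chord {d g O z w : ℂ} {r α : ℝ} (hd : d.re ^ 2 + d.im ^ 2 = 1)
    (hα : dist (g + α • d) O = r) (hz : dist z O = r) (hw : dist w O = r)
    (sz : cr d (z - g) * cr d (O - g) ≤ 0) (sw : cr d (w - g) * cr d (O - g) ≤ 0) :
    dist z w ≤ 2 * |d.re * (O - g).re + d.im * (O - g).im - α| := by
  set m := d.re * (O - g).re + d.im * (O - g).im with hm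
  have e1 : ∀ q : ℂ, dist q O = r → cr d (q - g) * cr d (O - g) ≤ 0 →
      dist q (g + m • d) ≤ |m - α| := by
    intro q hq hs
    have h1 := dist_sq_c q O
    have h2 := dist_sq_c (g + α • d) O
    rw [hq] at h1
    rw [hα] at h2
    refine abs_le_of_sq_le_sq' ?_ (abs_nonneg _) |>.2
    rw [sq_abs, dist_sq_c]
    simp only [cr, Complex.sub_re, Complex.sub_im, Complex.add_re, Complex.add_im,
      Complex.smul_re, Complex.smul_im, smul_eq_mul] at *
    obtain ⟨dx, dy⟩ := d
    obtain ⟨gx, gy⟩ := g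
    obtain ⟨ox, oy⟩ := O
    obtain ⟨qx, qy⟩ := q
    simp only at *
    have hA : (gx + α * dx - ox) ^ 2 + (gy + α * dy - oy) ^ 2 =
        α ^ 2 - 2 * α * m + (gx - ox) ^ 2 + (gy - oy) ^ 2 := by
      rw [hm]; linear_combination α ^ 2 * hd
    have hB : (qx - (gx + m * dx)) ^ 2 + (qy - (gy + m * dy)) ^ 2 =
        m ^ 2 - 2 * m * (dx * (qx - gx) + dy * (qy - gy)) + (qx - gx) ^ 2 + (qy - gy) ^ 2 := by
      linear_combination m ^ 2 * hd
    have hC : (dx * (qy - gy) - dy * (qx - gx)) * (dx * (oy - gy) - dy * (ox - gx)) =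
        (qx - gx) * (ox - gx) + (qy - gy) * (oy - gy) - m * (dx * (qx - gx) + dy * (qy - gy)) := by
      rw [hm]
      linear_combination ((qx - gx) * (ox - gx) + (qy - gy) * (oy - gy)) * hd
    rw [hB]
    nlinarith
  calc dist z w ≤ dist z (g + m • d) + dist w (g + m • d) := dist_triangle_right _ _ _
    _ ≤ |m - α| + |m - α| := add_le_add (e1 z hz sz) (e1 w hw sw)
    _ = _ := by ring

lemma inside_chord {a b O y : ℂ} {r : ℝ} (ha : dist a O = r) (hb : dist b O ≤ r) (hab : a ≠ b)
    (hy : y ∈ openSegment ℝ a b) : dist y O < r := by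
  have h1 : a ∈ closedBall O r := by simpa using ha.le
  have h2 : b ∈ closedBall O r := by simpa using hb
  have hr : r ≠ 0 := by
    rintro rfl
    apply hab
    rw [dist_eq_zero.1 ha, dist_eq_zero.1 (le_antisymm hb dist_nonneg)]
  have := (strictConvex_closedBall ℝ O r).openSegment_subset h1 h2 hab hy
  rw [interior_closedBall _ hr] at this
  simpa using this

lemma param_pos {g Y e : ℂ} {α y : ℝ} {d O : ℂ} (hd : d.re ^ 2 + d.im ^ 2 = 1) {r : ℝ}
    (he : e = g + α • d) (hY : Y = g + y • d) (hr : dist e O = r) (hYr : dist Y O < r) :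
    (y - (d.re * (O - g).re + d.im * (O - g).im)) ^ 2 <
      (α - (d.re * (O - g).re + d.im * (O - g).im)) ^ 2 ∧
    dist g O ^ 2 - r ^ 2 = α * (2 * (d.re * (O - g).re + d.im * (O - g).im) - α) := by
  have h1 := dist_sq_c e O
  have h2 := dist_sq_c Y O
  have h3 := dist_sq_c g O
  have h4 : dist Y O ^ 2 < r ^ 2 := by
    have : (0:ℝ) ≤ dist Y O := dist_nonneg
    nlinarith
  rw [hr] at h1
  subst he hY
  simp only [Complex.sub_re, Complex.sub_im, Complex.add_re, Complex.add_im,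
      Complex.smul_re, Complex.smul_im, smul_eq_mul] at *
  obtain ⟨dx, dy⟩ := d
  obtain ⟨gx, gy⟩ := g
  obtain ⟨ox, oy⟩ := O
  simp only at *
  set m := dx * (ox - gx) + dy * (oy - gy) with hm
  have hA : ∀ α : ℝ, (gx + α * dx - ox) ^ 2 + (gy + α * dy - oy) ^ 2 =
      α ^ 2 - 2 * α * m + (gx - ox) ^ 2 + (gy - oy) ^ 2 := by
    intro α
    rw [hm]; linear_combination α ^ 2 * hd
  rw [hA] at h1 h2
  constructor
  · nlinarith
  · nlinarith

lemma unit_dir {g Y : ℂ} (h : Y ≠ g) : ∃ d : ℂ, d.re ^ 2 + d.im ^ 2 = 1 ∧ Y = g + dist g Y • d := by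
  have hp : 0 < ‖Y - g‖ := norm_pos_iff.2 (sub_ne_zero.2 h)
  refine ⟨(‖Y - g‖)⁻¹ • (Y - g), ?_, ?_⟩
  · have := Complex.sq_norm (Y - g)
    rw [Complex.normSq_apply] at this
    simp only [Complex.smul_re, Complex.smul_im, smul_eq_mul]
    field_simp
    linarith
  · rw [dist_comm, Complex.dist_eq, smul_smul, mul_inv_cancel₀ hp.ne', one_smul]; ring

lemma dist_unit {g d : ℂ} (hd : d.re ^ 2 + d.im ^ 2 = 1) {t : ℝ} (ht : 0 ≤ t) :
    dist g (g + t • d) = t := by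
  have := dist_sq_c g (g + t • d)
  simp only [Complex.add_re, Complex.add_im, Complex.smul_re, Complex.smul_im, smul_eq_mul] at this
  have h2 : dist g (g + t • d) ^ 2 = t ^ 2 := by rw [this]; linear_combination t ^ 2 * hd
  exact (pow_left_inj₀ dist_nonneg ht (by norm_num)).1 h2

lemma sq_aux {y m α : ℝ} (h : α < y) (h' : (y - m) ^ 2 < (α - m) ^ 2) : α < m := by
  by_contra hc
  push Not at hc
  nlinarith

lemma sgn_aux {k u v : ℝ} (hk : k ≤ 0) (h : 0 ≤ u * v) : k * u * v ≤ 0 := by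
  rw [mul_assoc]; exact mul_nonpos_of_nonpos_of_nonneg hk h

lemma sgn_aux' {k u v : ℝ} (hk : 0 ≤ k) (h : u * v ≤ 0) : k * u * v ≤ 0 := by
  rw [mul_assoc]; exact mul_nonpos_of_nonneg_of_nonpos hk h

lemma rho_aux {α β γ ρ : ℝ} (h1 : 1 ≤ α) (h2 : 2 ≤ β) (h0 : 0 < γ) (h3 : γ < 2)
    (h : α * β = γ * ρ) : 1 < ρ := by
  by_contra hc
  push Not at hc
  have : 1 * 2 ≤ α * β := mul_le_mul h1 h2 (by norm_num) (by linarith)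
  have : γ * ρ ≤ γ * 1 := mul_le_mul_of_nonneg_left hc h0.le
  linarith

set_option maxHeartbeats 1000000 in
lemma metricK {a b c g e O : ℂ} {r ξ η τ χ : ℝ}
    (ha : dist a O = r) (hb : dist b O = r) (hc : dist c O = r) (he : dist e O = r) (hab : a ≠ b)
    (hξ : 0 < ξ) (hξη : ξ ≤ η) (hη : η < 1) (hX : a + ξ • (b - a) = g + χ • (c - g))
    (hχ0 : 0 < χ) (hχ1 : χ < 1) (hE : e = g + τ • (a + η • (b - a) - g)) (hτ0 : 0 ≤ τ) (hτ1 : τ < 1)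
    (h1 : 1 ≤ dist g e) (h2 : 2 ≤ dist g e + dist e b) (hgc : dist g c < 2)
    (hac : 1 ≤ dist a c) (hbc : 1 ≤ dist b c) : False := by
  set X := a + ξ • (b - a) with hXd
  set Y := a + η • (b - a) with hYd
  have hXr : dist X O < r := inside_chord ha hb.le hab
    (by rw [openSegment_eq_image']; exact ⟨ξ, ⟨hξ, by linarith⟩, rfl⟩)
  have hYr : dist Y O < r := inside_chord ha hb.le hab
    (by rw [openSegment_eq_image']; exact ⟨η, ⟨by linarith, by linarith⟩, rfl⟩)
  have hYg : Y ≠ g := by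
    intro h
    rw [h] at hE
    simp at hE
    rw [hE] at h1
    norm_num at h1
  have hcg : c ≠ g := by
    intro h
    rw [h] at hX
    simp at hX
    rw [hX, ← h, hc] at hXr
    exact lt_irrefl _ hXr
  obtain ⟨d, hd, hdY⟩ := unit_dir hYg
  obtain ⟨d2, hd2, hdc⟩ := unit_dir hcg
  set y := dist g Y with hy
  set γ := dist g c with hγ
  have hy0 : 0 < y := dist_pos.2 hYg.symm
  have hγ0 : 0 < γ := dist_pos.2 hcg.symm
  have heα : e = g + (τ * y) • d := by
    rw [hE]; nth_rw 1 [hdY]; simp only [Complex.real_smul]; push_cast; ring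
  have hXx : X = g + (χ * γ) • d2 := by
    rw [hX]; nth_rw 1 [hdc]; simp only [Complex.real_smul]; push_cast; ring
  have hα : dist g e = τ * y := by
    rw [heα]; exact dist_unit hd (by positivity)
  set α := τ * y with hαd
  have hαy : α < y := by rw [hαd]; exact mul_lt_of_lt_one_left hy0 hτ1
  obtain ⟨p1, p2⟩ := param_pos hd heα hdY he hYr
  obtain ⟨p3, p4⟩ := param_pos hd2 hdc hXx hc hXr
  have hcirc1 : dist (g + α • d) O = r := by rw [← heα]; exact he
  have hcirc2 : dist (g + γ • d2) O = r := by rw [← hdc]; exact hc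
  have C1 := fun z w hz hw => @cap_chord d g O z w r α hd hcirc1 hz hw
  have C2 := fun z w hz hw => @cap_chord d2 g O z w r γ hd2 hcirc2 hz hw
  set m := d.re * (O - g).re + d.im * (O - g).im with hm
  set m2 := d2.re * (O - g).re + d2.im * (O - g).im with hm2
  have hmα : α < m := sq_aux hαy p1
  have hm2γ : m2 < γ := by
    have h5 : χ * γ < γ := mul_lt_of_lt_one_left hγ0 hχ1
    have := sq_aux (y := -(χ * γ)) (m := -m2) (α := -γ) (by linarith) (by
      have e1 : (-(χ * γ) - -m2) ^ 2 = (χ * γ - m2) ^ 2 := by ring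
      have e2 : (-γ - -m2) ^ 2 = (γ - m2) ^ 2 := by ring
      rw [e1, e2]; exact p3)
    linarith
  rw [abs_of_pos (by linarith)] at C1
  rw [abs_of_neg (by linarith)] at C2
  -- sides of line gY
  have sY : cr d (a - g) = - η * cr d (b - a) := by
    have : cr d (Y - g) = 0 := by rw [hdY]; simp [cr]; ring
    have h' : cr d (Y - g) = cr d (a - g) + η * cr d (b - a) := by
      rw [hYd]; simp [cr]; ring
    linarith
  have sB : cr d (b - g) = (1 - η) * cr d (b - a) := by
    have : cr d (b - g) = cr d (a - g) + cr d (b - a) := by simp [cr]; ring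
    rw [this, sY]; ring
  have sC : χ * cr d (c - g) = (ξ - η) * cr d (b - a) := by
    have : cr d (X - g) = χ * cr d (c - g) := by rw [hX]; simp [cr]; ring
    rw [← this, hXd]
    have : cr d (a + ξ • (b - a) - g) = cr d (a - g) + ξ * cr d (b - a) := by simp [cr]; ring
    rw [this, sY]; ring
  have sE : cr d (e - g) = 0 := by rw [heα]; simp [cr]; ring
  have hβ : 2 ≤ 2 * m - α := by
    rcases le_total (cr d (b - a) * cr d (O - g)) 0 with hs | hs
    · have := C1 e b he hb (by rw [sE]; simp) (by rw [sB]; exact sgn_aux' (by linarith) hs)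
      linarith
    · have := C1 a c ha hc (by rw [sY]; exact sgn_aux (by linarith) hs) (by
        have : χ * (cr d (c - g) * cr d (O - g)) ≤ 0 := by
          rw [← mul_assoc, sC]; exact sgn_aux (by linarith) hs
        exact nonpos_of_mul_nonpos_right this hχ0)
      linarith
  have hα1 : 1 ≤ α := by linarith
  have hρ1 : 1 < 2 * m2 - γ := rho_aux hα1 hβ hγ0 hgc (p2.symm.trans p4)
  -- sides of line gc
  have tX : cr d2 (a - g) = - ξ * cr d2 (b - a) := by
    have : cr d2 (X - g) = 0 := by rw [hXx]; simp [cr]; ring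
    have h' : cr d2 (X - g) = cr d2 (a - g) + ξ * cr d2 (b - a) := by
      rw [hXd]; simp [cr]; ring
    linarith
  have tB : cr d2 (b - g) = (1 - ξ) * cr d2 (b - a) := by
    have : cr d2 (b - g) = cr d2 (a - g) + cr d2 (b - a) := by simp [cr]; ring
    rw [this, tX]; ring
  have tC : cr d2 (c - g) = 0 := by rw [hdc]; simp [cr]; ring
  rcases le_total (cr d2 (b - a) * cr d2 (O - g)) 0 with hs | hs
  · have := C2 b c hb hc (by rw [tB]; exact sgn_aux' (by linarith) hs) (by rw [tC]; simp)
    linarith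
  · have := C2 a c ha hc (by rw [tX]; exact sgn_aux (by linarith) hs) (by rw [tC]; simp)
    linarith

lemma openSeg_iff {x y z : ℂ} :
    z ∈ openSegment ℝ x y ↔ ∃ t : ℝ, 0 < t ∧ t < 1 ∧ z = x + t • (y - x) := by
  rw [openSegment_eq_image']
  constructor
  · rintro ⟨t, ⟨h0, h1⟩, rfl⟩; exact ⟨t, h0, h1, rfl⟩
  · rintro ⟨t, h0, h1, rfl⟩; exact ⟨t, ⟨h0, h1⟩, rfl⟩

/-- a point of `[X,b)` with `X ∈ (a,b)` is in `(a,b)` -/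
lemma open_of_tail {a b X Y : ℂ} {ξ : ℝ} (h0 : 0 < ξ) (h1 : ξ < 1) (hX : X = a + ξ • (b - a))
    (hY : Y ∈ segment ℝ X b) (hYb : Y ≠ b) :
    ∃ η, ξ ≤ η ∧ η < 1 ∧ Y = a + η • (b - a) := by
  obtain ⟨t, t0, t1, rfl⟩ := mem_seg.1 hY
  refine ⟨ξ + t * (1 - ξ), ?_, ?_, ?_⟩
  · have := mul_nonneg t0 (sub_nonneg.2 h1.le); linarith
  · have : t < 1 := by
      refine lt_of_le_of_ne t1 ?_
      rintro rfl
      apply hYb; simp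
    nlinarith
  · rw [hX]; simp only [Complex.real_smul]; push_cast; ring

namespace CPoly
variable {Q : CPoly}

lemma lemK (hs : Q.Sep) {ia ib ic ig : ZMod Q.n} {O X : ℂ} {r : ℝ}
    (ha : dist (Q.V ia) O = r) (hb : dist (Q.V ib) O = r) (hc : dist (Q.V ic) O = r)
    (hab : ia ≠ ib) (hac : 1 ≤ dist (Q.V ia) (Q.V ic)) (hbc : 1 ≤ dist (Q.V ib) (Q.V ic))
    (habP : segment ℝ (Q.V ia) (Q.V ib) ⊆ Q.P) (hgcP : segment ℝ (Q.V ig) (Q.V ic) ⊆ Q.P)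
    (hgc : dist (Q.V ig) (Q.V ic) < 2)
    (hX : X ∈ openSegment ℝ (Q.V ia) (Q.V ib)) (hX' : X ∈ openSegment ℝ (Q.V ig) (Q.V ic))
    (hno : ∀ k, dist (Q.V k) O < r → ∀ y ∈ openSegment ℝ (Q.V ia) (Q.V ib),
      ¬ segment ℝ y (Q.V k) ⊆ Q.P) :
    segment ℝ (Q.V ig) (Q.V ib) ⊆ Q.P := by
  by_contra hcon
  have hne : Q.V ia ≠ Q.V ib := fun h => hab (Q.inj h)
  obtain ⟨ξ, ξ0, ξ1, hXξ⟩ := openSeg_iff.1 hX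
  obtain ⟨χ, χ0, χ1, hXχ⟩ := openSeg_iff.1 hX'
  have hXab := openSegment_subset_segment ℝ _ _ hX
  have hXgc := openSegment_subset_segment ℝ _ _ hX'
  obtain ⟨Y, hY, hYb, hgY, i, hi, hig⟩ := Q.brk_seg (o := Q.V ig) ((seg_sub_right hXab).trans habP)
    ((seg_sub_left hXgc).trans hgcP) hcon
  obtain ⟨η, η0, η1, hYη⟩ := open_of_tail ξ0 ξ1 hXξ hY hYb
  have hYo : Y ∈ openSegment ℝ (Q.V ia) (Q.V ib) :=
    openSeg_iff.2 ⟨η, by linarith, η1, hYη⟩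
  have hYr := inside_chord ha hb.le hne hYo
  have hir : r ≤ dist (Q.V i) O := by
    by_contra hlt
    push Not at hlt
    apply hno i hlt Y hYo
    rw [segment_symm]
    exact (seg_sub_right hi).trans hgY
  obtain ⟨e, he, her⟩ : ∃ e ∈ segment ℝ (Q.V i) Y, dist e O = r := by
    have hcont : ContinuousOn (fun t : ℝ => dist (Q.V i + t • (Y - Q.V i)) O) (Icc 0 1) := by
      fun_prop
    have := intermediate_value_Icc' (zero_le_one' ℝ) hcont
    obtain ⟨t, ht, h⟩ := this (show r ∈ _ from ⟨by simpa using hYr.le, by simpa using hir⟩)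
    exact ⟨_, seg_mem ht.1 ht.2, h⟩
  have heg : e ∈ segment ℝ (Q.V ig) Y := seg_sub_right hi he
  have heY : e ≠ Y := by rintro rfl; linarith
  have h_eb : segment ℝ e (Q.V ib) ⊆ Q.P := by
    by_contra hcon2
    have hYab : Y ∈ segment ℝ (Q.V ia) (Q.V ib) := openSegment_subset_segment ℝ _ _ hYo
    obtain ⟨Z, hZ, hZb, heZ, k, hk, hke⟩ := Q.brk_seg (o := e) ((seg_sub_right hYab).trans habP)
      ((seg_sub_right heg).trans hgY) hcon2
    obtain ⟨ζ, ζ0, ζ1, hZζ⟩ := open_of_tail (by linarith : 0 < η) η1 hYη hZ hZb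
    have hZo : Z ∈ openSegment ℝ (Q.V ia) (Q.V ib) :=
      openSeg_iff.2 ⟨ζ, by linarith, ζ1, hZζ⟩
    have hZr := inside_chord ha hb.le hne hZo
    refine hno k ?_ Z hZo (by rw [segment_symm]; exact (seg_sub_right hk).trans heZ)
    have hkZ : Q.V k = Z ∨ Q.V k ∈ openSegment ℝ e Z := by
      obtain ⟨t, t0, t1, ht⟩ := mem_seg.1 hk
      rcases t1.lt_or_eq with h | h
      · rcases t0.lt_or_eq with h' | h'
        · exact Or.inr (openSeg_iff.2 ⟨t, h', h, ht⟩)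
        · exfalso; apply hke; rw [ht, ← h']; simp
      · left; rw [ht, h]; simp
    rcases hkZ with h | h
    · rw [h]; exact hZr
    · refine inside_chord her hZr.le ?_ h
      rintro rfl; linarith
  have h2 := F2 hs ((seg_sub_left heg).trans hgY) h_eb hcon
  have hgi : ig ≠ i := by rintro rfl; exact hig rfl
  have h1 : 1 ≤ dist (Q.V ig) (Q.V i) := F1 hs hgi ((seg_sub_left hi).trans hgY)
  have h1' : 1 ≤ dist (Q.V ig) e := by
    have : Q.V i ∈ segment ℝ (Q.V ig) e := by
      obtain ⟨t, t0, t1, ht⟩ := mem_seg.1 hi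
      obtain ⟨s, s0, s1, hs⟩ := mem_seg.1 he
      have key : t ≤ t + s * (1 - t) := by nlinarith
      have he' : e = Q.V ig + (t + s * (1 - t)) • (Y - Q.V ig) := by
        rw [hs, ht]; simp only [Complex.real_smul]; push_cast; ring
      rcases (t0.trans key).lt_or_eq with h | h
      · refine mem_seg.2 ⟨t / (t + s * (1 - t)), by positivity, by rw [div_le_one h]; exact key, ?_⟩
        rw [he', add_sub_cancel_left, smul_smul, div_mul_cancel₀ _ h.ne']; exact ht
      · have : t = 0 := by linarith
        exfalso; apply hig; rw [ht, this]; simp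
    have := dist_seg this
    have h0 : 0 ≤ dist (Q.V i) e := dist_nonneg
    linarith
  obtain ⟨τ, τ0, τ1, hτ⟩ := mem_seg.1 heg
  have τ1' : τ < 1 := by
    refine lt_of_le_of_ne τ1 ?_
    rintro rfl
    apply heY; rw [hτ]; simp
  exact metricK ha hb hc her hne ξ0 η0 η1 (hXξ.symm.trans hXχ) χ0 χ1 (by rw [← hYη]; exact hτ)
    τ0 τ1' h1' h2 hgc hac hbc

end CPoly


/-- Closed triangle `abc` (counterclockwise), as an intersection of half planes. -/
def Tri (a b c : ℂ) : Set ℂ :=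
  {z | 0 ≤ cr (b - a) (z - a) ∧ 0 ≤ cr (c - b) (z - b) ∧ 0 ≤ cr (a - c) (z - c)}

lemma tri_cyc {a b c z : ℂ} (h : z ∈ Tri a b c) : z ∈ Tri b c a := ⟨h.2.1, h.2.2, h.1⟩

lemma tri_sum (a b c z : ℂ) :
    cr (b - a) (z - a) + cr (c - b) (z - b) + cr (a - c) (z - c) = cr (b - a) (c - a) := by
  simp [cr]; ring

lemma tri_bary (a b c z : ℂ) : cr (b - a) (c - a) • z =
    cr (c - b) (z - b) • a + cr (a - c) (z - c) • b + cr (b - a) (z - a) • c := by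
  apply Complex.ext <;> simp [cr] <;> ring

lemma tri_convex {a b c x y : ℂ} (hx : x ∈ Tri a b c) (hy : y ∈ Tri a b c) :
    segment ℝ x y ⊆ Tri a b c := by
  intro z hz
  obtain ⟨t, t0, t1, rfl⟩ := mem_seg.1 hz
  have t1' : 0 ≤ 1 - t := by linarith
  refine ⟨?_, ?_, ?_⟩
  · rw [cr_affine]; exact add_nonneg (mul_nonneg t1' hx.1) (mul_nonneg t0 hy.1)
  · rw [cr_affine]; exact add_nonneg (mul_nonneg t1' hx.2.1) (mul_nonneg t0 hy.2.1)
  · rw [cr_affine]; exact add_nonneg (mul_nonneg t1' hx.2.2) (mul_nonneg t0 hy.2.2)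

lemma tri_a {a b c : ℂ} (h : 0 < cr (b - a) (c - a)) : a ∈ Tri a b c := by
  refine ⟨by simp [cr], ?_, by simp [cr]; linarith⟩
  have : cr (c - b) (a - b) = cr (b - a) (c - a) := by simp [cr]; ring
  rw [this]; exact h.le

lemma cr_cyc (a b c : ℂ) : cr (c - b) (a - b) = cr (b - a) (c - a) := by simp [cr]; ring

lemma tri_b {a b c : ℂ} (h : 0 < cr (b - a) (c - a)) : b ∈ Tri a b c := by
  have := tri_a (a := b) (b := c) (c := a) (by rw [cr_cyc]; exact h)
  exact tri_cyc (tri_cyc this)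

lemma tri_c {a b c : ℂ} (h : 0 < cr (b - a) (c - a)) : c ∈ Tri a b c := by
  have := tri_b (a := b) (b := c) (c := a) (by rw [cr_cyc]; exact h)
  exact tri_cyc (tri_cyc this)

lemma tri_eq_div {a b c : ℂ} (h : 0 < cr (b - a) (c - a)) (z : ℂ) :
    z = (cr (c - b) (z - b) / cr (b - a) (c - a)) • a +
      (cr (a - c) (z - c) / cr (b - a) (c - a)) • b +
      (cr (b - a) (z - a) / cr (b - a) (c - a)) • c := by
  have := congrArg (fun x => (cr (b - a) (c - a))⁻¹ • x) (tri_bary a b c z)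
  simp only [smul_add, smul_smul] at this
  rw [inv_mul_cancel₀ h.ne', one_smul] at this
  simp only [div_eq_inv_mul]
  exact this

/-- Points with `l₁ = 0`, `l₂, l₃ > 0` lie in the open side. -/
lemma tri_open {a b c z : ℂ} (h : 0 < cr (b - a) (c - a)) (h1 : cr (b - a) (z - a) = 0)
    (h2 : 0 < cr (c - b) (z - b)) (h3 : 0 < cr (a - c) (z - c)) : z ∈ openSegment ℝ a b := by
  have hs := tri_sum a b c z
  have e := tri_eq_div h z
  rw [h1] at e hs
  simp only [zero_div, zero_smul, add_zero] at e
  refine ⟨_, _, div_pos h2 h, div_pos h3 h, ?_, e.symm⟩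
  rw [← add_div, div_eq_one_iff_eq h.ne']; linarith

lemma tri_vert {a b c z : ℂ} (h : 0 < cr (b - a) (c - a)) (h1 : cr (b - a) (z - a) = 0)
    (h2 : cr (c - b) (z - b) = 0) : z = b := by
  have hs := tri_sum a b c z
  have e := tri_eq_div h z
  rw [h1, h2] at e
  have : cr (a - c) (z - c) = cr (b - a) (c - a) := by linarith
  rw [this, div_self h.ne'] at e
  simpa using e

lemma tri_side {a b c z : ℂ} (h : 0 < cr (b - a) (c - a)) (hz : z ∈ segment ℝ a b) :
    z ∈ Tri a b c := tri_convex (tri_a h) (tri_b h) hz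

lemma cr_seg_zero {a b z : ℂ} (hz : z ∈ segment ℝ a b) : cr (b - a) (z - a) = 0 := by
  obtain ⟨t, _, _, rfl⟩ := mem_seg.1 hz
  simp [cr]; ring

lemma open_sides {a b c z : ℂ} (h : 0 < cr (b - a) (c - a)) (hz : z ∈ openSegment ℝ a b) :
    0 < cr (c - b) (z - b) ∧ 0 < cr (a - c) (z - c) := by
  obtain ⟨t, t0, t1, rfl⟩ := openSeg_iff.1 hz
  have e1 : cr (c - b) (a + t • (b - a) - b) = (1 - t) * cr (b - a) (c - a) := by
    simp [cr]; ring
  have e2 : cr (a - c) (a + t • (b - a) - c) = t * cr (b - a) (c - a) := by simp [cr]; ring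
  rw [e1, e2]
  exact ⟨mul_pos (by linarith) h, mul_pos t0 h⟩

lemma seg_cases {a b z : ℂ} (hz : z ∈ segment ℝ a b) : z = a ∨ z = b ∨ z ∈ openSegment ℝ a b := by
  obtain ⟨t, t0, t1, ht⟩ := mem_seg.1 hz
  rcases t0.lt_or_eq with h | h
  · rcases t1.lt_or_eq with h' | h'
    · exact Or.inr (Or.inr (openSeg_iff.2 ⟨t, h, h', ht⟩))
    · right; left; rw [ht, h']; simp
  · left; rw [ht, ← h]; simp

lemma col_near {a b m : ℂ} (hab : a ≠ b) (hm : m ∈ openSegment ℝ a b) :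
    ∃ ε > 0, ∀ z, dist z m < ε → cr (b - a) (z - a) = 0 → z ∈ openSegment ℝ a b := by
  obtain ⟨s, s0, s1, hs⟩ := openSeg_iff.1 hm
  have hp : 0 < ‖b - a‖ := norm_pos_iff.2 (sub_ne_zero.2 hab.symm)
  have hmin : 0 < min s (1 - s) := lt_min s0 (by linarith)
  refine ⟨min s (1 - s) * ‖b - a‖, by positivity, fun z hz h0 => ?_⟩
  obtain ⟨t, ht⟩ := cr_eq_zero (sub_ne_zero.2 hab.symm) h0
  have hz' : z = a + t • (b - a) := by rw [← ht]; ring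
  have : dist z m = |t - s| * ‖b - a‖ := by
    rw [hz', hs, dist_add_left, dist_eq_norm, ← sub_smul, norm_smul, Real.norm_eq_abs]
  rw [this] at hz
  have h2 := lt_of_mul_lt_mul_right hz hp.le
  have h3 := lt_of_lt_of_le h2 (min_le_left _ _)
  have h4 := lt_of_lt_of_le h2 (min_le_right _ _)
  rw [abs_lt] at h3 h4
  exact openSeg_iff.2 ⟨t, by linarith, by linarith, hz'⟩

/-- positivity of `cr` is open -/
lemma cr_pos_near {u o x : ℂ} (h : 0 < cr u (x - o)) :
    ∃ ε > 0, ∀ z, dist z x < ε → 0 < cr u (z - o) := by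
  have hc : Continuous fun z : ℂ => cr u (z - o) := by unfold cr; fun_prop
  have := hc.continuousAt.eventually_mem (Ioi_mem_nhds h)
  rw [Metric.eventually_nhds_iff] at this
  obtain ⟨ε, hε, h⟩ := this
  exact ⟨ε, hε, fun z hz => h hz⟩

lemma closed_near {S : Set ℂ} (hS : IsClosed S) {x : ℂ} (hx : x ∉ S) :
    ∃ ε > 0, ∀ z, dist z x < ε → z ∉ S := by
  have := hS.isOpen_compl.mem_nhds hx
  rw [Metric.mem_nhds_iff] at this
  obtain ⟨ε, hε, h⟩ := this
  exact ⟨ε, hε, fun z hz => h hz⟩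

lemma closed_seg (a b : ℂ) : IsClosed (segment ℝ a b) := by
  rw [segment_eq_image']
  exact (isCompact_Icc.image (by fun_prop)).isClosed

lemma tri_closed (a b c : ℂ) : IsClosed (Tri a b c) := by
  have hc : ∀ u o : ℂ, Continuous fun z : ℂ => cr u (z - o) := by intro u o; unfold cr; fun_prop
  exact (isClosed_le continuous_const (hc _ _)).inter
    ((isClosed_le continuous_const (hc _ _)).inter (isClosed_le continuous_const (hc _ _)))

/-- Preconnectedness with local hypotheses relative to `P`. -/
lemma conn_loc {P S W : Set ℂ} (hS : IsPreconnected S) (hSP : S ⊆ P)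
    (h1 : ∀ x ∈ S, x ∈ W → ∃ ε > 0, ∀ z ∈ P, dist z x < ε → z ∈ W)
    (h2 : ∀ x ∈ S, x ∉ W → ∃ ε > 0, ∀ z ∈ P, dist z x < ε → z ∉ W)
    {x : ℂ} (hx : x ∈ S) (hxW : x ∈ W) : S ⊆ W := by
  by_contra hcon
  rw [Set.not_subset] at hcon
  obtain ⟨y, hy, hyW⟩ := hcon
  let u : Set ℂ := {z | ∃ x, ∃ ε > 0, dist z x < ε ∧ ∀ z ∈ P, dist z x < ε → z ∈ W}
  let v : Set ℂ := {z | ∃ x, ∃ ε > 0, dist z x < ε ∧ ∀ z ∈ P, dist z x < ε → z ∉ W}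
  have hopen : ∀ W : Set ℂ,
      IsOpen {z | ∃ x, ∃ ε > 0, dist z x < ε ∧ ∀ z ∈ P, dist z x < ε → z ∈ W} := by
    intro W
    rw [Metric.isOpen_iff]
    rintro z ⟨x, ε, hε, hz, h⟩
    refine ⟨ε - dist z x, by linarith, fun w hw => ⟨x, ε, hε, ?_, h⟩⟩
    rw [mem_ball] at hw
    have := dist_triangle w z x
    linarith
  have hu : ∀ x ∈ S, x ∈ W → x ∈ u := by
    intro x hx hW
    obtain ⟨ε, hε, h⟩ := h1 x hx hW
    exact ⟨x, ε, hε, by simpa using hε, h⟩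
  have hv : ∀ x ∈ S, x ∉ W → x ∈ v := by
    intro x hx hW
    obtain ⟨ε, hε, h⟩ := h2 x hx hW
    exact ⟨x, ε, hε, by simpa using hε, h⟩
  obtain ⟨z, hzS, hzu, hzv⟩ := hS u v (hopen W) (hopen Wᶜ)
    (fun z hz => by
      by_cases hW : z ∈ W
      · exact Or.inl (hu z hz hW)
      · exact Or.inr (hv z hz hW)) ⟨x, hx, hu x hx hxW⟩ ⟨y, hy, hv y hy hyW⟩
  obtain ⟨x1, ε1, _, hd1, h1⟩ := hzu
  obtain ⟨x2, ε2, _, hd2, h2⟩ := hzv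
  exact h2 z (hSP hzS) hd2 (h1 z (hSP hzS) hd1)

lemma seg_preconn (x y : ℂ) : IsPreconnected (segment ℝ x y) := (convex_segment x y).isPreconnected

namespace CPoly
variable {Q : CPoly}

lemma tri_sub {a b c : ℂ} (h : 0 < cr (b - a) (c - a)) (hab : segment ℝ a b ⊆ Q.P)
    (hbc : segment ℝ b c ⊆ Q.P) (hac : segment ℝ a c ⊆ Q.P) : Tri a b c ⊆ Q.P := by
  intro z hz
  have hs := tri_sum a b c z
  have e := tri_eq_div h z
  have := Q.filling h.ne' hab hac hbc (β := cr (a - c) (z - c) / cr (b - a) (c - a))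
    (γ := cr (b - a) (z - a) / cr (b - a) (c - a)) (div_nonneg hz.2.2 h.le)
    (div_nonneg hz.1 h.le) (by
      rw [← add_div, div_le_one h]; linarith [hz.2.1])
  convert this using 1
  have e1 : cr (c - b) (z - b) / cr (b - a) (c - a) =
      1 - cr (a - c) (z - c) / cr (b - a) (c - a) - cr (b - a) (z - a) / cr (b - a) (c - a) := by
    field_simp; linarith
  rw [e1] at e
  nth_rw 1 [e]
  simp only [Complex.real_smul]
  push_cast
  ring

end CPoly


namespace CPoly
variable {Q : CPoly}

/-- A pocket `A` of the polygon behind the directed chord `ab`. -/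
structure Cut (Q : CPoly) (A : Set ℂ) (a b : ℂ) : Prop where
  hab : a ≠ b
  seg : segment ℝ a b ⊆ Q.P
  sub : A ⊆ Q.P
  dis : ∀ z ∈ A, z ∉ segment ℝ a b
  opn : ∀ x ∈ A, ∃ ε > 0, ∀ z ∈ Q.P, dist z x < ε → z ∈ A
  cls : ∀ x ∈ Q.P, x ∉ segment ℝ a b → x ∉ A → ∃ ε > 0, ∀ z ∈ Q.P, dist z x < ε → z ∉ A
  side : ∀ m ∈ openSegment ℝ a b, ∃ ε > 0, ∀ z ∈ Q.P, dist z m < ε →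
    (0 < cr (b - a) (z - a) → z ∈ A) ∧ (cr (b - a) (z - a) < 0 → z ∉ A)

/-- no vertex in the open disc is visible from the open chord -/
def Clear (Q : CPoly) (a b O : ℂ) (r : ℝ) : Prop :=
  dist a O = r ∧ dist b O = r ∧
    ∀ k, dist (Q.V k) O < r → ∀ y ∈ openSegment ℝ a b, ¬ segment ℝ y (Q.V k) ⊆ Q.P

lemma Cut.cross {A : Set ℂ} {a b x y : ℂ} (h : Cut Q A a b) (hxy : segment ℝ x y ⊆ Q.P)
    (hd : ∀ z ∈ segment ℝ x y, z ∉ segment ℝ a b) (hx : x ∈ A) : y ∈ A :=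
  conn_loc (seg_preconn x y) hxy (fun z _ hzA => h.opn z hzA)
    (fun z hz hzA => h.cls z (hxy hz) (hd z hz) hzA) (left_mem_segment _ _ _) hx
    (right_mem_segment _ _ _)

/-- points seen from the open chord on the positive side are in the pocket -/
lemma Cut.vis_mem {A : Set ℂ} {a b y w : ℂ} (h : Cut Q A a b) (hy : y ∈ openSegment ℝ a b)
    (hw : 0 < cr (b - a) (w - a)) (hyw : segment ℝ y w ⊆ Q.P) : w ∈ A := by
  obtain ⟨ε, hε, hs⟩ := h.side y hy
  have hy0 := cr_seg_zero (openSegment_subset_segment ℝ _ _ hy)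
  obtain ⟨τ, τ0, τ1, hτ⟩ : ∃ τ : ℝ, 0 < τ ∧ τ ≤ 1 ∧ dist (y + τ • (w - y)) y < ε := by
    have hp : 0 ≤ ‖w - y‖ := norm_nonneg _
    refine ⟨min 1 (ε / (2 * (‖w - y‖ + 1))), by positivity, min_le_left _ _, ?_⟩
    rw [dist_eq_norm, add_sub_cancel_left, norm_smul, Real.norm_eq_abs, abs_of_pos (by positivity)]
    have h1 : min 1 (ε / (2 * (‖w - y‖ + 1))) ≤ ε / (2 * (‖w - y‖ + 1)) := min_le_right _ _
    calc _ ≤ ε / (2 * (‖w - y‖ + 1)) * ‖w - y‖ := by gcongr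
      _ < ε := by
        rw [div_mul_eq_mul_div, div_lt_iff₀ (by positivity)]; nlinarith
  have pos : ∀ σ : ℝ, 0 < σ → 0 < cr (b - a) (y + σ • (w - y) - a) := by
    intro σ hσ
    rw [cr_affine, hy0]; simpa using mul_pos hσ hw
  have hmem : y + τ • (w - y) ∈ segment ℝ y w := seg_mem τ0.le τ1
  have hA := (hs _ (hyw hmem) hτ).1 (pos τ τ0)
  refine h.cross ((seg_sub_right hmem).trans hyw) (fun z hz hz' => ?_) hA
  have hz0 := cr_seg_zero hz'
  obtain ⟨t, t0, t1, rfl⟩ := mem_seg.1 hz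
  rw [cr_affine] at hz0
  have := pos τ τ0
  rcases t0.lt_or_eq with h | h
  · have : 0 ≤ (1 - t) * cr (b - a) (y + τ • (w - y) - a) := mul_nonneg (by linarith) this.le
    have := mul_pos h hw
    linarith
  · rw [← h] at hz0; simp at hz0; simp at this; linarith

lemma Cut.accum {A : Set ℂ} {ia ib : ZMod Q.n} (h : Cut Q A (Q.V ia) (Q.V ib)) (hA : A.Nonempty) :
    ∃ m ∈ openSegment ℝ (Q.V ia) (Q.V ib), ∀ ε > 0, ∃ z ∈ A, dist z m < ε := by
  by_contra hcon
  push Not at hcon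
  obtain ⟨x, hx⟩ := hA
  have hmid : midpoint ℝ (Q.V ia) (Q.V ib) ∈ openSegment ℝ (Q.V ia) (Q.V ib) :=
    midpoint_mem_openSegment _ _
  have := Q.clopen_punct (F := {Q.V ia, Q.V ib}) (W := A) (by simp)
    (by
      rintro z (rfl | rfl)
      · exact Q.V_mem_fr _
      · exact Q.V_mem_fr _)
    (fun z hz hzF hzA => by
      by_cases hs : z ∈ segment ℝ (Q.V ia) (Q.V ib)
      · rcases seg_cases hs with e | e | e
        · exact absurd (Or.inl e) hzF
        · exact absurd (Or.inr e) hzF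
        · obtain ⟨ε, hε, h⟩ := hcon z e
          exact ⟨ε, hε, fun w _ hd hwA => absurd hd (not_lt.2 (h w hwA))⟩
      · exact h.cls z hz hs hzA)
    (fun z _ _ hzA => h.opn z hzA) (h.sub hx)
    (by
      rintro (rfl | rfl)
      · exact h.dis _ hx (left_mem_segment _ _ _)
      · exact h.dis _ hx (right_mem_segment _ _ _)) hx
  have hms := openSegment_subset_segment ℝ _ _ hmid
  refine h.dis _ (this ⟨h.seg hms, ?_⟩) hms
  rintro (e | e)
  · exact h.hab (by simpa [midpoint_eq_left_iff] using e)
  · have e : midpoint ℝ (Q.V ia) (Q.V ib) = Q.V ib := e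
    exact h.hab (by simpa [midpoint_eq_right_iff] using e)

lemma Cut.cand {A : Set ℂ} {ia ib : ZMod Q.n} (h : Cut Q A (Q.V ia) (Q.V ib)) (hA : A.Nonempty) :
    ∃ k, 0 < cr (Q.V ib - Q.V ia) (Q.V k - Q.V ia) ∧
      ∃ y ∈ openSegment ℝ (Q.V ia) (Q.V ib), segment ℝ y (Q.V k) ⊆ Q.P := by
  obtain ⟨m, hm, hacc⟩ := h.accum hA
  set a := Q.V ia
  set b := Q.V ib
  have hms := openSegment_subset_segment ℝ _ _ hm
  have hmP : m ∈ Q.P := h.seg hms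
  have hm0 := cr_seg_zero hms
  obtain ⟨ε1, hε1, h1⟩ := h.side m hm
  obtain ⟨ε2, hε2, h2⟩ := col_near h.hab hm
  obtain ⟨ε3, hε3, h3⟩ := Q.conic hmP
  obtain ⟨z, hzA, hz⟩ := hacc (min ε1 (min ε2 ε3)) (by positivity)
  have hz1 := lt_of_lt_of_le hz (min_le_left _ _)
  have hz2 := lt_of_lt_of_le hz ((min_le_right _ _).trans (min_le_left _ _))
  have hz3 := lt_of_lt_of_le hz ((min_le_right _ _).trans (min_le_right _ _))
  have hzpos : 0 < cr (b - a) (z - a) := by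
    rcases lt_trichotomy 0 (cr (b - a) (z - a)) with h' | h' | h'
    · exact h'
    · exact absurd (openSegment_subset_segment ℝ _ _ (h2 z hz2 h'.symm)) (h.dis z hzA)
    · exact absurd hzA ((h1 z (h.sub hzA) hz1).2 h')
  have hzm : z ≠ m := by rintro rfl; linarith
  -- shoot the ray
  obtain ⟨T, hT1, hTP⟩ : ∃ T : ℝ, 1 ≤ T ∧ m + T • (z - m) ∉ Q.P := by
    obtain ⟨R, hR⟩ := Q.cpt.isBounded.subset_ball m
    have hp : 0 < ‖z - m‖ := norm_pos_iff.2 (sub_ne_zero.2 hzm)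
    refine ⟨max 1 (R / ‖z - m‖), le_max_left _ _, fun hc => ?_⟩
    have := hR hc
    rw [mem_ball, dist_eq_norm, add_sub_cancel_left, norm_smul, Real.norm_eq_abs,
      abs_of_pos (lt_of_lt_of_le one_pos (le_max_left _ _))] at this
    have h' : R / ‖z - m‖ * ‖z - m‖ ≤ max 1 (R / ‖z - m‖) * ‖z - m‖ := by
      gcongr; exact le_max_right _ _
    rw [div_mul_cancel₀ _ hp.ne'] at h'
    linarith
  have hray : Continuous fun t : ℝ => m + t • (z - m) := by fun_prop
  let C : Set ℝ := {t | t ∈ Icc 1 T ∧ m + t • (z - m) ∈ frontier Q.P}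
  have hCc : IsCompact C :=
    isCompact_Icc.inter_right (isClosed_frontier.preimage hray)
  have hpre : ∀ t : ℝ, 1 ≤ t → (∀ s ∈ Icc (1:ℝ) t, m + s • (z - m) ∉ frontier Q.P) →
      ∀ s ∈ Icc (1:ℝ) t, m + s • (z - m) ∈ Q.P := by
    intro t ht hno s hs
    have hconn : IsPreconnected ((fun s : ℝ => m + s • (z - m)) '' Icc 1 t) :=
      isPreconnected_Icc.image _ hray.continuousOn
    refine conn_loc (P := univ) (W := Q.P) hconn (subset_univ _) ?_ ?_
      (x := z) ⟨1, ⟨le_rfl, ht⟩, by simp⟩ (h.sub hzA) ⟨s, hs, rfl⟩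
    · rintro _ ⟨u, hu, rfl⟩ hP
      have hintr : m + u • (z - m) ∈ interior Q.P := by
        by_contra hni
        apply hno u hu
        rw [frontier_eq_closure_inter_closure, closure_compl]
        exact ⟨subset_closure hP, hni⟩
      obtain ⟨ε, hε, h⟩ := Metric.isOpen_iff.1 isOpen_interior _ hintr
      exact ⟨ε, hε, fun w _ hw => interior_subset (h hw)⟩
    · rintro _ ⟨u, hu, rfl⟩ hP
      obtain ⟨ε, hε, h⟩ := closed_near Q.closed hP
      exact ⟨ε, hε, fun w _ hw => h w hw⟩
  have hCne : C.Nonempty := by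
    by_contra hemp
    rw [not_nonempty_iff_eq_empty] at hemp
    apply hTP
    refine hpre T hT1 (fun s hs hf => ?_) T ⟨hT1, le_rfl⟩
    have : s ∈ C := ⟨hs, hf⟩
    rw [hemp] at this
    exact this
  obtain ⟨t1, ⟨ht1C, ht1min⟩⟩ := hCc.exists_isLeast hCne
  set f := m + t1 • (z - m) with hf
  have hff : f ∈ frontier Q.P := ht1C.2
  have ht11 : 1 ≤ t1 := ht1C.1.1
  have hmf : segment ℝ m f ⊆ Q.P := by
    intro w hw
    obtain ⟨τ, τ0, τ1, rfl⟩ := mem_seg.1 hw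
    have e : m + τ • (f - m) = m + (τ * t1) • (z - m) := by
      rw [hf, add_sub_cancel_left, smul_smul]
    rw [e]
    rcases le_total (τ * t1) 1 with hle | hle
    · rcases (mul_nonneg τ0 (by linarith : (0:ℝ) ≤ t1)).lt_or_eq with h0 | h0
      · exact (h3 z hz3 _ h0 hle).1 (h.sub hzA)
      · rw [← h0]; simpa using hmP
    · have hle' : τ * t1 ≤ t1 := by nlinarith
      rcases hle'.lt_or_eq with h' | h'
      · refine hpre (τ * t1) hle (fun s hs hfr => ?_) _ ⟨hle, le_rfl⟩
        have := ht1min (show s ∈ C from ⟨⟨hs.1, hs.2.trans (hle'.trans ht1C.1.2)⟩, hfr⟩)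
        linarith [hs.2]
      · rw [h']; exact Q.fr_sub hff
  have hfpos : 0 < cr (b - a) (f - a) := by
    rw [hf, cr_affine, hm0]; simpa using mul_pos (by linarith) hzpos
  obtain ⟨i, hi⟩ := Q.mem_fr.1 hff
  -- a positive endpoint
  obtain ⟨k, hk, hkE⟩ : ∃ k, 0 < cr (b - a) (Q.V k - a) ∧ Q.V k ∈ Q.E i := by
    by_contra hcon
    push Not at hcon
    have c1 : cr (b - a) (Q.V i - a) ≤ 0 := by
      by_contra hc; push Not at hc; exact hcon i hc (left_mem_segment _ _ _)
    have c2 : cr (b - a) (Q.V (i + 1) - a) ≤ 0 := by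
      by_contra hc; push Not at hc; exact hcon (i + 1) hc (right_mem_segment _ _ _)
    obtain ⟨t, t0, t1, ht⟩ := mem_seg.1 hi
    rw [ht, cr_affine] at hfpos
    have := mul_nonpos_of_nonneg_of_nonpos (by linarith : (0:ℝ) ≤ 1 - t) c1
    have := mul_nonpos_of_nonneg_of_nonpos t0 c2
    linarith
  by_cases hmk : segment ℝ m (Q.V k) ⊆ Q.P
  · exact ⟨k, hk, m, hm, hmk⟩
  have hfk : segment ℝ f (Q.V k) ⊆ Q.P :=
    ((convex_segment _ _).segment_subset hi hkE).trans (Q.E_sub i)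
  obtain ⟨w, hw, _, hmw, l, hl, hlm⟩ := Q.brk_seg hfk hmf hmk
  refine ⟨l, ?_, m, hm, (seg_sub_left hl).trans hmw⟩
  have hwpos : 0 < cr (b - a) (w - a) := by
    obtain ⟨t, t0, t1, ht⟩ := mem_seg.1 hw
    rw [ht, cr_affine]
    rcases t0.lt_or_eq with h' | h'
    · have := mul_pos h' hk
      have := mul_nonneg (by linarith : (0:ℝ) ≤ 1 - t) hfpos.le
      linarith
    · rw [← h']; simpa using hfpos
  obtain ⟨t, t0, t1, ht⟩ := mem_seg.1 hl
  have t0' : 0 < t := by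
    rcases t0.lt_or_eq with h' | h'
    · exact h'
    · exfalso; apply hlm; rw [ht, ← h']; simp
  rw [ht, cr_affine, hm0]
  simpa using mul_pos t0' hwpos

end CPoly


/-- inner product `⟨w-a, w-b⟩` -/
def dp (a b w : ℂ) : ℝ := (w.re - a.re) * (w.re - b.re) + (w.im - a.im) * (w.im - b.im)

/-- centre of the circle through `a`, `b` with parameter `s` -/
def ctr (a b : ℂ) (s : ℝ) : ℂ := (1 / 2 : ℝ) • (a + b) + (s / 2) • (Complex.I * (b - a))

lemma ctr_pow (a b w : ℂ) (s : ℝ) :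
    dist w (ctr a b s) ^ 2 - dist a (ctr a b s) ^ 2 = dp a b w - s * cr (b - a) (w - a) := by
  rw [dist_sq_c, dist_sq_c]
  simp only [ctr, dp, cr, Complex.add_re, Complex.add_im, Complex.sub_re, Complex.sub_im,
    Complex.smul_re, Complex.smul_im, smul_eq_mul, Complex.mul_re, Complex.mul_im,
    Complex.I_re, Complex.I_im]
  ring

lemma ctr_exists {a b O : ℂ} (hab : a ≠ b) (h : dist a O = dist b O) : ∃ s, O = ctr a b s := by
  have h2 : dist a O ^ 2 = dist b O ^ 2 := by rw [h]
  rw [dist_sq_c, dist_sq_c] at h2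
  have hne : Complex.I * (b - a) ≠ 0 := mul_ne_zero Complex.I_ne_zero (sub_ne_zero.2 hab.symm)
  obtain ⟨t, ht⟩ := cr_eq_zero (v := O - (1 / 2 : ℝ) • (a + b)) hne (by
    simp only [cr, Complex.add_re, Complex.add_im, Complex.sub_re, Complex.sub_im,
      Complex.smul_re, Complex.smul_im, smul_eq_mul, Complex.mul_re, Complex.mul_im,
      Complex.I_re, Complex.I_im]
    linarith)
  refine ⟨2 * t, ?_⟩
  rw [ctr, show 2 * t / 2 = t by ring, ← ht]
  ring

lemma dist_of_sq {x y : ℝ} (hx : 0 ≤ x) (hy : 0 ≤ y) (h : x ^ 2 - y ^ 2 = 0) : x = y := by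
  have : x ^ 2 = y ^ 2 := by linarith
  exact (pow_left_inj₀ hx hy (by norm_num)).1 this

namespace CPoly
variable {Q : CPoly}

lemma Cut.choose {A : Set ℂ} {ia ib : ZMod Q.n} {O : ℂ} {r : ℝ} (h : Cut Q A (Q.V ia) (Q.V ib))
    (hcl : Clear Q (Q.V ia) (Q.V ib) O r) (hA : A.Nonempty) :
    ∃ ic O' r', 0 < cr (Q.V ib - Q.V ia) (Q.V ic - Q.V ia) ∧
      (∃ y ∈ openSegment ℝ (Q.V ia) (Q.V ib), segment ℝ y (Q.V ic) ⊆ Q.P) ∧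
      dist (Q.V ic) O' = r' ∧ Clear Q (Q.V ia) (Q.V ib) O' r' := by
  have := Q.finite_idx
  obtain ⟨k0, hk0⟩ := h.cand hA
  set a := Q.V ia with ha
  set b := Q.V ib with hb
  let K : Set (ZMod Q.n) := {k | 0 < cr (b - a) (Q.V k - a) ∧
      ∃ y ∈ openSegment ℝ a b, segment ℝ y (Q.V k) ⊆ Q.P}
  obtain ⟨c, hcK, hmin⟩ := Set.exists_min_image K
    (fun k => dp a b (Q.V k) / cr (b - a) (Q.V k - a)) (Set.toFinite _) ⟨k0, hk0⟩
  obtain ⟨hcpos, y, hy, hyc⟩ := hcK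
  obtain ⟨hra, hrb, hclear⟩ := hcl
  obtain ⟨s0, rfl⟩ := ctr_exists h.hab (hra.trans hrb.symm)
  set s := dp a b (Q.V c) / cr (b - a) (Q.V c - a) with hs
  have hpc := ctr_pow a b (Q.V c) s
  have hpb := ctr_pow a b b s
  have e1 : dist (Q.V c) (ctr a b s) = dist a (ctr a b s) := by
    refine dist_of_sq dist_nonneg dist_nonneg ?_
    rw [hpc, hs, div_mul_cancel₀ _ hcpos.ne', sub_self]
  have e2 : dist b (ctr a b s) = dist a (ctr a b s) := by
    refine dist_of_sq dist_nonneg dist_nonneg ?_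
    rw [hpb, cr_self]; simp [dp]
  have hs0 : s0 ≤ s := by
    have h1 : r ≤ dist (Q.V c) (ctr a b s0) := by
      by_contra hc
      push Not at hc
      exact hclear c hc y hy hyc
    have h2 := ctr_pow a b (Q.V c) s0
    rw [hra] at h2
    have h3 : 0 ≤ r := by rw [← hra]; exact dist_nonneg
    rw [hs, le_div_iff₀ hcpos]
    nlinarith
  refine ⟨c, ctr a b s, dist a (ctr a b s), hcpos, ⟨y, hy, hyc⟩, e1, rfl, e2, ?_⟩
  intro k hk y' hy' hvis
  have hpk := ctr_pow a b (Q.V k) s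
  have hlt : dp a b (Q.V k) - s * cr (b - a) (Q.V k - a) < 0 := by
    rw [← hpk]
    have : 0 ≤ dist (Q.V k) (ctr a b s) := dist_nonneg
    nlinarith
  rcases lt_or_ge 0 (cr (b - a) (Q.V k - a)) with hpos | hneg
  · have := hmin k ⟨hpos, y', hy', hvis⟩
    rw [le_div_iff₀ hpos] at this
    linarith
  · refine hclear k ?_ y' hy' hvis
    have hpk0 := ctr_pow a b (Q.V k) s0
    rw [hra] at hpk0
    have h3 : 0 ≤ r := by rw [← hra]; exact dist_nonneg
    have : s * cr (b - a) (Q.V k - a) ≤ s0 * cr (b - a) (Q.V k - a) :=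
      mul_le_mul_of_nonpos_right hs0 hneg
    refine lt_of_pow_lt_pow_left₀ 2 h3 ?_
    linarith

/-- If `p` sees `y ∈ (a,b)`, `p` on the circle, then `p` sees `b`. -/
lemma Clear.sees_end {a b p y O : ℂ} {r : ℝ} (h : Clear Q a b O r) (hab : a ≠ b)
    (hseg : segment ℝ a b ⊆ Q.P) (hp : dist p O = r)
    (hy : y ∈ openSegment ℝ a b) (hpy : segment ℝ y p ⊆ Q.P) : segment ℝ p b ⊆ Q.P := by
  by_contra hcon
  obtain ⟨ξ, ξ0, ξ1, hξ⟩ := openSeg_iff.1 hy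
  have hyab := openSegment_subset_segment ℝ _ _ hy
  obtain ⟨Z, hZ, hZb, hpZ, k, hk, hkp⟩ := Q.brk_seg (o := p) ((seg_sub_right hyab).trans hseg)
    (by rw [segment_symm]; exact hpy) hcon
  obtain ⟨ζ, ζ0, ζ1, hZζ⟩ := open_of_tail ξ0 ξ1 hξ hZ hZb
  have hZo : Z ∈ openSegment ℝ a b := openSeg_iff.2 ⟨ζ, by linarith, ζ1, hZζ⟩
  have hZr := inside_chord h.1 h.2.1.le hab hZo
  refine h.2.2 k ?_ Z hZo (by rw [segment_symm]; exact (seg_sub_right hk).trans hpZ)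
  rcases seg_cases hk with e | e | e
  · exact absurd e hkp
  · rw [e]; exact hZr
  · refine inside_chord hp hZr.le ?_ e
    rintro rfl; linarith

lemma Clear.symm {a b O : ℂ} {r : ℝ} (h : Clear Q a b O r) : Clear Q b a O r :=
  ⟨h.2.1, h.1, fun k hk y hy => h.2.2 k hk y (by rw [openSegment_symm]; exact hy)⟩

/-- Points inside the disc visible from the open chord see no vertex inside the disc. -/
lemma Clear.node {a b y0 y O : ℂ} {r : ℝ} (h : Clear Q a b O r) (hab : a ≠ b)
    (hy0 : y0 ∈ openSegment ℝ a b) (hyr : dist y O < r) (hy : segment ℝ y0 y ⊆ Q.P)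
    {k : ZMod Q.n} (hk : dist (Q.V k) O < r) : ¬ segment ℝ y (Q.V k) ⊆ Q.P := by
  intro hyk
  have h0r := inside_chord h.1 h.2.1.le hab hy0
  by_cases hv : segment ℝ y0 (Q.V k) ⊆ Q.P
  · exact h.2.2 k hk y0 hy0 hv
  obtain ⟨z, hz, _, h0z, l, hl, _⟩ := Q.brk_seg hyk hy hv
  have hb : Convex ℝ (ball O r) := convex_ball O r
  have hz' : z ∈ ball O r := hb.segment_subset (show y ∈ ball O r from hyr) hk hz
  have hl' : Q.V l ∈ ball O r := hb.segment_subset (show y0 ∈ ball O r from h0r) hz' hl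
  exact h.2.2 l hl' y0 hy0 ((seg_sub_left hl).trans h0z)

/-- The pocket behind a side `ac` of a triangle `acb` (with `b` on the negative side). -/
lemma child {ia ic : ZMod Q.n} {b : ℂ} (hneg : 0 < cr (Q.V ia - Q.V ic) (b - Q.V ic))
    (hT : Tri (Q.V ic) (Q.V ia) b ⊆ Q.P) :
    ∃ A, Cut Q A (Q.V ia) (Q.V ic) ∧ ∀ z ∈ Tri (Q.V ic) (Q.V ia) b, z ∉ A := by
  set a := Q.V ia with ha
  set c := Q.V ic with hc
  have hac : a ≠ c := by
    intro h; rw [h] at hneg; simp [cr] at hneg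
  have hseg : segment ℝ a c ⊆ Q.P := (tri_convex (tri_b hneg) (tri_a hneg)).trans hT
  obtain ⟨N, hN1, hN2⟩ := Q.sep (Q.V_mem_fr ia) (Q.V_mem_fr ic) hac hseg
  have hflip : ∀ z, cr (c - a) (z - a) = - cr (a - c) (z - c) := by
    intro z; simp [cr]; ring
  -- constancy on the triangle
  have hconst : ∀ z ∈ Tri c a b, z ∉ segment ℝ a c → N z = N b := by
    intro z hz hzs
    have hbT := tri_c hneg
    have hzpos : 0 < cr (a - c) (z - c) := by
      rcases hz.1.lt_or_eq with h | h
      · exact h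
      · exfalso
        apply hzs
        have hs := tri_sum c a b z
        have e := tri_eq_div hneg z
        rw [← h] at e hs
        simp only [zero_div, zero_smul, add_zero] at e
        rw [segment_symm]
        refine ⟨_, _, div_nonneg hz.2.1 hneg.le, div_nonneg hz.2.2 hneg.le, ?_, e.symm⟩
        rw [← add_div, div_eq_one_iff_eq hneg.ne']; linarith
    have hpos : ∀ w ∈ segment ℝ b z, w ∉ segment ℝ a c := by
      intro w hw hw'
      have h0 := cr_seg_zero hw'
      rw [hflip] at h0
      obtain ⟨t, t0, t1, rfl⟩ := mem_seg.1 hw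
      rw [cr_affine] at h0
      have h1 : 0 ≤ (1 - t) * cr (a - c) (b - c) := mul_nonneg (by linarith) hneg.le
      have h2 : 0 ≤ t * cr (a - c) (z - c) := mul_nonneg t0 hzpos.le
      have h3 : t * cr (a - c) (z - c) = 0 := by linarith
      rcases mul_eq_zero.1 h3 with h4 | h4
      · rw [h4] at h0; simp at h0; linarith
      · linarith
    have hsub : segment ℝ b z ⊆ Q.P := (tri_convex hbT hz).trans hT
    exact conn_loc (P := Q.P) (W := {w | N w = N b}) (seg_preconn b z) hsub
      (fun w hw hW => by
        obtain ⟨ε, hε, h⟩ := hN1 w (hsub hw) (hpos w hw)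
        exact ⟨ε, hε, fun v hv hd => (h v hv hd).trans hW⟩)
      (fun w hw hW => by
        obtain ⟨ε, hε, h⟩ := hN1 w (hsub hw) (hpos w hw)
        exact ⟨ε, hε, fun v hv hd h' => hW ((h v hv hd).symm.trans h')⟩)
      (left_mem_segment _ _ _) rfl (right_mem_segment _ _ _)
  refine ⟨{z | z ∈ Q.P ∧ z ∉ segment ℝ a c ∧ N z ≠ N b}, ⟨hac, hseg, fun z hz => hz.1,
    fun z hz => hz.2.1, ?_, ?_, ?_⟩, fun z hz hzA => hzA.2.2 (hconst z hz hzA.2.1)⟩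
  · rintro x ⟨hxP, hxs, hxN⟩
    obtain ⟨ε1, hε1, h1⟩ := hN1 x hxP hxs
    obtain ⟨ε2, hε2, h2⟩ := closed_near (closed_seg a c) hxs
    refine ⟨min ε1 ε2, by positivity, fun z hz hd => ⟨hz, h2 z (hd.trans_le (min_le_right _ _)), ?_⟩⟩
    rw [h1 z hz (hd.trans_le (min_le_left _ _))]; exact hxN
  · intro x hxP hxs hxA
    obtain ⟨ε1, hε1, h1⟩ := hN1 x hxP hxs
    refine ⟨ε1, hε1, fun z hz hd hzA => hxA ⟨hxP, hxs, ?_⟩⟩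
    rw [← h1 z hz hd]; exact hzA.2.2
  · intro m hm
    obtain ⟨ε, hε, k, h⟩ := hN2 m hm
    have hms := openSegment_subset_segment ℝ _ _ hm
    have hm0 : cr (a - c) (m - c) = 0 := by
      have := hflip m; rw [cr_seg_zero hms] at this; linarith
    have hmT : m ∈ Tri c a b := tri_side hneg (by rw [segment_symm]; exact hms)
    have hk : N b = k - 1 := by
      obtain ⟨τ, τ0, τ1, hτ⟩ : ∃ τ : ℝ, 0 < τ ∧ τ ≤ 1 ∧ dist (m + τ • (b - m)) m < ε := by
        have hp : 0 ≤ ‖b - m‖ := norm_nonneg _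
        refine ⟨min 1 (ε / (2 * (‖b - m‖ + 1))), by positivity, min_le_left _ _, ?_⟩
        rw [dist_eq_norm, add_sub_cancel_left, norm_smul, Real.norm_eq_abs,
          abs_of_pos (by positivity)]
        calc _ ≤ ε / (2 * (‖b - m‖ + 1)) * ‖b - m‖ := by gcongr; exact min_le_right _ _
          _ < ε := by
            rw [div_mul_eq_mul_div, div_lt_iff₀ (by positivity)]; nlinarith
      have hzT : m + τ • (b - m) ∈ Tri c a b := tri_convex hmT (tri_c hneg) (seg_mem τ0.le τ1)
      have hcrz : cr (c - a) (m + τ • (b - m) - a) < 0 := by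
        rw [hflip, cr_affine, hm0]
        have := mul_pos τ0 hneg
        linarith
      rw [← hconst _ hzT (fun hs => by have := cr_seg_zero hs; linarith)]
      exact (h _ (hT hzT) hτ).2 hcrz
    refine ⟨ε, hε, fun z hz hd => ⟨fun hp => ⟨hz, fun hs => ?_, ?_⟩, fun hn hzA => ?_⟩⟩
    · have := cr_seg_zero hs; linarith
    · rw [(h z hz hd).1 hp, hk]; omega
    · exact hzA.2.2 (by rw [(h z hz hd).2 hn, hk])

end CPoly


namespace CPoly
variable {Q : CPoly}

lemma sub_generic {A A' : Set ℂ} {a b s t p q : ℂ} (h : Cut Q A a b) (h' : Cut Q A' s t)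
    (h1 : ∀ z ∈ segment ℝ a b, z ∉ A') (hp : p ∈ frontier Q.P)
    (h2 : ∀ z ∈ segment ℝ s t, z ≠ p → z ∈ A) (hq : q ∈ Q.P) (hqp : q ≠ p) (hqA : q ∉ A') 
    (hpA : p ∉ A') : A' ⊆ A := by
  intro x hx
  by_contra hxA
  have := Q.clopen_punct (F := {p}) (W := A' \ A) (by simp) (by simpa using hp)
    (fun z hz hzF hzW => by
      by_cases hzA : z ∈ A
      · obtain ⟨ε, hε, hh⟩ := h.opn z hzA
        exact ⟨ε, hε, fun w hw hd hwW => hwW.2 (hh w hw hd)⟩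
      · have hz' : z ∉ A' := fun hc => hzW ⟨hc, hzA⟩
        by_cases hs : z ∈ segment ℝ s t
        · exact absurd (h2 z hs hzF) hzA
        · obtain ⟨ε, hε, hh⟩ := h'.cls z hz hs hz'
          exact ⟨ε, hε, fun w hw hd hwW => hh w hw hd hwW.1⟩)
    (fun z hz hzF hzW => by
      obtain ⟨ε1, hε1, hh1⟩ := h'.opn z hzW.1
      obtain ⟨ε2, hε2, hh2⟩ := h.cls z hz (fun hc => h1 z hc hzW.1) hzW.2
      exact ⟨min ε1 ε2, by positivity, fun w hw hd => ⟨hh1 w hw (hd.trans_le (min_le_left _ _)),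
        hh2 w hw (hd.trans_le (min_le_right _ _))⟩⟩)
    (h'.sub hx) (by rintro rfl; exact hpA hx) ⟨hx, hxA⟩
  exact hqA (this ⟨hq, hqp⟩).1

/-- Data of a triangle erected over the chord, with its two children. -/
structure Node (Q : CPoly) (A A1 A2 : Set ℂ) (ia ib ic : ZMod Q.n) : Prop where
  h : Cut Q A (Q.V ia) (Q.V ib)
  pos : 0 < cr (Q.V ib - Q.V ia) (Q.V ic - Q.V ia)
  tri : Tri (Q.V ia) (Q.V ib) (Q.V ic) ⊆ Q.P
  h1 : Cut Q A1 (Q.V ia) (Q.V ic)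
  h2 : Cut Q A2 (Q.V ic) (Q.V ib)
  t1 : ∀ z ∈ Tri (Q.V ia) (Q.V ib) (Q.V ic), z ∉ A1
  t2 : ∀ z ∈ Tri (Q.V ia) (Q.V ib) (Q.V ic), z ∉ A2

namespace Node
variable {A A1 A2 : Set ℂ} {ia ib ic : ZMod Q.n}

lemma tri_A (N : Node Q A A1 A2 ia ib ic) {z : ℂ} (hz : z ∈ Tri (Q.V ia) (Q.V ib) (Q.V ic))
    (hp : 0 < cr (Q.V ib - Q.V ia) (z - Q.V ia)) : z ∈ A := by
  have hm : midpoint ℝ (Q.V ia) (Q.V ib) ∈ openSegment ℝ (Q.V ia) (Q.V ib) :=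
    midpoint_mem_openSegment _ _
  refine N.h.vis_mem hm hp ((tri_convex (tri_side N.pos ?_) hz).trans N.tri)
  exact openSegment_subset_segment ℝ _ _ hm

lemma seg1 (N : Node Q A A1 A2 ia ib ic) {z : ℂ} (hz : z ∈ segment ℝ (Q.V ia) (Q.V ic)) :
    z ∈ Tri (Q.V ia) (Q.V ib) (Q.V ic) := tri_convex (tri_a N.pos) (tri_c N.pos) hz

lemma seg2 (N : Node Q A A1 A2 ia ib ic) {z : ℂ} (hz : z ∈ segment ℝ (Q.V ic) (Q.V ib)) :
    z ∈ Tri (Q.V ia) (Q.V ib) (Q.V ic) := tri_convex (tri_c N.pos) (tri_b N.pos) hz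

lemma l3_seg1 {a c z : ℂ} (hz : z ∈ segment ℝ a c) : cr (a - c) (z - c) = 0 := by
  rw [segment_symm] at hz; exact cr_seg_zero hz

lemma tri_vert_ac {a b c z : ℂ} (h : 0 < cr (b - a) (c - a)) (h1 : cr (b - a) (z - a) = 0)
    (h3 : cr (a - c) (z - c) = 0) : z = a :=
  tri_vert (a := c) (b := a) (c := b) (by rw [cr_cyc, cr_cyc] ; exact h) h3 h1

lemma tri_vert_c {a b c z : ℂ} (h : 0 < cr (b - a) (c - a)) (h2 : cr (c - b) (z - b) = 0)
    (h3 : cr (a - c) (z - c) = 0) : z = c :=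
  tri_vert (a := b) (b := c) (c := a) (by rw [cr_cyc] ; exact h) h2 h3

lemma sub1 (N : Node Q A A1 A2 ia ib ic) : A1 ⊆ A := by
  refine sub_generic (p := Q.V ia) (q := Q.V ib) N.h N.h1 (fun z hz => N.t1 z (tri_side N.pos hz))
    (Q.V_mem_fr _) (fun z hz hza => ?_) (Q.V_mem _) N.h.hab.symm (N.t1 _ (tri_b N.pos))
    (N.t1 _ (tri_a N.pos))
  have hT := N.seg1 hz
  refine N.tri_A hT (lt_of_le_of_ne hT.1 fun h0 => hza ?_)
  exact tri_vert_ac N.pos h0.symm (l3_seg1 hz)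

lemma sub2 (N : Node Q A A1 A2 ia ib ic) : A2 ⊆ A := by
  refine sub_generic (p := Q.V ib) (q := Q.V ia) N.h N.h2 (fun z hz => N.t2 z (tri_side N.pos hz))
    (Q.V_mem_fr _) (fun z hz hza => ?_) (Q.V_mem _) N.h.hab (N.t2 _ (tri_a N.pos))
    (N.t2 _ (tri_b N.pos))
  have hT := N.seg2 hz
  refine N.tri_A hT (lt_of_le_of_ne hT.1 fun h0 => hza ?_)
  exact tri_vert N.pos h0.symm (l3_seg1 hz)

lemma disj12 (N : Node Q A A1 A2 ia ib ic) {x : ℂ} (hx1 : x ∈ A1) (hx2 : x ∈ A2) : False := by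
  have hc1 : Q.V ic ∉ A1 := N.t1 _ (tri_c N.pos)
  have := Q.clopen_punct (F := {Q.V ic}) (W := A1 ∩ A2) (by simp)
    (by simpa using Q.V_mem_fr ic)
    (fun z hz hzF hzW => by
      have aux : z ∉ A1 → z ∈ segment ℝ (Q.V ia) (Q.V ic) → z ∉ segment ℝ (Q.V ic) (Q.V ib) := by
        intro _ hs hs'
        exact hzF (tri_vert_c N.pos (l3_seg1 hs') (l3_seg1 hs))
      by_cases hz1 : z ∈ A1
      · have hz2 : z ∉ A2 := fun hc => hzW ⟨hz1, hc⟩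
        have hs : z ∉ segment ℝ (Q.V ic) (Q.V ib) := fun hs => N.t1 z (N.seg2 hs) hz1
        obtain ⟨ε, hε, hh⟩ := N.h2.cls z hz hs hz2
        exact ⟨ε, hε, fun w hw hd hwW => hh w hw hd hwW.2⟩
      · by_cases hs : z ∈ segment ℝ (Q.V ia) (Q.V ic)
        · obtain ⟨ε, hε, hh⟩ := N.h2.cls z hz (aux hz1 hs) (N.t2 z (N.seg1 hs))
          exact ⟨ε, hε, fun w hw hd hwW => hh w hw hd hwW.2⟩
        · obtain ⟨ε, hε, hh⟩ := N.h1.cls z hz hs hz1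
          exact ⟨ε, hε, fun w hw hd hwW => hh w hw hd hwW.1⟩)
    (fun z hz hzF hzW => by
      obtain ⟨ε1, hε1, hh1⟩ := N.h1.opn z hzW.1
      obtain ⟨ε2, hε2, hh2⟩ := N.h2.opn z hzW.2
      exact ⟨min ε1 ε2, by positivity, fun w hw hd => ⟨hh1 w hw (hd.trans_le (min_le_left _ _)),
        hh2 w hw (hd.trans_le (min_le_right _ _))⟩⟩)
    (N.h1.sub hx1) (by rintro rfl; exact hc1 hx1) ⟨hx1, hx2⟩
  exact N.t1 _ (tri_a N.pos) (this ⟨Q.V_mem ia, N.h1.hab⟩).1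

lemma cover (N : Node Q A A1 A2 ia ib ic) {x : ℂ} (hx : x ∈ A) :
    x ∈ Tri (Q.V ia) (Q.V ib) (Q.V ic) ∨ x ∈ A1 ∨ x ∈ A2 := by
  by_contra hcon
  push Not at hcon
  obtain ⟨hxT, hx1, hx2⟩ := hcon
  set a := Q.V ia with ha
  set b := Q.V ib with hb
  set c := Q.V ic with hc
  have hpos := N.pos
  have hh := N.h
  have hh1 := N.h1
  have hh2 := N.h2
  rw [← ha, ← hb] at hh
  rw [← ha, ← hb, ← hc] at hpos
  rw [← ha, ← hc] at hh1
  rw [← hc, ← hb] at hh2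
  let W : Set ℂ := {z | z ∈ A ∧ z ∉ Tri a b c ∧ z ∉ A1 ∧ z ∉ A2}
  have key := Q.clopen_punct (F := {a, b, c}) (W := W) (by simp)
    (by
      rintro z (rfl | rfl | rfl)
      · exact Q.V_mem_fr _
      · exact Q.V_mem_fr _
      · exact Q.V_mem_fr _)
    (fun z hz hzF hzW => by
      have hza : z ≠ a := fun e => hzF (Or.inl e)
      have hzb : z ≠ b := fun e => hzF (Or.inr (Or.inl e))
      have hzc : z ≠ c := fun e => hzF (Or.inr (Or.inr e))
      by_cases hs : z ∈ segment ℝ a b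
      · have hzo : z ∈ openSegment ℝ a b := by
          rcases seg_cases hs with e | e | e
          · exact absurd e hza
          · exact absurd e hzb
          · exact e
        obtain ⟨l2, l3⟩ := open_sides hpos hzo
        obtain ⟨ε2, hε2, g2⟩ := cr_pos_near l2
        obtain ⟨ε3, hε3, g3⟩ := cr_pos_near l3
        obtain ⟨ε, hε, g⟩ := hh.side z hzo
        refine ⟨min ε (min ε2 ε3), by positivity, fun w hw hd hwW => ?_⟩
        have d1 := hd.trans_le (min_le_left _ _)
        have d2 := hd.trans_le ((min_le_right _ _).trans (min_le_left _ _))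
        have d3 := hd.trans_le ((min_le_right _ _).trans (min_le_right _ _))
        rcases lt_or_ge (cr (b - a) (w - a)) 0 with hn | hn
        · exact (g w hw d1).2 hn hwW.1
        · exact hwW.2.1 ⟨hn, (g2 w d2).le, (g3 w d3).le⟩
      by_cases hzA : z ∈ A
      · by_cases hz1 : z ∈ A1
        · obtain ⟨ε, hε, g⟩ := hh1.opn z hz1
          exact ⟨ε, hε, fun w hw hd hwW => hwW.2.2.1 (g w hw hd)⟩
        by_cases hz2 : z ∈ A2
        · obtain ⟨ε, hε, g⟩ := hh2.opn z hz2
          exact ⟨ε, hε, fun w hw hd hwW => hwW.2.2.2 (g w hw hd)⟩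
        have hzT : z ∈ Tri a b c := by
          by_contra hc
          exact hzW ⟨hzA, hc, hz1, hz2⟩
        obtain ⟨t1, t2, t3⟩ := hzT
        have p1 : 0 < cr (b - a) (z - a) := by
          refine lt_of_le_of_ne t1 fun h0 => hs ?_
          refine openSegment_subset_segment ℝ _ _ (tri_open hpos h0.symm ?_ ?_)
          · exact lt_of_le_of_ne t2 fun h2 => hzb (tri_vert hpos h0.symm h2.symm)
          · exact lt_of_le_of_ne t3 fun h3 => hza (tri_vert_ac hpos h0.symm h3.symm)
        obtain ⟨ε1, hε1, g1⟩ := cr_pos_near p1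
        rcases t2.lt_or_eq with p2 | p2
        · obtain ⟨ε2, hε2, g2⟩ := cr_pos_near p2
          rcases t3.lt_or_eq with p3 | p3
          · obtain ⟨ε3, hε3, g3⟩ := cr_pos_near p3
            refine ⟨min ε1 (min ε2 ε3), by positivity, fun w hw hd hwW => ?_⟩
            have d1 := hd.trans_le (min_le_left _ _)
            have d2 := hd.trans_le ((min_le_right _ _).trans (min_le_left _ _))
            have d3 := hd.trans_le ((min_le_right _ _).trans (min_le_right _ _))
            exact hwW.2.1 ⟨(g1 w d1).le, (g2 w d2).le, (g3 w d3).le⟩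
          · have hzo : z ∈ openSegment ℝ a c := by
              rw [openSegment_symm]
              exact tri_open (a := c) (b := a) (c := b) (by rw [cr_cyc, cr_cyc]; exact hpos)
                p3.symm p1 p2
            obtain ⟨ε, hε, g⟩ := hh1.side z hzo
            refine ⟨min ε (min ε1 ε2), by positivity, fun w hw hd hwW => ?_⟩
            have d1 := hd.trans_le (min_le_left _ _)
            have d2 := hd.trans_le ((min_le_right _ _).trans (min_le_left _ _))
            have d3 := hd.trans_le ((min_le_right _ _).trans (min_le_right _ _))
            rcases lt_or_ge (cr (a - c) (w - c)) 0 with hn | hn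
            · refine hwW.2.2.1 ((g w hw d1).1 ?_)
              have : cr (c - a) (w - a) = - cr (a - c) (w - c) := by simp [cr]; ring
              linarith
            · exact hwW.2.1 ⟨(g1 w d2).le, (g2 w d3).le, hn⟩
        · have p3 : 0 < cr (a - c) (z - c) :=
            lt_of_le_of_ne t3 fun h3 => hzc (tri_vert_c hpos p2.symm h3.symm)
          obtain ⟨ε3, hε3, g3⟩ := cr_pos_near p3
          have hzo : z ∈ openSegment ℝ c b := by
            rw [openSegment_symm]
            exact tri_open (a := b) (b := c) (c := a) (by rw [cr_cyc]; exact hpos)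
              p2.symm p3 p1
          obtain ⟨ε, hε, g⟩ := hh2.side z hzo
          refine ⟨min ε (min ε1 ε3), by positivity, fun w hw hd hwW => ?_⟩
          have d1 := hd.trans_le (min_le_left _ _)
          have d2 := hd.trans_le ((min_le_right _ _).trans (min_le_left _ _))
          have d3 := hd.trans_le ((min_le_right _ _).trans (min_le_right _ _))
          rcases lt_or_ge (cr (c - b) (w - b)) 0 with hn | hn
          · refine hwW.2.2.2 ((g w hw d1).1 ?_)
            have : cr (b - c) (w - c) = - cr (c - b) (w - b) := by simp [cr]; ring
            linarith
          · exact hwW.2.1 ⟨(g1 w d2).le, hn, (g3 w d3).le⟩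
      · obtain ⟨ε, hε, g⟩ := hh.cls z hz hs hzA
        exact ⟨ε, hε, fun w hw hd hwW => g w hw hd hwW.1⟩)
    (fun z hz hzF hzW => by
      obtain ⟨zA, zT, z1, z2⟩ := hzW
      have s1 : z ∉ segment ℝ a c := fun hs => zT (N.seg1 hs)
      have s2 : z ∉ segment ℝ c b := fun hs => zT (N.seg2 hs)
      obtain ⟨ε, hε, g⟩ := hh.opn z zA
      obtain ⟨ε0, hε0, g0⟩ := closed_near (tri_closed a b c) zT
      obtain ⟨ε1, hε1, g1⟩ := hh1.cls z hz s1 z1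
      obtain ⟨ε2, hε2, g2⟩ := hh2.cls z hz s2 z2
      refine ⟨min (min ε ε0) (min ε1 ε2), by positivity, fun w hw hd => ?_⟩
      exact ⟨g w hw (hd.trans_le ((min_le_left _ _).trans (min_le_left _ _))),
        g0 w (hd.trans_le ((min_le_left _ _).trans (min_le_right _ _))),
        g1 w hw (hd.trans_le ((min_le_right _ _).trans (min_le_left _ _))),
        g2 w hw (hd.trans_le ((min_le_right _ _).trans (min_le_right _ _)))⟩)
    (hh.sub hx)
    (by
      rintro (rfl | rfl | rfl)
      · exact hxT (tri_a hpos)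
      · exact hxT (tri_b hpos)
      · exact hxT (tri_c hpos)) ⟨hx, hxT, hx1, hx2⟩
  have hmid : midpoint ℝ a b ∈ openSegment ℝ a b := midpoint_mem_openSegment _ _
  have hms := openSegment_subset_segment ℝ _ _ hmid
  have hmW := key ⟨hh.seg hms, by
    rintro (e | e | e)
    · exact hh.hab (by simpa [midpoint_eq_left_iff] using e)
    · have e : midpoint ℝ a b = b := e
      exact hh.hab (by simpa [midpoint_eq_right_iff] using e)
    · have e : midpoint ℝ a b = c := e
      have := cr_seg_zero hms
      rw [e] at this
      linarith⟩
  exact hmW.2.1 (tri_side hpos hms)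

end Node

end CPoly


namespace CPoly
variable {Q : CPoly}

lemma sees_tri {a b c g X : ℂ} (hk : 0 < cr (b - a) (c - a)) (hX : X ∈ openSegment ℝ a b)
    (hX' : X ∈ openSegment ℝ g c) (ga : segment ℝ g a ⊆ Q.P) (gb : segment ℝ g b ⊆ Q.P)
    (gc : segment ℝ g c ⊆ Q.P) (ac : segment ℝ c a ⊆ Q.P) (bc : segment ℝ c b ⊆ Q.P) {z : ℂ}
    (hz : z ∈ Tri a b c) : segment ℝ g z ⊆ Q.P := by
  obtain ⟨ξ, ξ0, ξ1, hξ⟩ := openSeg_iff.1 hX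
  obtain ⟨χ, χ0, χ1, hχ⟩ := openSeg_iff.1 hX'
  obtain ⟨l, hl, hl'⟩ : ∃ l : ℝ, 0 < l ∧ l * (1 - χ) = χ :=
    ⟨χ / (1 - χ), div_pos χ0 (by linarith), div_mul_cancel₀ _ (by linarith)⟩
  have hg : g = a + ((1 + l) * ξ) • (b - a) - l • (c - a) := by
    have h1 : (1 - χ) • g = (1 - χ) • (a + ((1 + l) * ξ) • (b - a) - l • (c - a)) := by
      have e : a + ξ • (b - a) = g + χ • (c - g) := hξ ▸ hχ
      have e1 := congrArg Complex.re e
      have e2 := congrArg Complex.im e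
      have hl2 : (1 + l) * (1 - χ) = 1 := by linarith
      simp only [Complex.add_re, Complex.sub_re, Complex.smul_re, Complex.add_im, Complex.sub_im,
        Complex.smul_im, smul_eq_mul] at e1 e2
      apply Complex.ext
      · simp only [Complex.add_re, Complex.sub_re, Complex.smul_re, smul_eq_mul]
        linear_combination -e1 - ξ * (b.re - a.re) * hl2 + (c.re - a.re) * hl'
      · simp only [Complex.add_im, Complex.sub_im, Complex.smul_im, smul_eq_mul]
        linear_combination -e2 - ξ * (b.im - a.im) * hl2 + (c.im - a.im) * hl'
    exact smul_right_injective ℂ (show (1 - χ) ≠ 0 by linarith) h1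
  obtain ⟨z1, z2, z3⟩ := hz
  have p1 : 0 < (1 + l) * ξ := by positivity
  have p2 : 0 < (1 + l) * (1 - ξ) := mul_pos (by positivity) (by linarith)
  rcases le_total 0 (cr (c - g) (z - g)) with h | h
  · have ho : cr (g - a) (c - a) = (1 + l) * ξ * cr (b - a) (c - a) := by
      rw [hg]; simp [cr]; ring
    have ho' : 0 < cr (g - a) (c - a) := by rw [ho]; positivity
    have hT := Q.tri_sub ho' (by rw [segment_symm]; exact ga) gc (by rw [segment_symm]; exact ac)
    have hz' : z ∈ Tri a g c := by
      refine ⟨?_, h, z3⟩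
      have : cr (g - a) (z - a) = (1 + l) * ξ * cr (b - a) (z - a) + l * cr (a - c) (z - c) := by
        rw [hg]; simp [cr]; ring
      rw [this]; positivity
    exact (tri_convex (tri_b ho') hz').trans hT
  · have ho : cr (b - g) (c - g) = (1 + l) * (1 - ξ) * cr (b - a) (c - a) := by
      rw [hg]; simp [cr]; ring
    have ho' : 0 < cr (b - g) (c - g) := by rw [ho]; positivity
    have hT := Q.tri_sub ho' gb (by rw [segment_symm]; exact bc) gc
    have hz' : z ∈ Tri g b c := by
      refine ⟨?_, z2, ?_⟩
      · have : cr (b - g) (z - g) = (1 + l) * (1 - ξ) * cr (b - a) (z - a)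
            + l * cr (c - b) (z - b) := by
          rw [hg]; simp [cr]; ring
        rw [this]; positivity
      · have : cr (g - c) (z - c) = - cr (c - g) (z - g) := by simp [cr]; ring
        rw [this]; linarith
    exact (tri_convex (tri_a ho') hz').trans hT

/-- The conflict lemma. -/
lemma conflict (hs : Q.Sep) {A : Set ℂ} {ia ib ic ig : ZMod Q.n} {O : ℂ} {r : ℝ}
    (h : Cut Q A (Q.V ia) (Q.V ib)) (hcl : Clear Q (Q.V ia) (Q.V ib) O r)
    (hpos : 0 < cr (Q.V ib - Q.V ia) (Q.V ic - Q.V ia)) (hc : dist (Q.V ic) O = r)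
    (hca : segment ℝ (Q.V ic) (Q.V ia) ⊆ Q.P) (hcb : segment ℝ (Q.V ic) (Q.V ib) ⊆ Q.P)
    (hcA : Q.V ic ∈ A) (hg : Q.V ig ∉ A) (hgc : segment ℝ (Q.V ig) (Q.V ic) ⊆ Q.P)
    (hd : dist (Q.V ig) (Q.V ic) < 2) {z : ℂ} (hz : z ∈ Tri (Q.V ia) (Q.V ib) (Q.V ic)) :
    segment ℝ (Q.V ig) z ⊆ Q.P := by
  have hT := Q.tri_sub hpos h.seg (by rw [segment_symm]; exact hcb) (by rw [segment_symm]; exact hca)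
  have hab : ia ≠ ib := fun e => h.hab (by rw [e])
  have hac : ia ≠ ic := by rintro rfl; simp [cr] at hpos
  have hbc : ib ≠ ic := by rintro rfl; rw [cr_self] at hpos; exact lt_irrefl _ hpos
  have dac : 1 ≤ dist (Q.V ia) (Q.V ic) := F1 hs hac (by rw [segment_symm]; exact hca)
  have dbc : 1 ≤ dist (Q.V ib) (Q.V ic) := F1 hs hbc (by rw [segment_symm]; exact hcb)
  have hX : ∃ X ∈ segment ℝ (Q.V ig) (Q.V ic), X ∈ segment ℝ (Q.V ia) (Q.V ib) := by
    by_contra hcon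
    push Not at hcon
    exact hg (h.cross (by rw [segment_symm]; exact hgc)
      (fun z hz => hcon z (by rw [segment_symm]; exact hz)) hcA)
  obtain ⟨X, hX1, hX2⟩ := hX
  -- passing through a vertex
  have thru : ∀ k, Q.V k ∈ segment ℝ (Q.V ig) (Q.V ic) → 1 ≤ dist (Q.V k) (Q.V ic) →
      Q.V k ∈ Tri (Q.V ia) (Q.V ib) (Q.V ic) → segment ℝ (Q.V ig) z ⊆ Q.P := by
    intro k hk hd1 hkT
    by_cases e : ig = k
    · rw [e]; exact (tri_convex hkT hz).trans hT
    · have h1 := F1 hs e ((seg_sub_left hk).trans hgc)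
      have := dist_seg hk
      linarith
  rcases seg_cases hX2 with e | e | hXo
  · exact thru ia (e ▸ hX1) dac (tri_a hpos)
  · exact thru ib (e ▸ hX1) dbc (tri_b hpos)
  rcases seg_cases hX1 with e | e | hXo'
  · exfalso
    rw [e] at hXo
    refine hcl.2.2 ig (inside_chord hcl.1 hcl.2.1.le h.hab hXo) _ hXo ?_
    rw [segment_same]; simpa using Q.V_mem ig
  · exfalso
    have := cr_seg_zero hX2
    rw [e] at this; linarith
  have gb := lemK hs hcl.1 hcl.2.1 hc hab dac dbc h.seg hgc hd hXo hXo' hcl.2.2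
  have ga := lemK hs hcl.2.1 hcl.1 hc hab.symm dbc dac (by rw [segment_symm]; exact h.seg) hgc hd
    (by rw [openSegment_symm]; exact hXo) hXo' hcl.symm.2.2
  exact sees_tri hpos hXo hXo' ga gb hgc hca hcb hz

lemma Clear.child {a b c p q O : ℂ} {r : ℝ} (hcl : Clear Q a b O r) (hab : a ≠ b)
    (hpos : 0 < cr (b - a) (c - a)) (hT : Tri a b c ⊆ Q.P)
    (hp : dist p O = r) (hq : dist q O = r) (hpT : p ∈ Tri a b c) (hqT : q ∈ Tri a b c)
    (hpq : p ≠ q) : Clear Q p q O r := by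
  refine ⟨hp, hq, fun k hk y hy => ?_⟩
  have hm : midpoint ℝ a b ∈ openSegment ℝ a b := midpoint_mem_openSegment _ _
  refine hcl.node hab hm (inside_chord hp hq.le hpq hy) ?_ hk
  exact (tri_convex (tri_side hpos (openSegment_subset_segment ℝ _ _ hm))
    (tri_convex hpT hqT (openSegment_subset_segment ℝ _ _ hy))).trans hT

lemma node_exists {A : Set ℂ} {ia ib : ZMod Q.n} {O : ℂ} {r : ℝ}
    (h : Cut Q A (Q.V ia) (Q.V ib)) (hcl : Clear Q (Q.V ia) (Q.V ib) O r) (hA : A.Nonempty) :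
    ∃ A1 A2 ic O' r', Node Q A A1 A2 ia ib ic ∧ Clear Q (Q.V ia) (Q.V ib) O' r' ∧
      dist (Q.V ic) O' = r' ∧ segment ℝ (Q.V ic) (Q.V ia) ⊆ Q.P ∧
      segment ℝ (Q.V ic) (Q.V ib) ⊆ Q.P ∧ Q.V ic ∈ A ∧
      Clear Q (Q.V ia) (Q.V ic) O' r' ∧ Clear Q (Q.V ic) (Q.V ib) O' r' := by
  obtain ⟨ic, O', r', hpos, ⟨y, hy, hyc⟩, hc, hcl'⟩ := h.choose hcl hA
  have hcb := hcl'.sees_end h.hab h.seg hc hy hyc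
  have hca := hcl'.symm.sees_end h.hab.symm (by rw [segment_symm]; exact h.seg) hc
    (by rw [openSegment_symm]; exact hy) hyc
  have hT := Q.tri_sub hpos h.seg (by rw [segment_symm]; exact hcb) (by rw [segment_symm]; exact hca)
  obtain ⟨A1, hA1, t1⟩ := CPoly.child (ia := ia) (ic := ic) (b := Q.V ib)
    (by rw [cr_cyc, cr_cyc]; exact hpos) (fun z hz => hT (tri_cyc hz))
  obtain ⟨A2, hA2, t2⟩ := CPoly.child (ia := ic) (ic := ib) (b := Q.V ia)
    (by rw [cr_cyc]; exact hpos) (fun z hz => hT (tri_cyc (tri_cyc hz)))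
  have hac : Q.V ia ≠ Q.V ic := by intro e; rw [e] at hpos; simp [cr] at hpos
  have hbc : Q.V ic ≠ Q.V ib := by
    intro e; rw [e, cr_self] at hpos; exact lt_irrefl _ hpos
  refine ⟨A1, A2, ic, O', r', ⟨h, hpos, hT, hA1, hA2, fun z hz => t1 z (tri_cyc (tri_cyc hz)),
    fun z hz => t2 z (tri_cyc hz)⟩, hcl', hc, hca, hcb, h.vis_mem hy hpos hyc, ?_, ?_⟩
  · exact hcl'.child h.hab hpos hT hcl'.1 hc (tri_a hpos) (tri_c hpos) hac
  · exact hcl'.child h.hab hpos hT hc hcl'.2.1 (tri_c hpos) (tri_b hpos) hbc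

/-- pairwise dispersed vertex sets -/
def Indep (Q : CPoly) (G : Set (ZMod Q.n)) : Prop :=
  ∀ i ∈ G, ∀ j ∈ G, i ≠ j → 2 ≤ geoC Q.P (Q.V i) (Q.V j)

lemma main_ind (hs : Q.Sep) : ∀ (N : ℕ) (A : Set ℂ) (ia ib : ZMod Q.n) (O : ℂ) (r : ℝ),
    Cut Q A (Q.V ia) (Q.V ib) → Clear Q (Q.V ia) (Q.V ib) O r → {k | Q.V k ∈ A}.ncard ≤ N →
    ∀ G0 : Set (ZMod Q.n), Q.Indep G0 → (∀ k ∈ G0, Q.V k ∉ A) →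
    ∃ G, G0 ⊆ G ∧ Q.Indep G ∧ (∀ k ∈ G, k ∉ G0 → Q.V k ∈ A) ∧
      (∀ z ∈ A, ∃ k ∈ G, segment ℝ (Q.V k) z ⊆ Q.P) ∧
      (A.Nonempty → ∀ z ∈ segment ℝ (Q.V ia) (Q.V ib), ∃ k ∈ G, segment ℝ (Q.V k) z ⊆ Q.P) := by
  intro N
  induction N with
  | zero =>
    intro A ia ib O r h hcl hN G0 hG0 hG0A
    rcases A.eq_empty_or_nonempty with rfl | hA
    · exact ⟨G0, Subset.rfl, hG0, fun k hk hk' => absurd hk hk', by simp, by simp⟩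
    · exfalso
      obtain ⟨A1, A2, ic, O', r', -, -, -, -, -, hcA, -, -⟩ := node_exists h hcl hA
      have := Q.finite_idx
      have : {k | Q.V k ∈ A} = ∅ := (Set.ncard_eq_zero (Set.toFinite _)).1 (by omega)
      have hm : ic ∈ {k | Q.V k ∈ A} := hcA
      rw [this] at hm; exact hm
  | succ N ih =>
    intro A ia ib O r h hcl hN G0 hG0 hG0A
    rcases A.eq_empty_or_nonempty with rfl | hA
    · exact ⟨G0, Subset.rfl, hG0, fun k hk hk' => absurd hk hk', by simp, by simp⟩
    obtain ⟨A1, A2, ic, O', r', hN', hcl', hc, hca, hcb, hcA, hcl1, hcl2⟩ := node_exists h hcl hA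
    have hfin := Q.finite_idx
    have hcT := tri_c hN'.pos
    -- step one
    have step : ∃ G1, G0 ⊆ G1 ∧ Q.Indep G1 ∧ (∀ k ∈ G1, k ∉ G0 → k = ic) ∧
        ∃ g ∈ G1, ∀ z ∈ Tri (Q.V ia) (Q.V ib) (Q.V ic), segment ℝ (Q.V g) z ⊆ Q.P := by
      by_cases hcon : ∃ g ∈ G0, geoC Q.P (Q.V g) (Q.V ic) < 2 ∨ geoC Q.P (Q.V ic) (Q.V g) < 2
      · obtain ⟨g, hg, hgc⟩ := hcon
        have hne : g ≠ ic := by rintro rfl; exact hG0A _ hg hcA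
        have hF : segment ℝ (Q.V g) (Q.V ic) ⊆ Q.P ∧ dist (Q.V g) (Q.V ic) < 2 := by
          rcases hgc with h | h
          · exact F3 hs hne h
          · rw [segment_symm, dist_comm]; exact F3 hs hne.symm h
        exact ⟨G0, Subset.rfl, hG0, fun k hk hk' => absurd hk hk', g, hg, fun z hz =>
          conflict hs h hcl' hN'.pos hc hca hcb hcA (hG0A _ hg) hF.1 hF.2 hz⟩
      · push Not at hcon
        refine ⟨insert ic G0, subset_insert _ _, ?_, ?_, ic, mem_insert _ _, fun z hz =>
          (tri_convex hcT hz).trans hN'.tri⟩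
        · intro i hi j hj hij
          rcases hi with rfl | hi <;> rcases hj with rfl | hj
          · exact absurd rfl hij
          · exact (hcon j hj).2
          · exact (hcon i hi).1
          · exact hG0 i hi j hj hij
        · intro k hk hk'
          exact hk.resolve_right hk'
    obtain ⟨G1, hG01, hG1, hG1c, g, hg, hgT⟩ := step
    have cnt : ∀ B : Set ℂ, B ⊆ A → Q.V ic ∉ B → {k | Q.V k ∈ B}.ncard ≤ N := by
      intro B hB hcB
      have : {k | Q.V k ∈ B} ⊂ {k | Q.V k ∈ A} := by
        refine ⟨fun k hk => hB hk, fun hh => hcB (hh hcA)⟩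
      have := Set.ncard_lt_ncard this (Set.toFinite _)
      omega
    have hc1 := hN'.t1 _ hcT
    have hc2 := hN'.t2 _ hcT
    obtain ⟨G2, hG12, hG2, hG2A, hG2s, -⟩ := ih A1 ia ic O' r' hN'.h1 hcl1 (cnt A1 hN'.sub1 hc1) G1
      hG1 (fun k hk hkA => by
        by_cases hk0 : k ∈ G0
        · exact hG0A k hk0 (hN'.sub1 hkA)
        · rw [hG1c k hk hk0] at hkA; exact hc1 hkA)
    obtain ⟨G3, hG23, hG3, hG3A, hG3s, -⟩ := ih A2 ic ib O' r' hN'.h2 hcl2 (cnt A2 hN'.sub2 hc2) G2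
      hG2 (fun k hk hkA => by
        by_cases hk1 : k ∈ G1
        · by_cases hk0 : k ∈ G0
          · exact hG0A k hk0 (hN'.sub2 hkA)
          · rw [hG1c k hk1 hk0] at hkA; exact hc2 hkA
        · exact hN'.disj12 (hG2A k hk hk1) hkA)
    refine ⟨G3, hG01.trans (hG12.trans hG23), hG3, ?_, ?_, ?_⟩
    · intro k hk hk0
      by_cases hk2 : k ∈ G2
      · by_cases hk1 : k ∈ G1
        · rw [hG1c k hk1 hk0]; exact hcA
        · exact hN'.sub1 (hG2A k hk2 hk1)
      · exact hN'.sub2 (hG3A k hk hk2)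
    · intro z hz
      rcases hN'.cover hz with hz | hz | hz
      · exact ⟨g, hG23 (hG12 hg), hgT z hz⟩
      · obtain ⟨k, hk, hh⟩ := hG2s z hz
        exact ⟨k, hG23 hk, hh⟩
      · exact hG3s z hz
    · intro _ z hz
      exact ⟨g, hG23 (hG12 hg), hgT z (tri_side hN'.pos hz)⟩

end CPoly


namespace CPoly
variable {Q : CPoly}

lemma initial (hs : Q.Sep) {ia ib : ZMod Q.n} (hab : Q.V ia ≠ Q.V ib)
    (hE : segment ℝ (Q.V ia) (Q.V ib) ⊆ Q.P)
    (hh : ∀ x ∈ openSegment ℝ (Q.V ia) (Q.V ib), ∃ ε > 0, ∀ z, dist z x < ε →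
      (z ∈ Q.P ↔ 0 ≤ cr (Q.V ib - Q.V ia) (z - Q.V ia)))
    (hnv : ∀ k, Q.V k ∉ openSegment ℝ (Q.V ia) (Q.V ib))
    (hne : ∃ z ∈ Q.P, z ∉ segment ℝ (Q.V ia) (Q.V ib)) :
    ∃ G, Q.Indep G ∧ ∀ z ∈ Q.P, ∃ k ∈ G, segment ℝ (Q.V k) z ⊆ Q.P := by
  set a := Q.V ia with ha
  set b := Q.V ib with hb
  have hcut : Cut Q (Q.P \ segment ℝ a b) a b := by
    refine ⟨hab, hE, sdiff_subset, fun z hz => hz.2, ?_, ?_, ?_⟩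
    · intro x hx
      obtain ⟨ε, hε, h⟩ := closed_near (closed_seg a b) hx.2
      exact ⟨ε, hε, fun z hz hd => ⟨hz, h z hd⟩⟩
    · intro x hx hx1 hx2
      exact absurd ⟨hx, hx1⟩ hx2
    · intro m hm
      obtain ⟨ε, hε, h⟩ := hh m hm
      refine ⟨ε, hε, fun z hz hd => ⟨fun hp => ⟨hz, fun hc => ?_⟩, fun hn => ?_⟩⟩
      · rw [cr_seg_zero hc] at hp; exact lt_irrefl _ hp
      · have := (h z hd).1 hz; linarith
  have hfin := Q.finite_idx
  -- choose the circle
  obtain ⟨s, hsb⟩ : ∃ s : ℝ, ∀ k, 0 < cr (b - a) (Q.V k - a) →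
      s * cr (b - a) (Q.V k - a) ≤ dp a b (Q.V k) := by
    obtain ⟨s, hs'⟩ := (Set.finite_range fun k => dp a b (Q.V k) / cr (b - a) (Q.V k - a)).bddBelow
    refine ⟨s, fun k hk => ?_⟩
    have := hs' ⟨k, rfl⟩
    exact (le_div_iff₀ hk).1 this
  have hbr : dist b (ctr a b s) = dist a (ctr a b s) := by
    apply dist_of_sq dist_nonneg dist_nonneg
    rw [ctr_pow, cr_self]; simp [dp]
  have hcl : Clear Q a b (ctr a b s) (dist a (ctr a b s)) := by
    refine ⟨rfl, hbr, fun k hk y hy hyk => ?_⟩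
    have hp := ctr_pow a b (Q.V k) s
    have hneg : dp a b (Q.V k) - s * cr (b - a) (Q.V k - a) < 0 := by
      rw [← hp]
      have := pow_lt_pow_left₀ hk dist_nonneg (n := 2) (by norm_num)
      linarith
    rcases lt_trichotomy (cr (b - a) (Q.V k - a)) 0 with h0 | h0 | h0
    · obtain ⟨ε, hε, h⟩ := hh y hy
      have hy0 := cr_seg_zero (openSegment_subset_segment ℝ _ _ hy)
      have hpn : 0 ≤ ‖Q.V k - y‖ := norm_nonneg _
      obtain ⟨τ, τ0, τ1, hτ⟩ : ∃ τ : ℝ, 0 < τ ∧ τ ≤ 1 ∧ dist (y + τ • (Q.V k - y)) y < ε := by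
        refine ⟨min 1 (ε / (2 * (‖Q.V k - y‖ + 1))), by positivity, min_le_left _ _, ?_⟩
        rw [dist_eq_norm, add_sub_cancel_left, norm_smul, Real.norm_eq_abs,
          abs_of_pos (by positivity)]
        have h1 : min 1 (ε / (2 * (‖Q.V k - y‖ + 1))) ≤ ε / (2 * (‖Q.V k - y‖ + 1)) :=
          min_le_right _ _
        calc _ ≤ ε / (2 * (‖Q.V k - y‖ + 1)) * ‖Q.V k - y‖ := by gcongr
          _ < ε := by
            rw [div_mul_eq_mul_div, div_lt_iff₀ (by positivity)]; nlinarith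
      have := (h _ hτ).1 (hyk (seg_mem τ0.le τ1))
      rw [cr_affine, hy0] at this
      nlinarith
    · obtain ⟨t, ht⟩ := cr_eq_zero (sub_ne_zero.2 hab.symm) h0
      have hw : Q.V k = a + t • (b - a) := by rw [← ht]; ring
      have hd : dp a b (Q.V k) = t * (t - 1) * ((b.re - a.re) ^ 2 + (b.im - a.im) ^ 2) := by
        rw [hw]; simp [dp]; ring
      rw [h0, hd] at hneg
      have hq : 0 ≤ (b.re - a.re) ^ 2 + (b.im - a.im) ^ 2 := by positivity
      have ht' : t * (t - 1) < 0 := by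
        by_contra hc
        push Not at hc
        have := mul_nonneg hc hq
        linarith
      have t0 : 0 < t := by nlinarith
      have t1 : t < 1 := by nlinarith
      exact hnv k (openSeg_iff.2 ⟨t, t0, t1, hw⟩)
    · have := hsb k h0; linarith
  obtain ⟨G, -, hG, -, h1, h2⟩ := main_ind hs _ _ ia ib _ _ hcut hcl le_rfl ∅
    (fun i hi => absurd hi (by simp)) (by simp)
  refine ⟨G, hG, fun z hz => ?_⟩
  by_cases hzs : z ∈ segment ℝ a b
  · obtain ⟨w, hw, hw'⟩ := hne
    exact h2 ⟨w, hw, hw'⟩ z hzs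
  · exact h1 z ⟨hz, hzs⟩

theorem main (hs : Q.Sep) :
    ∃ G, Q.Indep G ∧ ∀ z ∈ Q.P, ∃ k ∈ G, segment ℝ (Q.V k) z ⊆ Q.P := by
  obtain ⟨u, hu, hh⟩ := Q.halfE 0
  have hV : Q.V 0 ≠ Q.V (0 + 1) := Q.V_ne_succ 0
  have hE : segment ℝ (Q.V 0) (Q.V (0 + 1)) ⊆ Q.P := Q.E_sub 0
  have hnv : ∀ k, Q.V k ∉ openSegment ℝ (Q.V 0) (Q.V (0 + 1)) := by
    intro k hk
    exact (Q.mem_openSeg.1 hk).2 k rfl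
  have hne : ∃ z ∈ Q.P, z ∉ segment ℝ (Q.V 0) (Q.V (0 + 1)) := by
    refine ⟨Q.V (0 + 2), Q.V_mem _, fun hc => ?_⟩
    have : Q.V (0 + 2) ∈ ({Q.V (0 + 1)} : Set ℂ) := by
      rw [← Q.adj 0]; exact ⟨hc, right_mem_segment _ _ _⟩
    have h1 := Q.V_ne_succ (0 + 1)
    apply h1
    rw [mem_singleton_iff] at this
    rw [← this]; congr 1; ring
  rcases hu with rfl | rfl
  · refine initial hs hV hE (fun x hx => ?_) hnv hne
    obtain ⟨h1, h2⟩ := Q.mem_openSeg.1 hx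
    exact hh x h1 h2
  · refine initial (ia := 0 + 1) (ib := 0) hs hV.symm (by rw [segment_symm]; exact hE)
      (fun x hx => ?_) (by rw [openSegment_symm]; exact hnv) (by rw [segment_symm]; exact hne)
    rw [openSegment_symm] at hx
    obtain ⟨h1, h2⟩ := Q.mem_openSeg.1 hx
    obtain ⟨ε, hε, h⟩ := hh x h1 h2
    refine ⟨ε, hε, fun z hz => ?_⟩
    rw [h z hz]
    have : cr (-Q.dir 0) (z - Q.V 0) = cr (Q.V 0 - Q.V (0 + 1)) (z - Q.V (0 + 1)) := by
      simp only [dir, cr, Complex.neg_re, Complex.neg_im, Complex.sub_re, Complex.sub_im]; ring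
    rw [this]

end CPoly


/-- identification of the plane with `ℂ` -/
def planeIso : Plane ≃ₗᵢ[ℝ] ℂ := Complex.orthonormalBasisOneI.repr.symm

lemma planeIso_segment (p q : Plane) :
    planeIso '' segment ℝ p q = segment ℝ (planeIso p) (planeIso q) :=
  image_segment ℝ (planeIso.toLinearEquiv.toLinearMap.toAffineMap) p q

lemma planeIso_seg_sub (S : Set Plane) (p q : Plane) :
    segment ℝ (planeIso p) (planeIso q) ⊆ planeIso '' S ↔ segment ℝ p q ⊆ S := by
  rw [← planeIso_segment, Set.image_subset_image_iff planeIso.injective]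

lemma planeIso_geo (S : Set Plane) (p q : Plane) :
    geoC (planeIso '' S) (planeIso p) (planeIso q) = geodesicDist S p q := by
  apply le_antisymm
  · refine le_iInf fun γ => le_iInf fun h1 => le_iInf fun h2 => le_iInf fun h3 => le_iInf fun h4 => ?_
    subst h2 h3
    refine (geoC_le (P := planeIso '' S) (γ := planeIso ∘ γ) (planeIso.continuous.comp_continuousOn h1)
      (fun t ht => ⟨γ t, h4 ht, rfl⟩)).trans ?_
    have := (planeIso.lipschitz.lipschitzOnWith (s := univ)).comp_eVariationOn_le
      (g := γ) (s := Icc 0 1) (fun _ _ => mem_univ _)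
    simpa using this
  · refine le_iInf fun γ => le_iInf fun h1 => le_iInf fun h2 => le_iInf fun h3 => le_iInf fun h4 => ?_
    have := (planeIso.symm.lipschitz.lipschitzOnWith (s := univ)).comp_eVariationOn_le
      (g := γ) (s := Icc 0 1) (fun _ _ => mem_univ _)
    refine le_trans ?_ (this.trans (by simp))
    refine iInf_le_of_le (planeIso.symm ∘ γ) (iInf_le_of_le
      (planeIso.symm.continuous.comp_continuousOn h1) (iInf_le_of_le (by simp [h2])
      (iInf_le_of_le (by simp [h3]) (iInf_le _ ?_))))
    intro t ht
    obtain ⟨x, hx, hx'⟩ := h4 ht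
    simpa [← hx'] using hx

/-- The polygon transported to `ℂ`. -/
def SimplePolygon.toC (P : SimplePolygon) : CPoly where
  n := P.n
  three_le := P.three_le
  V := fun i => planeIso (P.vertex i)
  P := planeIso '' P.carrier
  cpt := P.isCompact.image planeIso.continuous
  conn := P.isConnected.image _ planeIso.continuous.continuousOn
  reg := by
    have h1 := planeIso.toHomeomorph.image_closure (interior P.carrier)
    rw [planeIso.toHomeomorph.image_interior] at h1
    have h2 := P.regular
    rw [← P.regular] at h1
    exact h1.le
  fr := by
    have h1 := planeIso.toHomeomorph.image_frontier P.carrier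
    rw [P.frontier_eq, image_iUnion] at h1
    refine h1.symm.trans (iUnion_congr fun i => planeIso_segment _ _)
  inj := planeIso.injective.comp P.vertex_injective
  adj := by
    intro i
    rw [← planeIso_segment, ← planeIso_segment, ← image_inter planeIso.injective,
      P.edges_adjacent, image_singleton]
  disj := by
    intro i j h1 h2 h3
    rw [← planeIso_segment, ← planeIso_segment, disjoint_image_iff planeIso.injective]
    exact P.edges_disjoint i j h1 h2 h3

/-- For every simple polygon whose vertices have pairwise
geodesic distance at least `1`, there is a vertex guard set with dispersion
distance at least `2`. -/
theorem dispersive_agp_simple_polygon (P : SimplePolygon)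
    (hsep : ∀ i j : ZMod P.n, i ≠ j →
      1 ≤ geodesicDist P.carrier (P.vertex i) (P.vertex j)) :
    ∃ G : Set Plane, P.IsVertexGuardSet G ∧
      ∀ g ∈ G, ∀ h ∈ G, g ≠ h → 2 ≤ geodesicDist P.carrier g h := by
  have hs : P.toC.Sep := fun i j hij => by
    have := hsep i j hij
    rw [← planeIso_geo] at this
    exact this
  obtain ⟨G, hG, hsee⟩ := CPoly.main hs
  have hmem : ∀ k, P.vertex k ∈ P.carrier := by
    intro k
    obtain ⟨x, hx, hx'⟩ : planeIso (P.vertex k) ∈ planeIso '' P.carrier := P.toC.V_mem k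
    rw [← planeIso.injective hx']; exact hx
  refine ⟨P.vertex '' G, ⟨image_subset_range _ _, ?_, ?_⟩, ?_⟩
  · rintro _ ⟨k, -, rfl⟩
    exact hmem k
  · intro x hx
    obtain ⟨k, hk, h⟩ := hsee (planeIso x) (mem_image_of_mem _ hx)
    exact ⟨_, ⟨k, hk, rfl⟩, (planeIso_seg_sub _ _ _).1 h⟩
  · rintro _ ⟨i, hi, rfl⟩ _ ⟨j, hj, rfl⟩ hij
    have := hG i hi j hj (fun e => hij (by rw [e]))
    rw [← planeIso_geo]
    exact this
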